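/- There exists an absolute constant κ > 0 and a constant C > 0 such that for all sufficiently large X and every subinterval I′ of I₁ = [(ηX)^{1/2}, X^{1/2}], one has |Σ_{m ∈ I′} ρ(m) − κ|I′|(log X)^{−1}| ≤ C X^{1/2}(log X)^{−2}, where |I′| denotes the length of I′. -/

import Mathlib

open MeasureTheory Finset
open scoped Classical

/-- `e(x) = exp(2πix)`. -/
noncomputable def e (x : ℝ) : ℂ := Complex.exp (2 * Real.pi * Complex.I * x)

/-- Fejér-type kernel `K_τ(α)`. -/
noncomputable def Kf (τ α : ℝ) : ℝ :=
  if α = 0 then τ ^ 2 else (Real.sin (Real.pi * τ * α) / (Real.pi * α)) ^ 2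

/-- `ψ(m,z) = 1` if every prime factor of `m` is `≥ z`, else `0`. -/
noncomputable def psi (m : ℕ) (z : ℝ) : ℝ :=
  if ∀ p : ℕ, p.Prime → p ∣ m → z ≤ (p : ℝ) then 1 else 0

/-- `z(p)` in the sieve weights. -/
noncomputable def zP (X : ℝ) (p : ℕ) : ℝ :=
  if (p : ℝ) < X ^ ((1:ℝ)/7) then X ^ ((5:ℝ)/28) * (p : ℝ) ^ (-(1:ℝ)/2)
  else if (p : ℝ) ≤ X ^ ((3:ℝ)/14) then (p : ℝ)
  else X ^ ((5:ℝ)/14) / (p : ℝ)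

/-- The sieve function `ρ(m)` of Harman–Kumchev. -/
noncomputable def rho (X : ℝ) (m : ℕ) : ℝ :=
  psi m (X ^ ((5:ℝ)/42)) -
    ∑ p ∈ m.primeFactors.filter
        (fun p : ℕ => X ^ ((5:ℝ)/42) ≤ (p:ℝ) ∧ (p:ℝ) ≤ X ^ ((1:ℝ)/4)),
      psi (m / p) (zP X p)

/-- `S_k(α) = Σ_{p ∈ [(ηX)^{1/k}, X^{1/k}]} (log p) e(p^k α)`, sum over primes. -/
noncomputable def SS (η X : ℝ) (k : ℕ) (α : ℝ) : ℂ :=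
  ∑ p ∈ (Finset.Icc 1 ⌊X ^ ((1:ℝ)/(k:ℝ))⌋₊).filter
      (fun p : ℕ => p.Prime ∧ (η * X) ^ ((1:ℝ)/(k:ℝ)) ≤ (p : ℝ)),
    (Real.log p : ℂ) * e ((p : ℝ) ^ k * α)

/-- `S₂(α, ρ) = Σ_{m ∈ [(ηX)^{1/2}, X^{1/2}]} ρ(m) e(m²α)`. -/
noncomputable def S2 (η X α : ℝ) : ℂ :=
  ∑ m ∈ (Finset.Icc 1 ⌊X ^ ((1:ℝ)/2)⌋₊).filter
      (fun m : ℕ => (η * X) ^ ((1:ℝ)/2) ≤ (m : ℝ)),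
    (rho X m : ℂ) * e ((m : ℝ) ^ 2 * α)

/-- `S_r(α)` for real `r ≥ 1`. -/
noncomputable def Sr (η X r α : ℝ) : ℂ :=
  ∑ p ∈ (Finset.Icc 1 ⌊X ^ (1/r)⌋₊).filter
      (fun p : ℕ => p.Prime ∧ (η * X) ^ (1/r) ≤ (p : ℝ)),
    (Real.log p : ℂ) * e ((p : ℝ) ^ r * α)

/-- `U_r(α)` for real `r ≥ 1`. -/
noncomputable def Ur (η X r α : ℝ) : ℂ :=
  ∑ n ∈ (Finset.Icc 1 ⌊X ^ (1/r)⌋₊).filter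
      (fun n : ℕ => (η * X) ^ (1/r) ≤ (n : ℝ)),
    e ((n : ℝ) ^ r * α)

/-- Chebyshev's function `θ(x) = Σ_{p ≤ x} log p`. -/
noncomputable def theta (x : ℝ) : ℝ :=
  ∑ p ∈ (Finset.Icc 1 ⌊x⌋₊).filter Nat.Prime, Real.log p

/-- `J_r(X,h)`. -/
noncomputable def J (ε r X h : ℝ) : ℝ :=
  ∫ x in Set.Icc (ε * X) X,
    (theta ((x + h) ^ (1/r)) - theta (x ^ (1/r)) - ((x + h) ^ (1/r) - x ^ (1/r))) ^ 2

/-- `T_n(α) = ∫_{(ηX)^{1/n}}^{X^{1/n}} e(t^n α) dt`. -/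
noncomputable def T (η X : ℝ) (n : ℕ) (α : ℝ) : ℂ :=
  ∫ t in Set.Icc ((η * X) ^ ((1:ℝ)/(n:ℝ))) (X ^ ((1:ℝ)/(n:ℝ))), e (t ^ n * α)

/-- `m₁(k)`. -/
noncomputable def m1 (k : ℕ) : ℝ :=
  if k = 5 then 2 * (⌈343 * (k:ℝ) / 50 - 20⌉ : ℝ)
  else 2 * (⌈(49 * (k:ℝ) / 50 - (⌊49 * (k:ℝ) / 50⌋ : ℝ) / 2)
      * ((⌊49 * (k:ℝ) / 50⌋ : ℝ) + 1)⌉ : ℝ)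

/-- `σ(k) = 44/45 − 24/(25 m₁(k))`. -/
noncomputable def sigma' (k : ℕ) : ℝ := 44/45 - 24 / (25 * m1 k)

/-- `m(k)` depending on `δ`. -/
noncomputable def mδ (k : ℕ) (δ : ℝ) : ℝ :=
  if ⌊(k:ℝ) * δ⌋ ≤ 3 then
    2 * (⌈((k:ℝ) * δ + 1 - (⌊(k:ℝ) * δ⌋ : ℝ)) * (2:ℝ) ^ (⌊(k:ℝ) * δ - 1⌋)⌉ : ℝ)
  else if ⌊(k:ℝ) * δ⌋ = 4 then 2 * (⌈7 * (k:ℝ) * δ - 20⌉ : ℝ)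
  else 2 * (⌈((k:ℝ) * δ - (⌊(k:ℝ) * δ⌋ : ℝ)/2) * ((⌊(k:ℝ) * δ⌋ : ℝ) + 1)⌉ : ℝ)

/-- `m₂(k)`. -/
noncomputable def m2 (k : ℕ) : ℝ :=
  if k = 5 then
    2 * (⌈(2 * (k:ℝ)/3 + 1 - (⌊2 * (k:ℝ)/3⌋ : ℝ)) * (2:ℝ) ^ (⌊2 * (k:ℝ)/3⌋ - 1)⌉ : ℝ)
  else if k ≤ 7 then 2 * (⌈14 * (k:ℝ)/3 - 20⌉ : ℝ)
  else 2 * (⌈(2 * (k:ℝ)/3 - (⌊2 * (k:ℝ)/3⌋ : ℝ)/2) * ((⌊2 * (k:ℝ)/3⌋ : ℝ) + 1)⌉ : ℝ)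

namespace PNTaux
open Complex Filter Topology Asymptotics

/-- fractional part beyond `N`. -/
noncomputable def fN (N : ℕ) (x : ℝ) : ℂ := Set.indicator (Set.Ioi (N:ℝ)) (fun x => ((Int.fract x : ℝ) : ℂ)) x

lemma fN_norm_le (N : ℕ) (x : ℝ) : ‖fN N x‖ ≤ 1 := by
  unfold fN
  by_cases h : x ∈ Set.Ioi (N:ℝ)
  · rw [Set.indicator_of_mem h, Complex.norm_real, Real.norm_eq_abs, abs_of_nonneg (Int.fract_nonneg x)]
    exact (Int.fract_lt_one x).le
  · rw [Set.indicator_of_notMem h]; simp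

lemma fN_meas (N : ℕ) : Measurable (fN N) := by
  unfold fN
  exact (Complex.measurable_ofReal.comp measurable_fract).indicator measurableSet_Ioi

/-- `E_N(s) = ∫_N^∞ {x} x^{-s-1}`. -/
noncomputable def EN (N : ℕ) (s : ℂ) : ℂ := mellin (fN N) (-s)

lemma EN_diff (N : ℕ) (hN : 1 ≤ N) {s : ℂ} (hs : 0 < s.re) : DifferentiableAt ℂ (EN N) s := by
  have h : DifferentiableAt ℂ (mellin (fN N)) (-s) := by
    apply mellin_differentiableAt_of_isBigO_rpow (a := 0) (b := -s.re - 1)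
    · apply (locallyIntegrable_const (1:ℝ)).locallyIntegrableOn (Set.Ioi 0) |>.mono (fN_meas N).aestronglyMeasurable
      exact Filter.Eventually.of_forall (fun x => by simpa using fN_norm_le N x)
    · simp only [neg_zero, Real.rpow_zero]
      exact IsBigO.of_bound 1 (Eventually.of_forall fun x => by simpa using fN_norm_le N x)
    · simpa using hs
    · apply IsBigO.of_bound 1
      have : ∀ᶠ x : ℝ in 𝓝[>] 0, x ∈ Set.Ioo (0:ℝ) 1 := Ioo_mem_nhdsGT one_pos
      filter_upwards [this] with x hx
      have : fN N x = 0 := by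
        unfold fN; rw [Set.indicator_of_notMem]; simp
        have : (1:ℝ) ≤ N := by exact_mod_cast hN
        linarith [hx.2]
      rw [this]; simp
    · simp
  exact h.comp s (by fun_prop)

lemma EN_eq (N : ℕ) (s : ℂ) : EN N s = ∫ x in Set.Ioi (N:ℝ), (x:ℂ)^(-(s+1)) * ((Int.fract x : ℝ) : ℂ) := by
  unfold EN mellin
  have : ∀ t : ℝ, (t:ℂ)^(-s-1) • fN N t = Set.indicator (Set.Ioi (N:ℝ)) (fun x => (x:ℂ)^(-(s+1)) * ((Int.fract x : ℝ) : ℂ)) t := by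
    intro t
    unfold fN
    by_cases h : t ∈ Set.Ioi (N:ℝ)
    · rw [Set.indicator_of_mem h, Set.indicator_of_mem h]; simp; left; congr 1; ring
    · rw [Set.indicator_of_notMem h, Set.indicator_of_notMem h]; simp
  simp_rw [this]
  rw [integral_indicator measurableSet_Ioi, Measure.restrict_restrict measurableSet_Ioi]
  congr 2
  ext x; simp

lemma EN_integrable (N : ℕ) (hN : 1 ≤ N) {s : ℂ} (hs : 0 < s.re) :
    IntegrableOn (fun x : ℝ => (x:ℂ)^(-(s+1)) * ((Int.fract x : ℝ) : ℂ)) (Set.Ioi (N:ℝ)) := by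
  have hN' : (0:ℝ) < N := by exact_mod_cast hN
  have h1 := integrableOn_Ioi_cpow_of_lt (a := -(s+1)) (by simp; linarith) hN'
  refine h1.mul_bdd (c := 1) ?_ ?_
  · exact (Complex.measurable_ofReal.comp measurable_fract).aestronglyMeasurable
  · refine Eventually.of_forall fun x => ?_
    rw [Complex.norm_real, Real.norm_eq_abs, abs_of_nonneg (Int.fract_nonneg x)]
    exact (Int.fract_lt_one x).le

lemma EN_bound (N : ℕ) (hN : 1 ≤ N) {s : ℂ} (hs : 0 < s.re) : ‖EN N s‖ ≤ (N:ℝ)^(-s.re) / s.re := by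
  have hN' : (0:ℝ) < N := by exact_mod_cast hN
  rw [EN_eq]
  calc _ ≤ ∫ x in Set.Ioi (N:ℝ), x^(-(s.re+1)) := by
        apply norm_integral_le_of_norm_le
        · exact integrableOn_Ioi_rpow_of_lt (by linarith) hN'
        · filter_upwards [ae_restrict_mem measurableSet_Ioi] with x hx
          have hx0 : 0 < x := hN'.trans hx
          rw [norm_mul, Complex.norm_cpow_eq_rpow_re_of_pos hx0, Complex.norm_real, Real.norm_eq_abs, abs_of_nonneg (Int.fract_nonneg x)]
          have := (Int.fract_lt_one x).le
          have h2 := Int.fract_nonneg x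
          simp only [neg_re, add_re, one_re]
          have : 0 ≤ x ^ (-(s.re+1)) := by positivity
          nlinarith
    _ = _ := by
        rw [integral_Ioi_rpow_of_lt (by linarith) hN']
        have : -(s.re+1)+1 = -s.re := by ring
        rw [this]; field_simp

lemma zeta_formula1 (N : ℕ) (hN : 1 ≤ N) {s : ℂ} (hs : 1 < s.re) :
    riemannZeta s = ∑ n ∈ Finset.Icc 1 N, (n:ℂ)^(-s) + (N:ℂ)^(1-s)/(s-1) - s * EN N s := by
  have hN' : (0:ℝ) < N := by exact_mod_cast hN
  have hN1 : (1:ℝ) ≤ N := by exact_mod_cast hN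
  have hNC : (N:ℂ) ≠ 0 := by exact_mod_cast hN'.ne'
  have hs0 : s ≠ 0 := by rintro rfl; simp at hs; linarith
  have hs1 : s - 1 ≠ 0 := by
    intro h; have : s = 1 := by linear_combination h
    rw [this] at hs; simp at hs
  set f : ℕ → ℝ := fun n => if N < n then 1 else 0 with hf
  have hfnn : ∀ n, 0 ≤ f n := fun n => by simp only [hf]; split_ifs <;> norm_num
  have hsum : ∀ n : ℕ, ∑ k ∈ Finset.Icc 1 n, f k = ((n - N : ℕ) : ℝ) := by
    intro n
    simp only [hf]
    rw [Finset.sum_ite]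
    simp
    have : (Finset.filter (fun x => N < x) (Finset.Icc 1 n)) = Finset.Ioc N n := by
      ext x; simp; omega
    rw [this]; simp
  have hO : (fun n ↦ ∑ k ∈ Finset.Icc 1 n, f k) =O[atTop] fun n : ℕ ↦ (n : ℝ) ^ (1:ℝ) := by
    apply IsBigO.of_bound 1
    refine Eventually.of_forall fun n => ?_
    rw [hsum]
    simp only [Real.rpow_one, one_mul, Real.norm_natCast]
    exact_mod_cast Nat.sub_le n N
  have hL := LSeries_eq_mul_integral_of_nonneg f zero_le_one hs hO hfnn
  have e1 : LSeries (fun n ↦ (f n : ℂ)) s = riemannZeta s - ∑ n ∈ Finset.Icc 1 N, (n:ℂ)^(-s) := by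
    rw [zeta_eq_tsum_one_div_nat_cpow hs]
    have hsm : Summable (fun n : ℕ => 1 / (n:ℂ)^s) := Complex.summable_one_div_nat_cpow.mpr hs
    rw [← hsm.sum_add_tsum_compl (s := Finset.Icc 1 N)]
    have : ∑ n ∈ Finset.Icc 1 N, 1 / (n:ℂ)^s = ∑ n ∈ Finset.Icc 1 N, (n:ℂ)^(-s) := by
      apply Finset.sum_congr rfl; intro n _; rw [cpow_neg, one_div]
    rw [this, add_sub_cancel_left]
    rw [LSeries]
    rw [show (∑' x : ↥((Finset.Icc 1 N : Finset ℕ) : Set ℕ)ᶜ, 1 / ((x:ℕ):ℂ)^s) = ∑' n : ℕ, Set.indicator (((Finset.Icc 1 N : Finset ℕ) : Set ℕ)ᶜ) (fun n : ℕ => 1/(n:ℂ)^s) n from _root_.tsum_subtype (((Finset.Icc 1 N : Finset ℕ) : Set ℕ)ᶜ) (fun n : ℕ => 1/(n:ℂ)^s)]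
    apply tsum_congr
    intro n
    rcases Nat.eq_zero_or_pos n with h0 | h0
    · subst h0; simp [hs0]
    · rw [LSeries.term_of_ne_zero h0.ne']
      by_cases h : N < n
      · rw [Set.indicator_of_mem (by simp; intro _; exact h)]; simp [hf, h]
      · rw [Set.indicator_of_notMem (by simp; omega)]; simp [hf, h]
  have e2 : ∫ t in Set.Ioi (1 : ℝ), (∑ k ∈ Finset.Icc 1 ⌊t⌋₊, (f k : ℂ)) * (t:ℂ) ^ (-(s + 1))
      = ∫ t in Set.Ioi (N : ℝ), ((t:ℂ)^(-s) - N * (t:ℂ)^(-(s+1)) - (t:ℂ)^(-(s+1)) * ((Int.fract t : ℝ) : ℂ)) := by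
    have : ∀ t : ℝ, 1 < t → (∑ k ∈ Finset.Icc 1 ⌊t⌋₊, (f k : ℂ)) * (t:ℂ) ^ (-(s + 1)) = Set.indicator (Set.Ioi (N:ℝ)) (fun t : ℝ => ((t:ℂ)^(-s) - N * (t:ℂ)^(-(s+1)) - (t:ℂ)^(-(s+1)) * ((Int.fract t : ℝ) : ℂ))) t := by
      intro t ht
      have h1 : ∑ k ∈ Finset.Icc 1 ⌊t⌋₊, (f k : ℂ) = ((⌊t⌋₊ - N : ℕ) : ℂ) := by
        have := hsum ⌊t⌋₊
        exact_mod_cast congrArg (fun x : ℝ => (x:ℂ)) this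
      rw [h1]
      have ht0 : (t:ℂ) ≠ 0 := by exact_mod_cast (by linarith : t ≠ 0)
      by_cases h : (N:ℝ) < t
      · rw [Set.indicator_of_mem (by exact h)]
        have h2 : N ≤ ⌊t⌋₊ := Nat.le_floor h.le
        rw [Nat.cast_sub h2]
        have h3 : (Int.fract t : ℝ) = t - (⌊t⌋₊ : ℝ) := by
          rw [Int.fract, natCast_floor_eq_intCast_floor (by linarith)]
        rw [h3]
        have h4 : (t:ℂ)^(-s) = t * (t:ℂ)^(-(s+1)) := by
          rw [show -s = -(s+1) + 1 by ring, cpow_add _ _ ht0, cpow_one, mul_comm]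
        rw [h4]; push_cast; ring
      · rw [Set.indicator_of_notMem (by exact h)]
        have : ⌊t⌋₊ - N = 0 := by
          rw [Nat.sub_eq_zero_iff_le]
          have : ⌊t⌋₊ ≤ ⌊(N:ℝ)⌋₊ := Nat.floor_mono (not_lt.mp h)
          simpa using this
        rw [this]; simp
    rw [setIntegral_congr_fun measurableSet_Ioi (fun t ht => this t ht)]
    rw [integral_indicator measurableSet_Ioi, Measure.restrict_restrict measurableSet_Ioi]
    congr 2
    ext x; simp; intro h; linarith
  have i1 := integrableOn_Ioi_cpow_of_lt (a := -s) (by simp; linarith) hN'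
  have i2 := integrableOn_Ioi_cpow_of_lt (a := -(s+1)) (by simp; linarith) hN'
  have i3 := EN_integrable N hN (s := s) (by linarith)
  have i12 : IntegrableOn (fun t : ℝ => (t:ℂ)^(-s) - N * (t:ℂ)^(-(s+1))) (Set.Ioi (N:ℝ)) := i1.sub (i2.const_mul _)
  rw [e1, e2, integral_sub i12 i3, integral_sub i1 (i2.const_mul _), ← EN_eq,
    integral_const_mul, integral_Ioi_cpow_of_lt (by simp; linarith) hN', integral_Ioi_cpow_of_lt (by simp; linarith) hN'] at hL
  have h5 : (N:ℂ)^(-(s+1)+1) = (N:ℂ)^(1-s) / N := by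
    rw [show -(s+1)+1 = (1 - s) - 1 by ring, cpow_sub _ _ hNC, cpow_one]
  have h6 : (N:ℂ)^(-s+1) = (N:ℂ)^(1-s) := by congr 1; ring
  simp only [ofReal_natCast] at hL
  rw [h5, h6] at hL
  have h7 : -s + 1 ≠ 0 := by intro h; apply hs1; linear_combination -h
  have h8 : -(s+1)+1 ≠ 0 := by intro h; apply hs0; linear_combination -h
  have : s * (-(N:ℂ)^(1-s)/(-s+1) - N * (-((N:ℂ)^(1-s)/N)/(-(s+1)+1)) - EN N s) = (N:ℂ)^(1-s)/(s-1) - s * EN N s := by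
    have : -(s+1)+1 = -s := by ring
    rw [this]
    have : -s+1 = -(s-1) := by ring
    rw [this]
    field_simp
    ring
  rw [this] at hL
  linear_combination hL

end PNTaux

namespace PNTaux
open Complex Filter Topology Asymptotics

lemma zeta_formula (N : ℕ) (hN : 1 ≤ N) {s : ℂ} (hs : 0 < s.re) (hs1 : s ≠ 1) :
    riemannZeta s = ∑ n ∈ Finset.Icc 1 N, (n:ℂ)^(-s) + (N:ℂ)^(1-s)/(s-1) - s * EN N s := by
  have hN' : (0:ℝ) < N := by exact_mod_cast hN
  have hNC : (N:ℂ) ≠ 0 := by exact_mod_cast hN'.ne'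
  set U : Set ℂ := {s | 0 < s.re} with hU
  have hUo : IsOpen U := isOpen_lt continuous_const Complex.continuous_re
  have hUc : IsPreconnected U := (convex_halfSpace_re_gt 0).isPreconnected
  set g : ℂ → ℂ := fun s => (s-1) * ∑ n ∈ Finset.Icc 1 N, (n:ℂ)^(-s) + (N:ℂ)^(1-s) - (s-1) * (s * EN N s) with hg
  have hgd : DifferentiableOn ℂ g U := by
    intro z hz
    apply DifferentiableAt.differentiableWithinAt
    have h1 := EN_diff N hN (s := z) hz
    have h2 : DifferentiableAt ℂ (fun s : ℂ => ∑ n ∈ Finset.Icc 1 N, (n:ℂ)^(-s)) z := by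
      apply DifferentiableAt.fun_sum
      intro n hn
      apply DifferentiableAt.const_cpow (by fun_prop)
      left
      have : 1 ≤ n := (Finset.mem_Icc.mp hn).1
      exact_mod_cast (by omega : n ≠ 0)
    have h3 : DifferentiableAt ℂ (fun s : ℂ => (N:ℂ)^(1-s)) z := DifferentiableAt.const_cpow (by fun_prop) (Or.inl hNC)
    simp only [hg]
    fun_prop
  have hga := hgd.analyticOnNhd hUo
  have hza : AnalyticOnNhd ℂ riemannZeta₁ U := differentiable_riemannZeta₁.differentiableOn.analyticOnNhd hUo
  have key := hza.eqOn_of_preconnected_of_eventuallyEq hga hUc (z₀ := 2) (by simp [hU]) (by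
    have : {s : ℂ | 1 < s.re} ∈ 𝓝 (2:ℂ) := (isOpen_lt continuous_const Complex.continuous_re).mem_nhds (by simp)
    filter_upwards [this] with z hz
    have hz1 : z ≠ 1 := by rintro rfl; simp at hz
    have h := zeta_formula1 N hN hz
    rw [riemannZeta_eq_inv_sub_mul hz1] at h
    have h0 : z - 1 ≠ 0 := sub_ne_zero.mpr hz1
    simp only [hg]
    field_simp at h
    linear_combination h)
  have h := key hs
  rw [riemannZeta_eq_inv_sub_mul hs1, h]
  have h0 : s - 1 ≠ 0 := sub_ne_zero.mpr hs1
  simp only [hg]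
  field_simp

lemma sum_rpow_le (N : ℕ) {δ : ℝ} (hδ : 0 < δ) (hδ1 : δ ≤ 1) :
    ∑ n ∈ Finset.Icc 1 N, (n:ℝ)^(δ - 1) ≤ (N:ℝ)^δ / δ := by
  induction N with
  | zero => simp; positivity
  | succ k ih =>
    rw [Finset.sum_Icc_succ_top (by omega)]
    have : ((k+1:ℕ):ℝ)^(δ-1) ≤ ((k+1:ℕ):ℝ)^δ/δ - (k:ℝ)^δ/δ := by
      -- Bernoulli: k^δ ≤ (k+1)^δ (1 - δ/(k+1))
      have hk : (0:ℝ) < (k+1:ℕ) := by positivity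
      have h1 : ((k:ℝ)/((k+1:ℕ):ℝ))^δ ≤ 1 - δ/((k+1:ℕ):ℝ) := by
        have := rpow_one_add_le_one_add_mul_self (s := -1/((k+1:ℕ):ℝ)) (p := δ) (by rw [le_div_iff₀ hk]; push_cast; linarith [Nat.cast_nonneg (α := ℝ) k]) hδ.le hδ1
        have e : 1 + -1/((k+1:ℕ):ℝ) = (k:ℝ)/((k+1:ℕ):ℝ) := by field_simp; push_cast; ring
        rw [e] at this
        refine this.trans (le_of_eq ?_); ring
      rw [Real.div_rpow (by positivity) (by positivity), div_le_iff₀ (by positivity)] at h1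
      rw [Real.rpow_sub hk, Real.rpow_one, ← sub_div, div_le_div_iff₀ hk hδ]
      have : (1 - δ/((k+1:ℕ):ℝ)) * ((k+1:ℕ):ℝ)^δ * ((k+1:ℕ):ℝ) = ((k+1:ℕ):ℝ)^δ * ((k+1:ℕ):ℝ) - δ * ((k+1:ℕ):ℝ)^δ := by
        field_simp
      nlinarith [mul_le_mul_of_nonneg_right h1 hk.le]
    linarith

lemma zeta_bound {δ : ℝ} (hδ : 0 < δ) (hδ1 : δ ≤ 1/2) : ∃ C > 0, ∀ s : ℂ, 1 - δ ≤ s.re → s.re ≤ 4 →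
    1 ≤ |s.im| → ‖riemannZeta s‖ ≤ C * |s.im|^δ := by
  refine ⟨2/δ + 2 + 10, by positivity, fun s h1 h2 h3 => ?_⟩
  set t := |s.im| with ht
  set N := ⌈t⌉₊ with hN
  have hN1 : 1 ≤ N := Nat.one_le_ceil_iff.mpr (by linarith)
  have hNt : t ≤ N := Nat.le_ceil t
  have hNt2 : (N:ℝ) ≤ 2 * t := by have := (Nat.ceil_lt_add_one (by linarith : 0 ≤ t)).le; linarith
  have hN0 : (0:ℝ) < N := by exact_mod_cast hN1
  have hN1' : (1:ℝ) ≤ N := by exact_mod_cast hN1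
  have hs1 : s ≠ 1 := by rintro rfl; simp [ht] at h3; linarith
  have hNδ : (N:ℝ)^δ ≤ 2 * t^δ := by
    calc (N:ℝ)^δ ≤ (2*t)^δ := Real.rpow_le_rpow hN0.le hNt2 hδ.le
      _ = 2^δ * t^δ := Real.mul_rpow (by norm_num) (by linarith)
      _ ≤ 2 * t^δ := by
        gcongr
        calc (2:ℝ)^δ ≤ 2^(1:ℝ) := Real.rpow_le_rpow_of_exponent_le (by norm_num) (by linarith)
          _ = 2 := by simp
  rw [zeta_formula N hN1 (by linarith) hs1]
  have b1 : ‖∑ n ∈ Finset.Icc 1 N, (n:ℂ)^(-s)‖ ≤ 2/δ * t^δ := by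
    calc _ ≤ ∑ n ∈ Finset.Icc 1 N, (n:ℝ)^(δ-1) := by
          apply norm_sum_le_of_le
          intro n hn
          have : 1 ≤ n := (Finset.mem_Icc.mp hn).1
          have hn1 : (1:ℝ) ≤ n := by exact_mod_cast this
          rw [Complex.norm_natCast_cpow_of_pos (by omega)]
          apply Real.rpow_le_rpow_of_exponent_le hn1
          simp; linarith
      _ ≤ (N:ℝ)^δ/δ := sum_rpow_le N hδ (by linarith)
      _ ≤ (2 * t^δ)/δ := by gcongr
      _ = _ := by ring
  have him : t ≤ ‖s - 1‖ := by
    have := Complex.abs_im_le_norm (s-1); simpa [ht] using this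
  have b2 : ‖(N:ℂ)^(1-s)/(s-1)‖ ≤ 2 * t^δ := by
    rw [norm_div, Complex.norm_natCast_cpow_of_pos (by omega)]
    calc _ ≤ (N:ℝ)^δ / 1 := by
          gcongr
          · simp; linarith
          · linarith
      _ ≤ _ := by rw [div_one]; exact hNδ
  have b3 : ‖s * EN N s‖ ≤ 10 * t^δ := by
    rw [norm_mul]
    have hs : ‖s‖ ≤ 5 * t := by
      have := Complex.norm_le_abs_re_add_abs_im s
      rw [abs_of_nonneg (by linarith : 0 ≤ s.re)] at this
      linarith
    have hE := EN_bound N hN1 (s := s) (by linarith)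
    have hE2 : ‖EN N s‖ ≤ 2 * (t^δ / t) := by
      refine hE.trans ?_
      calc (N:ℝ)^(-s.re)/s.re ≤ (N:ℝ)^(δ-1) / (1/2) := by
            gcongr
            · linarith
            · linarith
        _ ≤ t^(δ-1)/(1/2) := by
            gcongr 1
            exact Real.rpow_le_rpow_of_nonpos (by linarith) hNt (by linarith)
        _ = _ := by rw [Real.rpow_sub (by linarith), Real.rpow_one]; ring
    have ht0 : 0 < t := by linarith
    calc _ ≤ (5*t) * (2 * (t^δ/t)) := by gcongr
      _ = _ := by field_simp; norm_num
  calc _ ≤ ‖∑ n ∈ Finset.Icc 1 N, (n:ℂ)^(-s)‖ + ‖(N:ℂ)^(1-s)/(s-1)‖ + ‖s * EN N s‖ := by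
        refine (norm_sub_le _ _).trans ?_
        gcongr; exact norm_add_le _ _
    _ ≤ _ := by linarith

end PNTaux

namespace PNTaux
open Complex Filter Topology Asymptotics

lemma zeta_341 {x : ℝ} (hx : 0 < x) (y : ℝ) :
    1 ≤ ‖riemannZeta (1+x)‖^3 * ‖riemannZeta (1 + x + I*y)‖^4 * ‖riemannZeta (1 + x + 2*I*y)‖ := by
  have h := DirichletCharacter.norm_LFunction_product_ge_one (N := 1) (1 : DirichletCharacter ℂ 1) hx y
  have e : ∀ χ : DirichletCharacter ℂ 1, DirichletCharacter.LFunction χ = riemannZeta := fun χ => DirichletCharacter.LFunction_modOne_eq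
  simp only [DirichletCharacter.LFunctionTrivChar, e] at h
  rw [norm_mul, norm_mul, norm_pow, norm_pow] at h
  exact h

lemma zeta_real_bound : ∃ C > 0, ∀ x : ℝ, 0 < x → x ≤ 1 → ‖riemannZeta (1+x)‖ ≤ C / x := by
  have hc : Continuous (fun x : ℝ => riemannZeta₁ (1+x)) := by
    have := differentiable_riemannZeta₁.continuous
    fun_prop
  obtain ⟨C, hC⟩ := (isCompact_Icc (a := (0:ℝ)) (b := 1)).exists_bound_of_continuousOn hc.continuousOn
  refine ⟨|C|+1, by positivity, fun x h0 h1 => ?_⟩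
  have h := hC x ⟨h0.le, h1⟩
  have hne : (1:ℂ) + x ≠ 1 := by simpa using h0.ne'
  rw [riemannZeta_eq_inv_sub_mul hne, norm_mul, norm_inv]
  simp only [add_sub_cancel_left, norm_real, Real.norm_eq_abs, abs_of_pos h0]
  rw [inv_mul_eq_div]
  gcongr
  linarith [le_abs_self C]

lemma zeta_deriv_bound {δ : ℝ} (hδ : 0 < δ) (hδ1 : δ ≤ 1/2) : ∃ C > 0, ∀ s : ℂ, 1 - δ/2 ≤ s.re → s.re ≤ 3 →
    2 ≤ |s.im| → ‖deriv riemannZeta s‖ ≤ C * |s.im|^δ := by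
  obtain ⟨C, hC, h⟩ := zeta_bound hδ hδ1
  refine ⟨C * 2 / (δ/2), by positivity, fun s h1 h2 h3 => ?_⟩
  have hball : ∀ z : ℂ, ‖z - s‖ ≤ δ/2 → |z.re - s.re| ≤ δ/2 ∧ |z.im - s.im| ≤ δ/2 := fun z hz =>
    ⟨by simpa using (Complex.abs_re_le_norm (z-s)).trans hz, by simpa using (Complex.abs_im_le_norm (z-s)).trans hz⟩
  have him : ∀ z : ℂ, ‖z - s‖ ≤ δ/2 → 1 ≤ |z.im| ∧ |z.im| ≤ 2 * |s.im| ∧ 1 - δ ≤ z.re ∧ z.re ≤ 4 := by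
    intro z hz
    obtain ⟨a, b⟩ := hball z hz
    have c1 := abs_sub_abs_le_abs_sub z.im s.im
    have c2 := abs_sub_abs_le_abs_sub s.im z.im
    rw [abs_sub_comm s.im] at c2
    rw [abs_le] at a
    refine ⟨by linarith, by linarith, by linarith [a.1], by linarith [a.2]⟩
  have hd : DiffContOnCl ℂ riemannZeta (Metric.ball s (δ/2)) := by
    apply DifferentiableOn.diffContOnCl
    rw [closure_ball _ (by positivity)]
    intro z hz
    rw [Metric.mem_closedBall, dist_eq_norm] at hz
    apply (differentiableAt_riemannZeta ?_).differentiableWithinAt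
    rintro rfl
    have := (him _ hz).1
    simp at this; linarith
  have := norm_deriv_le_of_forall_mem_sphere_norm_le (C := C * 2 * |s.im|^δ) (by positivity : 0 < δ/2) hd (by
    intro z hz
    rw [mem_sphere_iff_norm] at hz
    obtain ⟨a, b, c, d⟩ := him z hz.le
    refine (h z c d a).trans ?_
    rw [mul_assoc]
    gcongr
    calc |z.im|^δ ≤ (2 * |s.im|)^δ := by gcongr
      _ = 2^δ * |s.im|^δ := Real.mul_rpow (by norm_num) (by positivity)
      _ ≤ 2 * |s.im|^δ := by
        gcongr
        calc (2:ℝ)^δ ≤ 2^(1:ℝ) := Real.rpow_le_rpow_of_exponent_le (by norm_num) (by linarith)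
          _ = 2 := by simp)
  refine this.trans (le_of_eq ?_)
  ring

lemma zeta_lower {δ : ℝ} (hδ : 0 < δ) (hδ1 : δ ≤ 1/2) : ∃ c > 0, c ≤ δ/2 ∧ ∀ s : ℂ, 2 ≤ |s.im| →
    1 - c * |s.im|^(-5*δ) ≤ s.re → s.re ≤ 2 → c * |s.im|^(-4*δ) ≤ ‖riemannZeta s‖ := by
  obtain ⟨A, hA, hA'⟩ := zeta_real_bound
  obtain ⟨B, hB, hB'⟩ := zeta_bound hδ hδ1
  obtain ⟨D, hD, hD'⟩ := zeta_deriv_bound hδ hδ1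
  -- c₁ x^3 t^{-δ} ≤ |ζ|^4
  set c₁ : ℝ := 1/(A^3*(B*2)) with hc₁
  have hc₁0 : 0 < c₁ := by positivity
  set c₀ : ℝ := min (δ/2) (c₁/(4*D)^4) with hc₀
  have hc₀0 : 0 < c₀ := lt_min (by positivity) (by positivity)
  have low1 : ∀ x y : ℝ, 0 < x → x ≤ 1 → 2 ≤ |y| → c₁ * x^3 * |y|^(-δ) ≤ ‖riemannZeta (1+x+I*y)‖^4 := by
    intro x y hx hx1 hy
    have h := zeta_341 hx y
    have h1 := hA' x hx hx1
    have h2 := hB' (1+x+2*I*y) (by simp; linarith) (by simp; linarith) (by simp; linarith)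
    have h3 : |(1+x+2*I*y : ℂ).im|^δ ≤ 2 * |y|^δ := by
      have : |(1+x+2*I*y : ℂ).im| = 2 * |y| := by simp [abs_mul]
      rw [this, Real.mul_rpow (by norm_num) (by positivity)]
      gcongr
      calc (2:ℝ)^δ ≤ 2^(1:ℝ) := Real.rpow_le_rpow_of_exponent_le (by norm_num) (by linarith)
          _ = 2 := by simp
    have h4 : 1 ≤ (A/x)^3 * ‖riemannZeta (1+x+I*y)‖^4 * (B * (2 * |y|^δ)) := by
      refine h.trans ?_
      gcongr
      exact h2.trans (by gcongr)
    have hy0 : 0 < |y|^δ := by positivity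
    rw [Real.rpow_neg (by positivity), hc₁]
    rw [div_pow] at h4
    have : 1/(A^3*(B*2)) * x^3 * (|y|^δ)⁻¹ = 1 * (x^3 / (A^3 * (B*(2*|y|^δ)))) := by field_simp
    rw [this]
    calc _ ≤ (A^3/x^3 * ‖riemannZeta (1+x+I*y)‖^4 * (B * (2 * |y|^δ))) * (x^3 / (A^3 * (B*(2*|y|^δ)))) := by gcongr
      _ = _ := by field_simp
  have low2 : ∀ x y : ℝ, 2 ≤ |y| → c₀ * |y|^(-5*δ) ≤ x → x ≤ 1 → 4 * D * (c₀ * |y|^(-5*δ)) * |y|^δ ≤ ‖riemannZeta (1+x+I*y)‖ := by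
    intro x y hy hx hx1
    have hy0 : 0 < |y| := by linarith
    set w := c₀ * |y|^(-5*δ) with hw
    have hw0 : 0 < w := by positivity
    have h := low1 x y (hw0.trans_le hx) hx1 hy
    by_contra! hcon
    have h1 : ‖riemannZeta (1+x+I*y)‖^4 < (4 * D * w * |y|^δ)^4 := by gcongr
    have h2 : (4 * D * w * |y|^δ)^4 ≤ c₁ * w^3 * |y|^(-δ) := by
      have e1 : (4 * D * w * |y|^δ)^4 = w^3 * ((4*D)^4 * c₀ * (|y|^(-5*δ) * (|y|^δ)^4)) := by rw [hw]; ring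
      have e2 : |y|^(-5*δ) * (|y|^δ)^4 = |y|^(-δ) := by
        rw [← Real.rpow_natCast, ← Real.rpow_mul hy0.le, ← Real.rpow_add hy0]; congr 1; push_cast; ring
      rw [e1, e2]
      have : (4*D)^4 * c₀ ≤ c₁ := by
        have : c₀ ≤ c₁/(4*D)^4 := min_le_right _ _
        rw [le_div_iff₀ (by positivity)] at this
        linarith
      calc _ ≤ w^3 * (c₁ * |y|^(-δ)) := by gcongr
        _ = _ := by ring
    have h3 : c₁ * w^3 * |y|^(-δ) ≤ c₁ * x^3 * |y|^(-δ) := by gcongr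
    linarith
  refine ⟨min c₀ (2 * D * c₀), by positivity, (min_le_left _ _).trans (min_le_left _ _), fun s hs h1 h2 => ?_⟩
  set y := s.im with hy
  have hy0 : 0 < |y| := by linarith
  set w := c₀ * |y|^(-5*δ) with hw
  have hw0 : 0 < w := by positivity
  have hw1 : w ≤ δ/2 := by
    have : |y|^(-5*δ) ≤ 1 := Real.rpow_le_one_of_one_le_of_nonpos (by linarith) (by linarith)
    have h3 : c₀ ≤ δ/2 := min_le_left _ _
    rw [hw]; nlinarith
  have hfin : min c₀ (2 * D * c₀) * |y|^(-4*δ) ≤ 2 * D * w * |y|^δ := by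
    have : |y|^(-5*δ) * |y|^δ = |y|^(-4*δ) := by rw [← Real.rpow_add hy0]; congr 1; ring
    calc _ ≤ 2 * D * c₀ * |y|^(-4*δ) := by gcongr; exact min_le_right _ _
      _ = _ := by rw [hw, ← this]; ring
  refine hfin.trans ?_
  have hre : 1 - w ≤ s.re := by
    have : min c₀ (2 * D * c₀) * |y|^(-5*δ) ≤ w := by rw [hw]; gcongr; exact min_le_left _ _
    linarith
  by_cases hc : 1 + w ≤ s.re
  · have := low2 (s.re - 1) y hs (by linarith) (by linarith)
    have e : (1 + ((s.re - 1 : ℝ):ℂ) + I * y) = s := by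
      apply Complex.ext <;> simp [hy]
    rw [e] at this
    have h0 : 0 ≤ D * w * |y|^δ := by positivity
    linarith
  · push Not at hc
    have h3 := low2 w y hs le_rfl (by linarith)
    set z : ℂ := 1 + w + I * y with hz
    have hzre : z.re = 1 + w := by simp [hz]
    have hzim : z.im = y := by simp [hz]
    -- mean value on the segment
    have h4 : ‖riemannZeta s - riemannZeta z‖ ≤ (D * |y|^δ) * ‖s - z‖ := by
      set K : Set ℂ := {u | u.im = y ∧ 1 - w ≤ u.re ∧ u.re ≤ 1 + w} with hK
      have hconv : Convex ℝ K := by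
        intro a ha b hb p q hp hq hpq
        simp only [hK, Set.mem_ofPred_eq] at *
        simp only [add_im, add_re, real_smul, mul_im, mul_re, ofReal_re, ofReal_im, zero_mul, add_zero, sub_zero]
        refine ⟨by rw [ha.1, hb.1, ← add_mul, hpq, one_mul], ?_, ?_⟩
        · nlinarith
        · nlinarith
      apply hconv.norm_image_sub_le_of_norm_deriv_le (f := riemannZeta) (C := D * |y|^δ)
      · intro u hu
        apply differentiableAt_riemannZeta
        rintro rfl
        have := hu.1
        simp at this; rw [← this] at hs; simp at hs; linarith
      · intro u hu
        have := hD' u (by linarith [hu.2.1]) (by linarith [hu.2.2]) (by rw [hu.1]; exact hs)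
        rwa [hu.1] at this
      · exact ⟨hzim, by rw [hzre]; linarith, by rw [hzre]⟩
      · exact ⟨rfl, hre, hc.le⟩
    have h5 : ‖s - z‖ ≤ 2 * w := by
      have e : s - z = ((s.re - (1+w) : ℝ) : ℂ) := by apply Complex.ext <;> simp [hz, hy]
      rw [e, norm_real, Real.norm_eq_abs, abs_le]
      constructor <;> linarith
    have h6 := norm_sub_norm_le (riemannZeta z) (riemannZeta s)
    rw [norm_sub_rev] at h6
    have h7 : (D * |y|^δ) * ‖s - z‖ ≤ (D * |y|^δ) * (2 * w) := by gcongr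
    nlinarith

end PNTaux

namespace PNTaux
open Complex Filter Topology Asymptotics

noncomputable def HH (s : ℂ) : ℂ := (-deriv riemannZeta₁ s / riemannZeta₁ s - riemannZeta₀ s) / (s * (s+1))

lemma zeta1_ne {s : ℂ} (hs : riemannZeta s ≠ 0) : riemannZeta₁ s ≠ 0 := by
  by_cases h : s = 1
  · rw [h, riemannZeta₁_one]; exact one_ne_zero
  · intro h0
    apply hs
    rw [riemannZeta_eq_inv_sub_mul h, h0, mul_zero]

lemma HH_eq {s : ℂ} (h1 : s ≠ 1) (hs : riemannZeta s ≠ 0) :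
    HH s = (-deriv riemannZeta s / riemannZeta s - riemannZeta s) / (s*(s+1)) := by
  have h0 := zeta1_ne hs
  have h2 : s - 1 ≠ 0 := sub_ne_zero.mpr h1
  unfold HH
  congr 1
  have e : riemannZeta₀ s = riemannZeta s - (s-1)⁻¹ := by
    rw [riemannZeta_eq_inv_sub_add h1]; ring
  rw [e, deriv_riemannZeta_eq_neg_inv_sub_sq_mul_add h1, riemannZeta_eq_inv_sub_mul h1]
  field_simp
  ring

lemma HH_diffAt {s : ℂ} (hs : riemannZeta₁ s ≠ 0) (h0 : s ≠ 0) (h1 : s + 1 ≠ 0) :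
    DifferentiableAt ℂ HH s := by
  have hd : DifferentiableAt ℂ (deriv riemannZeta₁) s :=
    (differentiable_riemannZeta₁.deriv) s
  have hd1 := differentiable_riemannZeta₁ s
  have hd0 := differentiable_riemannZeta₀ s
  unfold HH
  exact ((hd.neg.div hd1 hs).sub hd0).div (by fun_prop) (mul_ne_zero h0 h1)

lemma HH_iter_bound_low : ∃ C > 0, ∀ s : ℂ, 1 ≤ s.re → s.re ≤ 3/2 → |s.im| ≤ 3 →
    ‖iteratedDeriv 2 HH s‖ ≤ C := by
  set U : Set ℂ := {s | riemannZeta₁ s ≠ 0 ∧ s ≠ 0 ∧ s + 1 ≠ 0}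
  have hU : IsOpen U := by
    refine (isOpen_ne_fun differentiable_riemannZeta₁.continuous continuous_const).inter
      ((isOpen_ne_fun continuous_id continuous_const).inter (isOpen_ne_fun (by fun_prop) continuous_const))
  have hd : DifferentiableOn ℂ HH U := fun s hs => (HH_diffAt hs.1 hs.2.1 hs.2.2).differentiableWithinAt
  have hd1 := hd.deriv hU
  have hd2 := hd1.deriv hU
  have hc : ContinuousOn (iteratedDeriv 2 HH) U := by
    have : iteratedDeriv 2 HH = deriv (deriv HH) := by
      rw [iteratedDeriv_succ, iteratedDeriv_one]
    rw [this]; exact hd2.continuousOn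
  set K : Set ℂ := Set.Icc (1:ℝ) (3/2) ×ℂ Set.Icc (-3:ℝ) 3
  have hK : IsCompact K := isCompact_Icc.reProdIm isCompact_Icc
  have hKU : K ⊆ U := by
    intro s hs
    have h1 : 1 ≤ s.re := hs.1.1
    refine ⟨zeta1_ne (riemannZeta_ne_zero_of_one_le_re h1), ?_, ?_⟩
    · rintro rfl; simp at h1; linarith
    · intro h
      have := congrArg Complex.re h
      simp at this; linarith
  obtain ⟨C, hC⟩ := hK.exists_bound_of_continuousOn (hc.mono hKU)
  refine ⟨max C 1, by positivity, fun s h1 h2 h3 => (hC s ⟨⟨h1, h2⟩, abs_le.mp h3⟩).trans (le_max_left _ _)⟩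

lemma HH_iter_bound_high : ∃ C > 0, ∀ s : ℂ, 1 ≤ s.re → s.re ≤ 3/2 → 3 ≤ |s.im| →
    ‖iteratedDeriv 2 HH s‖ ≤ C * |s.im|^(-(3/2):ℝ) := by
  obtain ⟨δ, hδ⟩ : ∃ δ : ℝ, δ = 1/30 := ⟨_, rfl⟩
  have hδ0 : 0 < δ := by rw [hδ]; norm_num
  have hδ1 : δ ≤ 1/2 := by rw [hδ]; norm_num
  obtain ⟨c, hc, hcδ, hl⟩ := zeta_lower hδ0 hδ1
  obtain ⟨B, hB, hB'⟩ := zeta_bound hδ0 hδ1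
  obtain ⟨D, hD, hD'⟩ := zeta_deriv_bound hδ0 hδ1
  refine ⟨2 * ((D/c+B) * 4) / (c/2)^2, by positivity, fun s h1 h2 h3 => ?_⟩
  set t := |s.im| with ht
  have ht0 : 0 < t := by linarith
  have hp1 : t^(-5*δ) ≤ 1 := Real.rpow_le_one_of_one_le_of_nonpos (by linarith) (by linarith)
  have hp0 : 0 < t^(-5*δ) := by positivity
  set r := c/2 * t^(-5*δ) with hr
  have hr0 : 0 < r := by positivity
  have hr1 : r ≤ δ/2 := by rw [hr]; nlinarith
  have key : ∀ w ∈ Metric.closedBall s r, 2 ≤ |w.im| ∧ t/2 ≤ |w.im| ∧ |w.im| ≤ 2*t ∧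
      1 - c * |w.im|^(-5*δ) ≤ w.re ∧ 1 - δ/2 ≤ w.re ∧ w.re ≤ 2 := by
    intro w hw
    rw [Metric.mem_closedBall, dist_eq] at hw
    have hi : |w.im - s.im| ≤ r := by simpa using (abs_im_le_norm (w - s)).trans hw
    have hre : |w.re - s.re| ≤ r := by simpa using (abs_re_le_norm (w - s)).trans hw
    have a1 : t ≤ |w.im| + r := by
      have := abs_sub_abs_le_abs_sub s.im w.im
      rw [abs_sub_comm] at this; linarith
    have a2 : |w.im| ≤ t + r := by
      have := abs_sub_abs_le_abs_sub w.im s.im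
      linarith
    have hre' := abs_le.mp hre
    have hr2 : r ≤ 1/2 := by linarith
    have b3 : |w.im| ≤ 2 * t := by linarith
    refine ⟨by linarith, by linarith, b3, ?_, by linarith, by linarith⟩
    have : t^(-5*δ)/2 ≤ |w.im|^(-5*δ) := by
      calc t^(-5*δ)/2 = 2^(-1:ℝ) * t^(-5*δ) := by rw [Real.rpow_neg_one]; ring
        _ ≤ 2^(-5*δ) * t^(-5*δ) := by
          gcongr
          · norm_num
          · rw [hδ]; norm_num
        _ = (2*t)^(-5*δ) := by rw [Real.mul_rpow (by norm_num) ht0.le]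
        _ ≤ _ := Real.rpow_le_rpow_of_nonpos (by linarith) b3 (by linarith)
    have : r ≤ c * |w.im|^(-5*δ) := by rw [hr]; nlinarith
    linarith
  have hne : ∀ w ∈ Metric.closedBall s r, riemannZeta w ≠ 0 ∧ w ≠ 1 ∧ w ≠ 0 ∧ w + 1 ≠ 0 := by
    intro w hw
    obtain ⟨k1, k2, k3, k4, k5, k6⟩ := key w hw
    have := hl w k1 k4 k6
    have hw0 : 0 < |w.im| := by linarith
    have : 0 < ‖riemannZeta w‖ := lt_of_lt_of_le (by positivity) this
    refine ⟨norm_pos_iff.mp this, ?_, ?_, ?_⟩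
    · rintro rfl; simp at hw0
    · rintro rfl; simp at hw0
    · intro h
      have := congrArg Complex.im h
      simp at this; simp [this] at hw0
  have hdc : DiffContOnCl ℂ HH (Metric.ball s r) := by
    apply DifferentiableOn.diffContOnCl
    rw [closure_ball _ hr0.ne']
    intro w hw
    obtain ⟨q1, q2, q3, q4⟩ := hne w hw
    exact (HH_diffAt (zeta1_ne q1) q3 q4).differentiableWithinAt
  have hbd : ∀ w ∈ Metric.sphere s r, ‖HH w‖ ≤ (D/c+B) * 4 * t^(5*δ-2) := by
    intro w hw
    have hw := Metric.sphere_subset_closedBall hw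
    obtain ⟨k1, k2, k3, k4, k5, k6⟩ := key w hw
    obtain ⟨q1, q2, q3, q4⟩ := hne w hw
    rw [HH_eq q2 q1]
    set u := |w.im| with hu
    have hu0 : 0 < u := by linarith
    have e1 := hl w k1 k4 k6
    have e2 := hB' w (by linarith) (by linarith) (by linarith)
    have e3 := hD' w k5 (by linarith) k1
    rw [norm_div]
    have n1 : ‖-deriv riemannZeta w / riemannZeta w - riemannZeta w‖ ≤ (D/c+B) * u^(5*δ) := by
      calc _ ≤ ‖deriv riemannZeta w‖ / ‖riemannZeta w‖ + ‖riemannZeta w‖ := by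
            refine (norm_sub_le _ _).trans ?_
            rw [norm_div, norm_neg]
        _ ≤ (D * u^δ) / (c * u^(-4*δ)) + B * u^δ := by gcongr
        _ ≤ D/c * u^(5*δ) + B * u^(5*δ) := by
          have : (D * u^δ) / (c * u^(-4*δ)) = D/c * u^(5*δ) := by
            have : u^(5*δ) = u^δ * u^(4*δ) := by rw [← Real.rpow_add hu0]; congr 1; ring
            rw [this, show -4*δ = -(4*δ) by ring, Real.rpow_neg hu0.le]; field_simp
          rw [this]
          gcongr 2
          · gcongr
            · linarith
            · linarith
        _ = _ := by ring
    have n2 : u^2 ≤ ‖w*(w+1)‖ := by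
      rw [norm_mul, sq]
      gcongr
      · exact abs_im_le_norm w
      · simpa using abs_im_le_norm (w+1)
    calc _ ≤ (D/c+B) * u^(5*δ) / u^2 := by gcongr
      _ = (D/c+B) * u^(5*δ-2) := by
        rw [Real.rpow_sub hu0, Real.rpow_two]; ring
      _ ≤ (D/c+B) * (t/2)^(5*δ-2) := by
        gcongr 1
        exact Real.rpow_le_rpow_of_nonpos (by linarith) k2 (by rw [hδ]; norm_num)
      _ = (D/c+B) * (2^(2-5*δ) * t^(5*δ-2)) := by
        rw [Real.div_rpow ht0.le (by norm_num), show 2-5*δ = -(5*δ-2) by ring, Real.rpow_neg (by norm_num)]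
        ring
      _ ≤ (D/c+B) * (4 * t^(5*δ-2)) := by
        gcongr
        calc (2:ℝ)^(2-5*δ) ≤ 2^(2:ℝ) := Real.rpow_le_rpow_of_exponent_le (by norm_num) (by linarith)
          _ = 4 := by norm_num
      _ = _ := by ring
  have := Complex.norm_iteratedDeriv_le_of_forall_mem_sphere_norm_le 2 hr0 hdc hbd
  refine this.trans (le_of_eq ?_)
  have e1 : t^(-(3/2):ℝ) * (t^(-5*δ))^2 = t^(5*δ-2) := by
    rw [← Real.rpow_natCast, ← Real.rpow_mul ht0.le, ← Real.rpow_add ht0]; congr 1; rw [hδ]; norm_num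
  rw [hr, ← e1]
  have : t^(-5*δ) ≠ 0 := hp0.ne'
  simp [Nat.factorial]
  field_simp

lemma HH_iter_bound : ∃ C > 0, ∀ s : ℂ, 1 ≤ s.re → s.re ≤ 3/2 →
    ‖iteratedDeriv 2 HH s‖ ≤ C * (1+‖s.im‖)^(-(3/2):ℝ) := by
  obtain ⟨C1, h1, h1'⟩ := HH_iter_bound_low
  obtain ⟨C2, h2, h2'⟩ := HH_iter_bound_high
  refine ⟨C1*8 + C2*8, by positivity, fun s ha hb => ?_⟩
  have hn := abs_nonneg s.im
  rw [Real.norm_eq_abs]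
  have e4 : (4:ℝ)^(-(3/2):ℝ) = 1/8 := by
    rw [show (4:ℝ) = 2^(2:ℝ) by norm_num, ← Real.rpow_mul (by norm_num)]; norm_num
  have e2 : (1/8:ℝ) ≤ (2:ℝ)^(-(3/2):ℝ) := by
    rw [← e4]
    exact Real.rpow_le_rpow_of_nonpos (by norm_num) (by norm_num) (by norm_num)
  have hp : 0 < (1+|s.im|)^(-(3/2):ℝ) := by positivity
  rcases le_total |s.im| 3 with h | h
  · have : (4:ℝ)^(-(3/2):ℝ) ≤ (1+|s.im|)^(-(3/2):ℝ) :=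
      Real.rpow_le_rpow_of_nonpos (by positivity) (by linarith) (by norm_num)
    rw [e4] at this
    have := h1' s ha hb h
    nlinarith
  · have hs : 0 < |s.im| := by linarith
    have h5 : (2*|s.im|)^(-(3/2):ℝ) ≤ (1+|s.im|)^(-(3/2):ℝ) :=
      Real.rpow_le_rpow_of_nonpos (by positivity) (by linarith) (by norm_num)
    rw [Real.mul_rpow (by norm_num) hn] at h5
    have h6 := h2' s ha hb h
    have h7 : 0 < |s.im|^(-(3/2):ℝ) := by positivity
    have : |s.im|^(-(3/2):ℝ) ≤ 8 * (1+|s.im|)^(-(3/2):ℝ) := by nlinarith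
    calc _ ≤ _ := h6
      _ ≤ C2 * (8 * (1+|s.im|)^(-(3/2):ℝ)) := by gcongr
      _ ≤ _ := by nlinarith

end PNTaux

namespace PNTaux
open Complex Filter Topology Asymptotics

noncomputable def cc (n : ℕ) : ℝ := if n = 0 then 0 else ArithmeticFunction.vonMangoldt n - 1
noncomputable def ph (u : ℝ) : ℝ := max (1 - u) 0
noncomputable def ff (x : ℝ) : ℂ := ∑' n : ℕ, ((cc n * ph (n * x) : ℝ) : ℂ)

lemma ph_nonneg (u : ℝ) : 0 ≤ ph u := le_max_right _ _
lemma ph_le {u : ℝ} (h : 0 ≤ u) : ph u ≤ 1 := max_le (by linarith) (by norm_num)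
lemma ph_zero {u : ℝ} (h : 1 ≤ u) : ph u = 0 := max_eq_right (by linarith)
lemma ph_cont : Continuous ph := by unfold ph; fun_prop

lemma ff_eq {x : ℝ} (N : ℕ) (hx : 1 ≤ (N+1) * x) (_hx0 : 0 < x) :
    ff x = ∑ n ∈ range (N+1), ((cc n * ph (n * x) : ℝ) : ℂ) := by
  refine tsum_eq_sum fun n hn => ?_
  have : N + 1 ≤ n := by simpa using hn
  have h2 : ((N:ℝ)+1) ≤ n := by exact_mod_cast this
  rw [ph_zero (by nlinarith)]; simp

lemma ff_cont : ContinuousOn ff (Set.Ioi 0) := by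
  intro x hx
  have hx : 0 < x := hx
  apply ContinuousAt.continuousWithinAt
  obtain ⟨N, hN⟩ := exists_nat_gt (2/x)
  have hN' : 2 < N * x := by rwa [div_lt_iff₀ hx] at hN
  have : ff =ᶠ[𝓝 x] fun x => ∑ n ∈ range (N+1), ((cc n * ph (n * x) : ℝ) : ℂ) := by
    filter_upwards [lt_mem_nhds (show x/2 < x by linarith)] with y hy
    refine ff_eq N ?_ (by linarith)
    have : (N:ℝ) * (x/2) ≤ N * y := by gcongr
    nlinarith
  refine ContinuousAt.congr ?_ this.symm
  apply Continuous.continuousAt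
  refine continuous_finsetSum _ fun n _ => ?_
  exact continuous_ofReal.comp (continuous_const.mul (ph_cont.comp (by fun_prop)))

lemma ff_locInt : LocallyIntegrableOn ff (Set.Ioi 0) := ff_cont.locallyIntegrableOn measurableSet_Ioi

lemma ff_top {x : ℝ} (hx : 1 ≤ x) : ff x = 0 := by
  rw [ff_eq 0 (by simpa using hx) (by linarith)]
  simp [cc]

lemma abs_cc_le (n : ℕ) : |cc n| ≤ ArithmeticFunction.vonMangoldt n + 1 := by
  have := ArithmeticFunction.vonMangoldt_nonneg (n := n)
  unfold cc
  split_ifs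
  · simp; linarith
  · rw [abs_le]; constructor <;> linarith

lemma ff_bound : ∃ C > 0, ∀ x, 0 < x → ‖ff x‖ ≤ C / x := by
  refine ⟨Real.log 4 + 4 + 2, by positivity, fun x hx => ?_⟩
  rcases le_or_gt 1 x with h | h
  · rw [ff_top h, norm_zero]; positivity
  have hx1 : 1 ≤ 1/x := by rw [le_div_iff₀ hx]; linarith
  rw [ff_eq ⌊1/x⌋₊ (by
    have := Nat.lt_floor_add_one (1/x)
    rw [div_lt_iff₀ hx] at this; linarith) hx]
  calc _ ≤ ∑ n ∈ range (⌊1/x⌋₊+1), (ArithmeticFunction.vonMangoldt n + 1) := by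
        refine norm_sum_le_of_le _ fun n _ => ?_
        rw [norm_real, Real.norm_eq_abs, abs_mul, abs_of_nonneg (ph_nonneg _)]
        have h1 := abs_cc_le n
        have h2 : ph (n * x) ≤ 1 := ph_le (by positivity)
        have := ph_nonneg (n*x)
        have := abs_nonneg (cc n)
        nlinarith
    _ = Chebyshev.psi (1/x) + (⌊1/x⌋₊+1) := by
        rw [sum_add_distrib, Chebyshev.psi_eq_sum_Icc, Nat.range_succ_eq_Icc_zero]
        simp
    _ ≤ (Real.log 4 + 4) * (1/x) + 2 * (1/x) := by
        gcongr
        · exact Chebyshev.psi_le_const_mul_self (by positivity)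
        · have := Nat.floor_le (show 0 ≤ 1/x by positivity)
          linarith
    _ = _ := by ring

lemma ff_bot : ff =O[𝓝[>] 0] (fun x : ℝ => x ^ (-(1:ℝ))) := by
  obtain ⟨C, hC, h⟩ := ff_bound
  refine IsBigO.of_bound C ?_
  filter_upwards [self_mem_nhdsWithin] with x hx
  have hx : 0 < x := hx
  rw [Real.rpow_neg_one, norm_inv, Real.norm_eq_abs, abs_of_pos hx, ← div_eq_mul_inv]
  exact h x hx

lemma ff_topO (a : ℝ) : ff =O[atTop] (fun x : ℝ => x ^ (-a)) := by
  refine IsBigO.of_bound 1 ?_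
  filter_upwards [eventually_ge_atTop 1] with x hx
  rw [ff_top hx, norm_zero]; positivity

lemma ph_mellin {s : ℂ} (hs : 0 < s.re) : HasMellin (fun x => (ph x : ℂ)) s (1/(s*(s+1))) := by
  have h1 := hasMellin_one_Ioc hs
  have h2 := hasMellin_cpow_Ioc 1 (s := s) (by simp; linarith)
  have h3 := hasMellin_sub h1.1 h2.1
  have e : Set.EqOn (fun t : ℝ => (t:ℂ)^(s-1) • ((Set.Ioc 0 1).indicator (fun _ => (1:ℂ)) t - (Set.Ioc 0 1).indicator (fun t : ℝ => (t:ℂ)^(1:ℂ)) t))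
      (fun t : ℝ => (t:ℂ)^(s-1) • (ph t : ℂ)) (Set.Ioi 0) := by
    intro t ht
    have ht : 0 < t := ht
    dsimp only
    congr 1
    by_cases h : t ≤ 1
    · have hm : t ∈ Set.Ioc (0:ℝ) 1 := Set.mem_Ioc.mpr ⟨ht, h⟩
      rw [Set.indicator_of_mem hm, Set.indicator_of_mem hm]
      rw [ph, max_eq_left (by linarith)]; simp
    · rw [Set.indicator_of_notMem (by simp; intro; linarith), Set.indicator_of_notMem (by simp; intro; linarith), ph_zero (by linarith)]
      simp
  refine ⟨h3.1.congr_fun e measurableSet_Ioi, ?_⟩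
  rw [mellin, ← setIntegral_congr_fun measurableSet_Ioi e]
  have := h3.2
  rw [mellin] at this
  rw [this, h1.2, h2.2]
  have hs0 : s ≠ 0 := by rintro rfl; simp at hs
  have hs1 : s + 1 ≠ 0 := by
    intro h
    have := congrArg Complex.re h
    simp at this; linarith
  field_simp
  ring

lemma cc_term (s : ℂ) (n : ℕ) : (cc n : ℂ) * (n:ℂ)^(-s) =
    LSeries.term (fun n => ((ArithmeticFunction.vonMangoldt n : ℝ) : ℂ)) s n - LSeries.term 1 s n := by
  rw [LSeries.term_def, LSeries.term_def, cc]
  split_ifs with h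
  · simp
  · rw [cpow_neg]; push_cast; simp only [Pi.one_apply]; ring

lemma ff_mellin {s : ℂ} (hs : 1 < s.re) : mellin ff s = HH s := by
  have hs0 : 0 < s.re := by linarith
  set F : ℕ → ℝ → ℂ := fun n t => (t:ℂ)^(s-1) • ((cc n * ph (n*t) : ℝ) : ℂ) with hF
  have hph := ph_mellin hs0
  have hmel : ∀ n : ℕ, IntegrableOn (F n) (Set.Ioi 0) ∧ ∫ t in Set.Ioi 0, F n t = (cc n : ℂ) * (n:ℂ)^(-s) * (1/(s*(s+1))) := by
    intro n
    rcases Nat.eq_zero_or_pos n with rfl | hn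
    · simp [hF, cc]
    have hn' : (0:ℝ) < n := by exact_mod_cast hn
    have h1 := (MellinConvergent.comp_mul_left (f := fun x => (ph x : ℂ)) (s := s) hn').mpr hph.1
    have h2 := mellin_comp_mul_left (fun x => (ph x : ℂ)) s hn'
    have h3 := hasMellin_const_smul h1 (cc n : ℂ)
    have e : F n = fun t : ℝ => (t:ℂ)^(s-1) • ((cc n : ℂ) • (ph (n*t) : ℂ)) := by
      funext t; simp [hF]
    rw [e]
    refine ⟨h3.1, ?_⟩
    have := h3.2
    rw [mellin] at this
    rw [this, h2, hph.2]
    simp [mul_assoc]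
  have hA := ArithmeticFunction.LSeriesSummable_vonMangoldt hs
  have hB := LSeriesSummable_one_iff.mpr hs
  have hnorm : ∀ n : ℕ, ∫ t in Set.Ioi 0, ‖F n t‖ = ‖(cc n : ℂ) * (n:ℂ)^(-s)‖ * ∫ t in Set.Ioi (0:ℝ), ‖(t:ℂ)^(s-1) • (ph t : ℂ)‖ := by
    intro n
    rcases Nat.eq_zero_or_pos n with rfl | hn
    · simp [hF, cc]
    have hn' : (0:ℝ) < n := by exact_mod_cast hn
    have h1 := integral_comp_mul_left_Ioi (fun t : ℝ => ‖(t:ℂ)^(s-1) • (ph t : ℂ)‖) 0 hn'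
    rw [mul_zero] at h1
    have e : ∀ t ∈ Set.Ioi (0:ℝ), ‖F n t‖ = (|cc n| * (n:ℝ)^(1 - s.re)) * ‖(((n:ℝ)*t : ℝ):ℂ)^(s-1) • (ph (n*t) : ℂ)‖ := by
      intro t ht
      have ht : 0 < t := ht
      simp only [hF, norm_smul, norm_real, norm_mul, Real.norm_eq_abs]
      rw [norm_cpow_eq_rpow_re_of_pos ht, norm_cpow_eq_rpow_re_of_pos (by positivity), Real.mul_rpow hn'.le ht.le]
      have : (n:ℝ)^(1-s.re) * (n:ℝ)^(s-1).re = 1 := by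
        rw [← Real.rpow_add hn']; simp
      linear_combination (-t ^ (s - 1).re * |cc n| * |ph (n*t)|) * this
    rw [setIntegral_congr_fun measurableSet_Ioi e, integral_const_mul, h1, norm_mul, norm_real,
      norm_natCast_cpow_of_pos hn, Real.norm_eq_abs]
    have : (n:ℝ)^(-s).re = (n:ℝ)^(1-s.re) * (n:ℝ)⁻¹ := by
      rw [← Real.rpow_neg_one, ← Real.rpow_add hn']; simp; congr 1; ring
    rw [this, smul_eq_mul]; ring
  have hsum : Summable fun n => ∫ t in Set.Ioi 0, ‖F n t‖ := by
    simp_rw [hnorm]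
    apply Summable.mul_right
    simp_rw [cc_term]
    exact (Summable.sub (f := LSeries.term _ s) hA hB).norm
  have key := hasSum_integral_of_summable_integral_norm (fun n => (hmel n).1) hsum
  simp_rw [fun n => (hmel n).2] at key
  have e2 : (∫ t in Set.Ioi 0, ∑' n, F n t) = mellin ff s := by
    rw [mellin]
    congr 1
    funext t
    simp only [hF, ff, smul_eq_mul]
    rw [tsum_mul_left]
  rw [e2] at key
  have key2 : HasSum (fun n => (cc n : ℂ) * (n:ℂ)^(-s) * (1/(s*(s+1)))) ((LSeries (fun n => ((ArithmeticFunction.vonMangoldt n : ℝ) : ℂ)) s - LSeries 1 s) * (1/(s*(s+1)))) := by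
    simp_rw [cc_term]
    exact (hA.hasSum.sub hB.hasSum).mul_right _
  rw [key.unique key2]
  have h1 := ArithmeticFunction.LSeries_vonMangoldt_eq_deriv_riemannZeta_div hs
  have h2 := LSeries_one_eq_riemannZeta hs
  rw [h1, h2, HH_eq (by rintro rfl; simp at hs) (riemannZeta_ne_zero_of_one_le_re hs.le)]
  ring

noncomputable def gg (x : ℝ) : ℂ := Real.log x • (Real.log x • ff x)

lemma ff_log_facts {b : ℝ} (hb : 1 < b) :
    LocallyIntegrableOn (fun t => Real.log t • ff t) (Set.Ioi 0) ∧
    (fun t => Real.log t • ff t) =O[atTop] (fun x : ℝ => x ^ (-(5:ℝ))) ∧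
    (fun t => Real.log t • ff t) =O[𝓝[>] 0] (fun x : ℝ => x ^ (-b)) := by
  refine ⟨?_, isBigO_rpow_top_log_smul (by norm_num) (ff_topO 6), isBigO_rpow_zero_log_smul hb ff_bot⟩
  apply ContinuousOn.locallyIntegrableOn _ measurableSet_Ioi
  exact ContinuousOn.smul (Real.continuousOn_log.mono (fun x hx => ne_of_gt hx)) ff_cont

lemma gg_cont : ContinuousOn gg (Set.Ioi 0) := by
  have h : ContinuousOn Real.log (Set.Ioi 0) := (Real.continuousOn_log.mono (fun x hx => ne_of_gt hx))
  exact h.smul (h.smul ff_cont)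

lemma gg_facts {b : ℝ} (hb : 1 < b) :
    LocallyIntegrableOn gg (Set.Ioi 0) ∧
    gg =O[atTop] (fun x : ℝ => x ^ (-(4:ℝ))) ∧
    gg =O[𝓝[>] 0] (fun x : ℝ => x ^ (-b)) := by
  obtain ⟨h1, h2, h3⟩ := ff_log_facts (show 1 < (1+b)/2 by linarith)
  exact ⟨gg_cont.locallyIntegrableOn measurableSet_Ioi, isBigO_rpow_top_log_smul (by norm_num) h2, isBigO_rpow_zero_log_smul (by linarith) h3⟩

lemma gg_mellin {s : ℂ} (hs : 1 < s.re) (hs2 : s.re < 2) : mellin gg s = iteratedDeriv 2 HH s := by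
  have hU : IsOpen {s : ℂ | 1 < s.re ∧ s.re < 2} :=
    (isOpen_lt continuous_const continuous_re).inter (isOpen_lt continuous_re continuous_const)
  have d1 : ∀ s : ℂ, 1 < s.re → s.re < 2 → deriv HH s = mellin (fun t => Real.log t • ff t) s := by
    intro s hs hs2
    have := (mellin_hasDerivAt_of_isBigO_rpow ff_locInt (ff_topO 5) (by linarith) ff_bot hs).2
    rw [← this.deriv]
    apply EventuallyEq.deriv_eq
    filter_upwards [hU.mem_nhds ⟨hs, hs2⟩] with w hw
    exact (ff_mellin hw.1).symm
  rw [iteratedDeriv_succ, iteratedDeriv_one]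
  obtain ⟨h1, h2, h3⟩ := ff_log_facts (show 1 < (1+s.re)/2 by linarith)
  have := (mellin_hasDerivAt_of_isBigO_rpow h1 h2 (by linarith) h3 (by linarith : _ < s.re)).2
  have e : deriv (deriv HH) s = deriv (mellin (fun t => Real.log t • ff t)) s := by
    apply EventuallyEq.deriv_eq
    filter_upwards [hU.mem_nhds ⟨hs, hs2⟩] with w hw
    exact d1 w hw.1 hw.2
  rw [e, this.deriv]
  rfl

lemma gg_bound : ∃ C > 0, ∀ x, 0 < x → ‖gg x‖ ≤ C / x := by
  obtain ⟨C, hC, hb⟩ := HH_iter_bound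
  have hint : Integrable (fun y : ℝ => (1+‖y‖)^(-(3/2):ℝ)) := by
    apply integrable_one_add_norm
    simp; norm_num
  set I := ∫ y : ℝ, (1+‖y‖)^(-(3/2):ℝ) with hI
  have hI0 : 0 ≤ I := integral_nonneg fun y => by positivity
  refine ⟨1/(2*Real.pi) * (C * I) + 1, by positivity, fun x hx => ?_⟩
  have main : ∀ σ : ℝ, 1 < σ → σ < 3/2 → ‖gg x‖ ≤ x^(-σ) * (1/(2*Real.pi) * (C * I)) := by
    intro σ h1 h2
    obtain ⟨g1, g2, g3⟩ := gg_facts (show 1 < (1+σ)/2 by linarith)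
    have hconv : MellinConvergent gg σ := mellinConvergent_of_isBigO_rpow g1 g2 (by simp; linarith) g3 (by simp; linarith)
    have hbd : ∀ y : ℝ, ‖mellin gg (σ + y * Complex.I)‖ ≤ C * (1+‖y‖)^(-(3/2):ℝ) := by
      intro y
      rw [gg_mellin (by simp; linarith) (by simp; linarith)]
      have := hb (σ + y * Complex.I) (by simp; linarith) (by simp; linarith)
      simpa using this
    have hvert : Integrable (fun y : ℝ => mellin gg (σ + y * Complex.I)) := by
      refine (hint.const_mul C).mono' ?_ (Eventually.of_forall hbd)
      apply Continuous.aestronglyMeasurable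
      rw [continuous_iff_continuousAt]
      intro y
      have := (mellin_differentiableAt_of_isBigO_rpow (s := σ + y * Complex.I) g1 g2 (by simp; linarith) g3 (by simp; linarith)).continuousAt
      exact ContinuousAt.comp (f := fun y : ℝ => (σ + y * Complex.I : ℂ)) this (by fun_prop)
    have inv := mellinInv_mellin_eq σ gg hx hconv hvert (gg_cont.continuousAt (Ioi_mem_nhds hx))
    rw [← inv, mellinInv, norm_smul]
    have : ‖∫ y : ℝ, (x:ℂ)^(-((σ:ℂ) + y * Complex.I)) • mellin gg (σ + y * Complex.I)‖ ≤ ∫ y : ℝ, x^(-σ) * (C * (1+‖y‖)^(-(3/2):ℝ)) := by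
      apply norm_integral_le_of_norm_le ((hint.const_mul C).const_mul _)
      refine Eventually.of_forall fun y => ?_
      rw [norm_smul, norm_cpow_eq_rpow_re_of_pos hx]
      have : (-((σ:ℂ) + y * Complex.I)).re = -σ := by simp
      rw [this]
      gcongr
      exact hbd y
    rw [integral_const_mul, integral_const_mul] at this
    calc _ ≤ (1/(2*Real.pi)) * (x^(-σ) * (C * I)) := by
          gcongr
          simp [abs_of_pos Real.pi_pos]
      _ = _ := by ring
  have hlim : Tendsto (fun σ : ℝ => x^(-σ) * (1/(2*Real.pi) * (C * I))) (𝓝[>] 1) (𝓝 (x^(-(1:ℝ)) * (1/(2*Real.pi) * (C * I)))) := by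
    apply Tendsto.mono_left _ nhdsWithin_le_nhds
    apply ContinuousAt.tendsto (f := fun σ : ℝ => x^(-σ) * (1/(2*Real.pi) * (C * I)))
    have : ContinuousAt (fun σ : ℝ => x^(-σ)) 1 := (Real.continuousAt_const_rpow hx.ne').comp (f := fun σ : ℝ => -σ) (by fun_prop)
    exact this.mul continuousAt_const
  have := ge_of_tendsto hlim (b := ‖gg x‖) (by
    filter_upwards [Ioo_mem_nhdsGT (show (1:ℝ) < 3/2 by norm_num)] with σ hσ
    exact main σ hσ.1 hσ.2)
  refine this.trans ?_
  rw [Real.rpow_neg_one, div_eq_inv_mul (_ + _)]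
  apply mul_le_mul_of_nonneg_left _ (by positivity)
  linarith

lemma smooth_bound : ∃ C > 0, ∀ y : ℝ, 1 < y →
    |∑ n ∈ Icc 1 ⌊y⌋₊, (ArithmeticFunction.vonMangoldt n - 1) * (y - n)| ≤ C * y^2 / (Real.log y)^2 := by
  obtain ⟨C, hC, h⟩ := gg_bound
  refine ⟨C, hC, fun y hy => ?_⟩
  have hy0 : 0 < y := by linarith
  have h1 := h (1/y) (by positivity)
  have e : ff (1/y) = (((∑ n ∈ Icc 1 ⌊y⌋₊, (ArithmeticFunction.vonMangoldt n - 1) * (y - n)) / y : ℝ) : ℂ) := by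
    rw [ff_eq ⌊y⌋₊ (by
      have := Nat.lt_floor_add_one y
      rw [mul_one_div, le_div_iff₀ hy0]; linarith) (by positivity), Nat.range_succ_eq_Icc_zero, ← ofReal_sum, sum_div]
    congr 1
    rw [← Finset.add_sum_Ioc_eq_sum_Icc (Nat.zero_le _)]
    simp only [cc, if_true, zero_mul, zero_add]
    apply sum_congr rfl
    intro n hn
    have hn := mem_Icc.mp hn
    have : (n:ℝ) ≤ y := (Nat.le_floor_iff hy0.le).mp hn.2
    rw [if_neg (by omega), ph, max_eq_left (by rw [mul_one_div, sub_nonneg, div_le_one hy0]; exact this)]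
    field_simp
  rw [gg, e] at h1
  have hl : 0 < Real.log y := Real.log_pos hy
  set S := ∑ n ∈ Icc 1 ⌊y⌋₊, (ArithmeticFunction.vonMangoldt n - 1) * (y - n)
  simp only [norm_smul, norm_real, Real.norm_eq_abs, one_div, Real.log_inv, abs_neg, abs_div, abs_of_pos hl, abs_of_pos hy0, div_inv_eq_mul] at h1
  rw [le_div_iff₀ (by positivity)]
  have : |S| * Real.log y ^ 2 = (Real.log y * (Real.log y * (|S|/y))) * y := by field_simp
  rw [this]
  calc _ ≤ (C * y) * y := by gcongr
    _ = _ := by ring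

end PNTaux

namespace PNTaux
open Filter Topology Asymptotics

noncomputable def Psi1 (y : ℝ) : ℝ := ∑ n ∈ Icc 1 ⌊y⌋₊, ArithmeticFunction.vonMangoldt n * (y - n)

lemma sum_y_sub (y : ℝ) (N : ℕ) : ∑ n ∈ Icc 1 N, (y - n) = N * y - N*(N+1)/2 := by
  induction N with
  | zero => simp
  | succ k ih => rw [sum_Icc_succ_top (by omega), ih]; push_cast; ring

lemma log_sq_le {y : ℝ} (hy : 1 ≤ y) : Real.log y ^ 2 ≤ 4 * y := by
  have h := Real.log_le_rpow_div (by linarith : 0 ≤ y) (show (0:ℝ) < 1/2 by norm_num)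
  rw [← Real.sqrt_eq_rpow] at h
  have h0 := Real.log_nonneg hy
  have : Real.log y ≤ 2 * √y := by linarith
  calc _ ≤ (2 * √y)^2 := by gcongr
    _ = _ := by rw [mul_pow, Real.sq_sqrt (by linarith)]; norm_num

lemma Psi1_asymp : ∃ C > 0, ∀ y : ℝ, 2 ≤ y → |Psi1 y - y^2/2| ≤ C * y^2 / (Real.log y)^2 := by
  obtain ⟨C, hC, h⟩ := smooth_bound
  refine ⟨C + 4, by positivity, fun y hy => ?_⟩
  have h1 := h y (by linarith)
  have hl : 0 < Real.log y := Real.log_pos (by linarith)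
  have e : ∑ n ∈ Icc 1 ⌊y⌋₊, (ArithmeticFunction.vonMangoldt n - 1) * (y - n) = Psi1 y - (⌊y⌋₊ * y - ⌊y⌋₊*(⌊y⌋₊+1)/2) := by
    rw [← sum_y_sub, Psi1, ← sum_sub_distrib]
    exact sum_congr rfl fun n _ => by ring
  rw [e] at h1
  have f1 := Nat.floor_le (show 0 ≤ y by linarith)
  have f2 := Nat.lt_floor_add_one y
  have h2 : |(⌊y⌋₊ * y - ⌊y⌋₊*(⌊y⌋₊+1)/2) - y^2/2| ≤ y := by
    rw [abs_le]; constructor <;> nlinarith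
  have h3 : y ≤ 4 * y^2/(Real.log y)^2 := by
    rw [le_div_iff₀ (by positivity)]
    have := log_sq_le (show 1 ≤ y by linarith)
    nlinarith
  have h4 : (C+4) * y^2/(Real.log y)^2 = C * y^2/(Real.log y)^2 + 4 * y^2/(Real.log y)^2 := by ring
  rw [h4]
  calc _ = |(Psi1 y - (⌊y⌋₊ * y - ⌊y⌋₊*(⌊y⌋₊+1)/2)) + ((⌊y⌋₊ * y - ⌊y⌋₊*(⌊y⌋₊+1)/2) - y^2/2)| := by congr 1; ring
    _ ≤ _ := (abs_add_le _ _).trans (by linarith)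

lemma Psi1_diff {y h : ℝ} (hy : 0 ≤ y) (hh : 0 ≤ h) :
    Chebyshev.psi y * h ≤ Psi1 (y+h) - Psi1 y ∧ Psi1 (y+h) - Psi1 y ≤ Chebyshev.psi (y+h) * h := by
  have hle : ⌊y⌋₊ ≤ ⌊y+h⌋₊ := Nat.floor_mono (by linarith)
  have split : Icc 1 ⌊y+h⌋₊ = Icc 1 ⌊y⌋₊ ∪ Ioc ⌊y⌋₊ ⌊y+h⌋₊ := by
    ext n; simp only [mem_union, mem_Icc, mem_Ioc]; omega
  have disj : Disjoint (Icc 1 ⌊y⌋₊) (Ioc ⌊y⌋₊ ⌊y+h⌋₊) := by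
    rw [disjoint_left]; intro n; simp only [mem_Icc, mem_Ioc]; omega
  have e1 : Psi1 (y+h) - Psi1 y = (∑ n ∈ Icc 1 ⌊y⌋₊, ArithmeticFunction.vonMangoldt n) * h + ∑ n ∈ Ioc ⌊y⌋₊ ⌊y+h⌋₊, ArithmeticFunction.vonMangoldt n * (y + h - n) := by
    rw [Psi1, Psi1, split, sum_union disj, sum_mul, add_sub_right_comm, ← sum_sub_distrib]
    congr 1
    exact sum_congr rfl fun n _ => by ring
  have e2 : ∀ y, Chebyshev.psi y = ∑ n ∈ Icc 1 ⌊y⌋₊, ArithmeticFunction.vonMangoldt n := fun y => rfl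
  have e3 : Chebyshev.psi (y+h) * h = (∑ n ∈ Icc 1 ⌊y⌋₊, ArithmeticFunction.vonMangoldt n) * h + ∑ n ∈ Ioc ⌊y⌋₊ ⌊y+h⌋₊, ArithmeticFunction.vonMangoldt n * h := by
    rw [e2, split, sum_union disj, add_mul, sum_mul, sum_mul]
  rw [e3, e1, e2 y]
  constructor
  · have : 0 ≤ ∑ n ∈ Ioc ⌊y⌋₊ ⌊y+h⌋₊, ArithmeticFunction.vonMangoldt n * (y + h - n) := by
      refine sum_nonneg fun n hn => mul_nonneg ArithmeticFunction.vonMangoldt_nonneg ?_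
      have := (Nat.le_floor_iff (by positivity)).mp (mem_Ioc.mp hn).2
      linarith
    linarith
  · gcongr with n hn
    · have := (Nat.floor_lt hy).mp (mem_Ioc.mp hn).1
      linarith

lemma psi_asymp_large : ∃ C > 0, ∀ y : ℝ, 4 ≤ y → |Chebyshev.psi y - y| ≤ C * y / Real.log y := by
  obtain ⟨C, hC, hE⟩ := Psi1_asymp
  refine ⟨1 + 20 * C, by positivity, fun y hy => ?_⟩
  have hl1 : 1 ≤ Real.log y := by
    rw [Real.le_log_iff_exp_le (by linarith)]
    linarith [Real.exp_one_lt_d9]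
  set l := Real.log y with hl
  set h := y / (2*l) with hh
  have hh0 : 0 < h := by positivity
  have hh1 : h ≤ y/2 := by
    rw [hh]; gcongr; linarith
  have hhl : h * (2*l) = y := by rw [hh]; field_simp
  have d1 := Psi1_diff (show 0 ≤ y by linarith) hh0.le
  have d2 := Psi1_diff (show 0 ≤ y - h by linarith) hh0.le
  rw [sub_add_cancel] at d2
  have E0 := abs_le.mp (hE y (by linarith))
  have E1 := abs_le.mp (hE (y+h) (by linarith))
  have E2 := abs_le.mp (hE (y-h) (by linarith))
  have E1' : C * (y+h)^2/(Real.log (y+h))^2 ≤ 4 * C * y^2/l^2 := by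
    have : l ≤ Real.log (y+h) := Real.log_le_log (by linarith) (by linarith)
    calc _ ≤ C * (2*y)^2/l^2 := by gcongr; linarith
      _ = _ := by ring
  have E2' : C * (y-h)^2/(Real.log (y-h))^2 ≤ 4 * C * y^2/l^2 := by
    have : l/2 ≤ Real.log (y-h) := by
      have : Real.log (√y) ≤ Real.log (y-h) := by
        apply Real.log_le_log (by positivity)
        have : √y ≤ y/2 := by
          rw [Real.sqrt_le_left (by linarith)]; nlinarith
        linarith
      rwa [Real.log_sqrt (by linarith)] at this
    calc _ ≤ C * (y)^2/(l/2)^2 := by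
          gcongr
          · linarith
          · linarith
      _ = _ := by ring
  have hy2 : y^2/l^2 = 2 * (y/l) * h := by rw [hh]; field_simp
  have q : (C * y^2/l^2) = 2 * C * (y/l) * h := by rw [mul_div_assoc, hy2]; ring
  have q4 : (4 * C * y^2/l^2) = 8 * C * (y/l) * h := by rw [mul_div_assoc, hy2]; ring
  rw [q] at E0
  rw [q4] at E1' E2'
  have hhy : h ≤ y/l := by rw [hh]; gcongr; linarith
  have r : (1+20*C) * y / l = y/l + 20 * C * (y/l) := by ring
  have hyl : 0 ≤ y/l := by positivity
  rw [r, abs_le]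
  constructor
  · have : (y - h/2 - 10 * C * (y/l)) * h ≤ Chebyshev.psi y * h := by nlinarith
    have := le_of_mul_le_mul_right this hh0
    have : 0 ≤ C * (y/l) := by positivity
    linarith
  · have : Chebyshev.psi y * h ≤ (y + h/2 + 10 * C * (y/l)) * h := by nlinarith
    have := le_of_mul_le_mul_right this hh0
    have : 0 ≤ C * (y/l) := by positivity
    linarith

lemma theta_asymp : ∃ C > 0, ∀ y : ℝ, 2 ≤ y → |Chebyshev.theta y - y| ≤ C * y / Real.log y := by
  obtain ⟨C, hC, hE⟩ := psi_asymp_large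
  obtain ⟨D, hD⟩ := Chebyshev.psi_sub_theta_le_mul_sqrt
  have hD0 : 0 ≤ D := by
    have := hD 4
    have h2 := Chebyshev.theta_le_psi 4
    rw [show (4:ℝ) = 2^2 by norm_num, Real.sqrt_sq (by norm_num)] at this
    norm_num at this
    linarith
  refine ⟨C + 2*D + 6, by positivity, fun y hy => ?_⟩
  have hl : 0 < Real.log y := Real.log_pos (by linarith)
  rcases le_or_gt 4 y with h | h
  · have h1 := abs_le.mp (hE y h)
    have h2 := hD y
    have h3 := Chebyshev.theta_le_psi y
    have h4 : √y ≤ 2 * y / Real.log y := by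
      rw [le_div_iff₀ hl]
      have h := Real.log_le_rpow_div (by linarith : 0 ≤ y) (show (0:ℝ) < 1/2 by norm_num)
      rw [← Real.sqrt_eq_rpow] at h
      have := Real.mul_self_sqrt (show 0 ≤ y by linarith)
      have := Real.sqrt_nonneg y
      nlinarith
    have h5 : (C+2*D+6) * y/Real.log y = C*y/Real.log y + D * (2*y/Real.log y) + 6 * (y/Real.log y) := by ring
    have h6 : 0 ≤ y/Real.log y := by positivity
    have h7 : D * √y ≤ D * (2*y/Real.log y) := by gcongr
    rw [h5, abs_le]
    constructor <;> linarith [mul_nonneg hD0 (Real.sqrt_nonneg y)]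
  · have h1 := Chebyshev.theta_nonneg y
    have h2 := Chebyshev.theta_le_log4_mul_x (show 0 ≤ y by linarith)
    have h3 : Real.log 4 ≤ 2 := by
      rw [show (4:ℝ) = 2^2 by norm_num, Real.log_pow]; norm_num; linarith [Real.log_two_lt_d9]
    have h4 : Real.log y ≤ 2 := (Real.log_le_log (by linarith) h.le).trans h3
    have h5 : |Chebyshev.theta y - y| ≤ 3 * y := by
      rw [abs_le]; constructor <;> nlinarith
    refine h5.trans ?_
    rw [le_div_iff₀ hl]
    have : 0 ≤ (C + 2*D) * y := by positivity
    nlinarith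

end PNTaux

namespace PNTaux
open Filter Topology Asymptotics

lemma mertens : ∃ C > 0, ∀ x y : ℝ, 2 ≤ x → x ≤ y →
    |∑ p ∈ (Ioc ⌊x⌋₊ ⌊y⌋₊).filter Nat.Prime, (1:ℝ)/p - Real.log (Real.log y / Real.log x)| ≤ C / Real.log x := by
  obtain ⟨C, hC, hθ⟩ := theta_asymp
  refine ⟨7*C, by positivity, fun x y hx hxy => ?_⟩
  set f : ℝ → ℝ := fun t => 1/(t * Real.log t) with hf
  set f' : ℝ → ℝ := fun t => -(Real.log t + 1)/(t * Real.log t)^2 with hf'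
  have pos : ∀ t ∈ Set.Icc x y, 0 < t ∧ 1/2 ≤ Real.log t := by
    intro t ht
    have h2 : 2 ≤ t := hx.trans ht.1
    refine ⟨by linarith, ?_⟩
    have := Real.log_le_log (by norm_num) h2
    linarith [Real.log_two_gt_d9]
  have hder : ∀ t ∈ Set.Icc x y, HasDerivAt f (f' t) t := by
    intro t ht
    obtain ⟨h0, h1⟩ := pos t ht
    have hl : Real.log t ≠ 0 := by linarith
    have := ((hasDerivAt_id t).mul (Real.hasDerivAt_log h0.ne')).inv (mul_ne_zero h0.ne' hl)
    refine (this.congr_deriv ?_).congr_of_eventuallyEq (Eventually.of_forall fun u => by simp [hf])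
    simp only [hf', id, Pi.mul_apply]
    field_simp
  set c : ℕ → ℝ := fun k => if k.Prime then Real.log k else 0 with hc
  have hcθ : ∀ t : ℝ, ∑ k ∈ Icc 0 ⌊t⌋₊, c k = Chebyshev.theta t := by
    intro t; rw [Chebyshev.theta_eq_sum_Icc, sum_filter]
  have hcont' : ContinuousOn f' (Set.Icc x y) := by
    intro t ht
    obtain ⟨h0, h1⟩ := pos t ht
    have h2 : Real.log t ≠ 0 := by linarith
    have h3 := h0.ne'
    apply ContinuousAt.continuousWithinAt
    have := Real.continuousAt_log h3
    refine ContinuousAt.div (by fun_prop) (by fun_prop) (by positivity)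
  have hint' : IntegrableOn f' (Set.Icc x y) := hcont'.integrableOn_Icc
  have heq : Set.EqOn (deriv f) f' (Set.Icc x y) := fun t ht => (hder t ht).deriv
  have abel := sum_mul_eq_sub_sub_integral_mul c (by linarith : 0 ≤ x) hxy (fun t ht => (hder t ht).differentiableAt)
    (hint'.congr_fun heq.symm measurableSet_Icc)
  simp_rw [hcθ] at abel
  have hint1 : IntegrableOn (fun t => f' t * Chebyshev.theta t) (Set.Ioc x y) := by
    have := integrableOn_mul_sum_Icc (g := f') (a := x) (b := y) (m := 0) c (by linarith) hint'
    simp_rw [hcθ] at this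
    exact this.mono_set Set.Ioc_subset_Icc_self
  have hint2 : IntegrableOn (fun t => f' t * t) (Set.Ioc x y) :=
    ((hcont'.mul continuousOn_id).integrableOn_Icc).mono_set Set.Ioc_subset_Icc_self
  have hI2 : ∫ t in Set.Ioc x y, f' t * t = (1/Real.log y - Real.log (Real.log y)) - (1/Real.log x - Real.log (Real.log x)) := by
    rw [← intervalIntegral.integral_of_le hxy]
    refine intervalIntegral.integral_eq_sub_of_hasDerivAt (f := fun t => 1/Real.log t - Real.log (Real.log t)) ?_ ?_
    · intro t ht
      rw [Set.uIcc_of_le hxy] at ht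
      obtain ⟨h0, h1⟩ := pos t ht
      have h2 : Real.log t ≠ 0 := by linarith
      have d1 := Real.hasDerivAt_log h0.ne'
      refine (((hasDerivAt_const t (1:ℝ)).div d1 h2).sub (d1.log h2)).congr_deriv ?_
      simp only [hf']
      field_simp
      ring
    · rw [intervalIntegrable_iff_integrableOn_Ioc_of_le hxy]; exact hint2
  have hcont3 : ContinuousOn (fun t => 3*C/(t * Real.log t^2)) (Set.Icc x y) := by
    intro t ht
    obtain ⟨h0, h1⟩ := pos t ht
    have h2 : Real.log t ≠ 0 := by linarith
    have h3 := h0.ne'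
    apply ContinuousAt.continuousWithinAt
    have := Real.continuousAt_log h3
    refine ContinuousAt.div (by fun_prop) (by fun_prop) (by positivity)
  have hI3 : ∫ t in Set.Ioc x y, 3*C/(t * Real.log t^2) = (-(3*C)/Real.log y) - (-(3*C)/Real.log x) := by
    rw [← intervalIntegral.integral_of_le hxy]
    refine intervalIntegral.integral_eq_sub_of_hasDerivAt (f := fun t => -(3*C)/Real.log t) ?_ ?_
    · intro t ht
      rw [Set.uIcc_of_le hxy] at ht
      obtain ⟨h0, h1⟩ := pos t ht
      have h2 : Real.log t ≠ 0 := by linarith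
      have d1 := Real.hasDerivAt_log h0.ne'
      refine ((hasDerivAt_const t (-(3*C))).div d1 h2).congr_deriv ?_
      field_simp
      ring
    · rw [intervalIntegrable_iff_integrableOn_Ioc_of_le hxy]; exact hcont3.integrableOn_Icc.mono_set Set.Ioc_subset_Icc_self
  have herr : |(∫ t in Set.Ioc x y, f' t * Chebyshev.theta t) - ∫ t in Set.Ioc x y, f' t * t| ≤ 3*C/Real.log x := by
    rw [← integral_sub hint1 hint2]
    have : ‖∫ t in Set.Ioc x y, (f' t * Chebyshev.theta t - f' t * t)‖ ≤ ∫ t in Set.Ioc x y, 3*C/(t * Real.log t^2) := by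
      apply norm_integral_le_of_norm_le (hcont3.integrableOn_Icc.mono_set Set.Ioc_subset_Icc_self)
      refine (ae_restrict_mem measurableSet_Ioc).mono fun t ht => ?_
      obtain ⟨h0, h1⟩ := pos t ⟨ht.1.le, ht.2⟩
      have hl : 0 < Real.log t := by linarith
      have := hθ t (by linarith [ht.1])
      rw [← mul_sub, norm_mul, Real.norm_eq_abs, Real.norm_eq_abs]
      have e : |f' t| = (Real.log t + 1)/(t * Real.log t)^2 := by
        rw [hf']; simp only [abs_div, abs_neg]
        rw [abs_of_pos (by positivity), abs_of_pos (by positivity)]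
      rw [e]
      calc _ ≤ (3 * Real.log t)/(t * Real.log t)^2 * (C*t/Real.log t) := by
            gcongr; linarith
        _ = _ := by field_simp
    rw [hI3, Real.norm_eq_abs] at this
    refine this.trans ?_
    have hly : 0 < Real.log y := by linarith [(pos y ⟨hxy, le_rfl⟩).2]
    have : 0 ≤ 3*C/Real.log y := by positivity
    rw [neg_div, neg_div]; linarith
  have hb : ∀ t ∈ Set.Icc x y, |f t * Chebyshev.theta t - 1/Real.log t| ≤ 2*C/Real.log x := by
    intro t ht
    obtain ⟨h0, h1⟩ := pos t ht
    have hl : 0 < Real.log t := by linarith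
    have hlx : 0 < Real.log x := by linarith [(pos x ⟨le_rfl, hxy⟩).2]
    have hlxt : Real.log x ≤ Real.log t := Real.log_le_log (by linarith) ht.1
    have := hθ t (by linarith [ht.1])
    have e : f t * Chebyshev.theta t - 1/Real.log t = f t * (Chebyshev.theta t - t) := by
      simp only [hf]; field_simp
    rw [e, abs_mul]
    have e2 : |f t| = 1/(t*Real.log t) := by
      simp only [hf]; rw [abs_of_pos (by positivity)]
    rw [e2]
    calc _ ≤ 1/(t*Real.log t) * (C*t/Real.log t) := by gcongr
      _ = C/(Real.log t * Real.log t) := by field_simp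
      _ ≤ 2 * C/(Real.log t) := by
        rw [div_le_div_iff₀ (by positivity) (by positivity)]
        have : 0 ≤ C * Real.log t := by positivity
        nlinarith
      _ ≤ _ := by gcongr
  have hsum : ∑ p ∈ (Ioc ⌊x⌋₊ ⌊y⌋₊).filter Nat.Prime, (1:ℝ)/p = ∑ k ∈ Ioc ⌊x⌋₊ ⌊y⌋₊, f k * c k := by
    rw [sum_filter]
    apply sum_congr rfl
    intro k hk
    simp only [hc, hf]
    split_ifs with h
    · have h2 : (2:ℝ) ≤ k := by exact_mod_cast h.two_le
      have : Real.log k ≠ 0 := (Real.log_pos (by linarith)).ne'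
      field_simp
    · simp
  have hlx : 0 < Real.log x := by linarith [(pos x ⟨le_rfl, hxy⟩).2]
  have hly : 0 < Real.log y := by linarith [(pos y ⟨hxy, le_rfl⟩).2]
  have b1 := abs_le.mp (hb x ⟨le_rfl, hxy⟩)
  have b2 := abs_le.mp (hb y ⟨hxy, le_rfl⟩)
  have hcongr : ∫ t in Set.Ioc x y, deriv f t * Chebyshev.theta t = ∫ t in Set.Ioc x y, f' t * Chebyshev.theta t :=
    setIntegral_congr_fun measurableSet_Ioc fun t ht => by
      rw [heq (Set.Ioc_subset_Icc_self ht)]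
  rw [hI2] at herr
  rw [hsum, abel, hcongr, Real.log_div hly.ne' hlx.ne']
  have := abs_le.mp herr
  have e5 : 7*C/Real.log x = 3*C/Real.log x + 2*C/Real.log x + 2*C/Real.log x := by ring
  rw [e5, abs_le]
  constructor <;> linarith

end PNTaux

namespace PNTaux
open Filter Topology Asymptotics

/-- primes in a closed interval -/
lemma theta_Icc {u v : ℝ} (hu : 2 ≤ u) (huv : u ≤ v) :
    Chebyshev.theta v - Chebyshev.theta u ≤ ∑ p ∈ (Icc ⌈u⌉₊ ⌊v⌋₊).filter Nat.Prime, Real.log p ∧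
    ∑ p ∈ (Icc ⌈u⌉₊ ⌊v⌋₊).filter Nat.Prime, Real.log p ≤ Chebyshev.theta v - Chebyshev.theta u + Real.log v := by
  have hle : ⌊u⌋₊ ≤ ⌊v⌋₊ := Nat.floor_mono huv
  have e : Chebyshev.theta v - Chebyshev.theta u = ∑ p ∈ (Ioc ⌊u⌋₊ ⌊v⌋₊).filter Nat.Prime, Real.log p := by
    rw [Chebyshev.theta, Chebyshev.theta, sub_eq_iff_eq_add, ← sum_union]
    · congr 1
      rw [← filter_union]
      congr 1
      ext n; simp only [mem_union, mem_Ioc]; omega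
    · rw [disjoint_left]; intro n; simp only [mem_filter, mem_Ioc]; omega
  rw [e]
  have hlog : ∀ n : ℕ, 0 ≤ Real.log n := fun n => Real.log_natCast_nonneg n
  constructor
  · apply sum_le_sum_of_subset_of_nonneg
    · apply filter_subset_filter
      intro n
      simp only [mem_Ioc, mem_Icc]
      rintro ⟨h1, h2⟩
      exact ⟨(Nat.ceil_le_floor_add_one u).trans h1, h2⟩
    · intro i _ _; exact hlog i
  · have hsub : (Icc ⌈u⌉₊ ⌊v⌋₊).filter Nat.Prime ⊆ insert ⌊u⌋₊ ((Ioc ⌊u⌋₊ ⌊v⌋₊).filter Nat.Prime) := by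
      intro n
      simp only [mem_insert, mem_filter, mem_Ioc, mem_Icc]
      rintro ⟨⟨h1, h2⟩, h3⟩
      have := Nat.floor_le_ceil u
      by_cases h : n = ⌊u⌋₊
      · exact Or.inl h
      · exact Or.inr ⟨⟨by omega, h2⟩, h3⟩
    refine (sum_le_sum_of_subset_of_nonneg hsub fun i _ _ => hlog i).trans ?_
    rw [sum_insert (by simp), add_comm]
    gcongr
    · have : 1 ≤ ⌊u⌋₊ := by rw [Nat.one_le_floor_iff]; linarith
      exact_mod_cast this
    · exact (Nat.floor_le (by linarith)).trans huv

lemma prime_count_Icc (η : ℝ) (hη : 0 < η) (hη1 : η < 1) : ∃ C > 0, ∃ y₀ ≥ 2, ∀ y ≥ y₀, ∀ u v : ℝ,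
    η * y ≤ u → u ≤ v → v ≤ y →
    |(((Icc ⌈u⌉₊ ⌊v⌋₊).filter Nat.Prime).card : ℝ) - (v - u)/Real.log y| ≤ C * y / (Real.log y)^2 := by
  obtain ⟨C, hC, hθ⟩ := theta_asymp
  set h := -Real.log η with hh
  have hh0 : 0 < h := by rw [hh]; linarith [Real.log_neg hη hη1]
  refine ⟨2*h*(9+8*C) + (4+4*C), by positivity, max (2/η) (Real.exp (2*h)) + 2, by
    have : 0 < max (2/η) (Real.exp (2*h)) := lt_max_of_lt_left (by positivity)
    linarith, fun y hy u v hu huv hv => ?_⟩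
  have hy1 : 2/η ≤ y := by linarith [le_max_left (2/η) (Real.exp (2*h))]
  have hy2 : Real.exp (2*h) ≤ y := by linarith [le_max_right (2/η) (Real.exp (2*h))]
  rw [div_le_iff₀ hη] at hy1
  have hu2 : 2 ≤ u := by linarith
  have hy0 : 0 < y := by linarith
  set l := Real.log y with hl
  have hl2 : 2*h ≤ l := by rw [hl, Real.le_log_iff_exp_le hy0]; exact hy2
  have hl0 : 0 < l := by linarith
  have hlu : l - h ≤ Real.log u := by
    have := Real.log_le_log (by positivity) hu
    rw [Real.log_mul hη.ne' hy0.ne'] at this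
    linarith
  have hlu0 : l/2 ≤ Real.log u := by linarith
  have hlv : Real.log u ≤ Real.log v := Real.log_le_log (by linarith) huv
  have t1 := hθ u hu2
  have t2 := hθ v (by linarith)
  have bd : ∀ w, u ≤ w → w ≤ y → C * w/Real.log w ≤ 2 * C * (y/l) := by
    intro w h1 h2
    have : l/2 ≤ Real.log w := hlu0.trans (Real.log_le_log (by linarith) h1)
    calc _ ≤ C * y/(l/2) := by gcongr
      _ = _ := by field_simp
  have t1' := abs_le.mp (t1.trans (bd u le_rfl (by linarith)))
  have t2' := abs_le.mp (t2.trans (bd v huv hv))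
  obtain ⟨s1, s2⟩ := theta_Icc hu2 huv
  set Θ := ∑ p ∈ (Icc ⌈u⌉₊ ⌊v⌋₊).filter Nat.Prime, Real.log p
  set F := (((Icc ⌈u⌉₊ ⌊v⌋₊).filter Nat.Prime).card : ℝ)
  have hvl : Real.log v ≤ 4 * (y/l) := by
    have h1 : Real.log v ≤ l := Real.log_le_log (by linarith) hv
    have h2 := log_sq_le (show 1 ≤ y by linarith)
    rw [← mul_div_assoc, le_div_iff₀ hl0]
    nlinarith
  have hΘ : |Θ - (v-u)| ≤ (4+4*C) * (y/l) := by
    have : 0 ≤ C * (y/l) := by positivity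
    have : 0 ≤ y/l := by positivity
    rw [abs_le]; constructor <;> linarith
  have hmem : ∀ p ∈ (Icc ⌈u⌉₊ ⌊v⌋₊).filter Nat.Prime, l - h ≤ Real.log p ∧ Real.log p ≤ l := by
    intro p hp
    rw [mem_filter, mem_Icc] at hp
    have h1 := Nat.ceil_le.mp hp.1.1
    have h2 := (Nat.le_floor_iff (by linarith)).mp hp.1.2
    exact ⟨hlu.trans (Real.log_le_log (by linarith) h1), Real.log_le_log (by linarith) (by linarith)⟩
  have F1 : F * (l-h) ≤ Θ := by
    have := card_nsmul_le_sum _ _ _ (fun p hp => (hmem p hp).1)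
    simpa [nsmul_eq_mul] using this
  have F2 : Θ ≤ F * l := by
    have := sum_le_card_nsmul _ _ _ (fun p hp => (hmem p hp).2)
    simpa [nsmul_eq_mul] using this
  have hF0 : 0 ≤ F := Nat.cast_nonneg _
  have hyl : y/l * l = y := by field_simp
  have hFl : F * l ≤ 2 * Θ := by nlinarith
  have hmain : |F * l - (v-u)| ≤ h * F + (4+4*C) * (y/l) := by
    have := abs_le.mp hΘ
    rw [abs_le]; constructor <;> nlinarith
  -- bound on F
  have hl1 : l ≥ Real.log 2 := Real.log_le_log (by norm_num) (by
    have : 0 < max (2/η) (Real.exp (2*h)) := lt_max_of_lt_left (by positivity)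
    linarith)
  have hFb : F * l ≤ 2 * (y + (4+4*C) * (y/l)) := by
    have := abs_le.mp hΘ
    have : v - u ≤ y := by linarith
    linarith
  have hy_l : y/l ≤ y * 2 := by
    rw [div_le_iff₀ hl0]
    have : 1/2 ≤ l := by linarith [Real.log_two_gt_d9]
    nlinarith
  have hFb' : F ≤ 2 * (9 + 8*C) * (y/l) := by
    have h3 : F * l ≤ 2 * (9+8*C) * (y/l) * l := by
      rw [mul_assoc _ (y/l), hyl]
      have h4 : (4+4*C) * (y/l) ≤ (4+4*C) * (y*2) := mul_le_mul_of_nonneg_left hy_l (by positivity)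
      linarith
    exact le_of_mul_le_mul_right h3 hl0
  clear hFb hFl F1 F2 hmem hΘ t1 t2 t1' t2' s1 s2 bd
  have e : F - (v-u)/l = (F*l - (v-u))/l := by field_simp
  rw [e, abs_div, abs_of_pos hl0, div_le_div_iff₀ hl0 (by positivity)]
  have h5 : h * F ≤ h * (2 * (9 + 8*C) * (y/l)) := mul_le_mul_of_nonneg_left hFb' hh0.le
  calc _ ≤ ((2*h*(9+8*C) + (4+4*C)) * (y/l)) * l^2 := by
        apply mul_le_mul_of_nonneg_right _ (by positivity)
        linarith
    _ = (2*h*(9+8*C) + (4+4*C)) * (y/l*l) * l := by ring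
    _ = _ := by rw [hyl]

end PNTaux

namespace PNTaux
open Filter Topology Asymptotics

/-- number of primes at least w in the interval scaled by d -/
noncomputable def cnt (a b d w : ℝ) : ℝ :=
  (((Icc ⌈a/d⌉₊ ⌊b/d⌋₊).filter (fun r : ℕ => r.Prime ∧ w ≤ (r:ℝ))).card : ℝ)

lemma cnt_asymp (η : ℝ) (hη : 0 < η) (hη1 : η < 1) : ∃ C > 0, ∃ X₀ ≥ 2, ∀ X ≥ X₀, ∀ a b d w : ℝ,
    (η * X) ^ ((1:ℝ)/2) ≤ a → a ≤ b → b ≤ X ^ ((1:ℝ)/2) → 1 ≤ d → X ^ ((3:ℝ)/28) ≤ w →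
    |cnt a b d w - if d * w ≤ X ^ ((1:ℝ)/2) then (b-a)/(d * Real.log (X ^ ((1:ℝ)/2) / d)) else 0| ≤
      C * X ^ ((1:ℝ)/2) / (Real.log X)^2 * (1/d) +
      if (η * X) ^ ((1:ℝ)/2) ≤ d * w ∧ d * w ≤ X ^ ((1:ℝ)/2) then C * X ^ ((1:ℝ)/2) / Real.log X * (1/d) else 0 := by
  have hη' : 0 < η ^ ((1:ℝ)/2) := Real.rpow_pos_of_pos hη _
  have hη1' : η ^ ((1:ℝ)/2) < 1 := Real.rpow_lt_one hη.le hη1 (by norm_num)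
  obtain ⟨C, hC, y₀, hy₀, H⟩ := prime_count_Icc _ hη' hη1'
  refine ⟨10 + 200 * C, by positivity, max 2 (y₀ ^ ((28:ℝ)/3)), le_max_left _ _, ?_⟩
  intro X hX a b d w ha hab hb hd hw
  have hX2 : 2 ≤ X := (le_max_left _ _).trans hX
  have hX0 : 0 < X := by linarith
  have hXy : y₀ ^ ((28:ℝ)/3) ≤ X := (le_max_right _ _).trans hX
  have hL : 0 < Real.log X := Real.log_pos (by linarith)
  set L := Real.log X with hLdef
  set s := X ^ ((1:ℝ)/2) with hs
  have hs0 : 0 < s := Real.rpow_pos_of_pos hX0 _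
  have hηs : (η * X) ^ ((1:ℝ)/2) = η ^ ((1:ℝ)/2) * s := Real.mul_rpow hη.le hX0.le
  have hd0 : 0 < d := by linarith
  have ha0 : 0 < a := lt_of_lt_of_le (by rw [hηs]; positivity) ha
  by_cases hdw : d * w ≤ s
  swap
  · have : cnt a b d w = 0 := by
      rw [cnt, Nat.cast_eq_zero, card_eq_zero, filter_eq_empty_iff]
      rintro r hr ⟨_, h2⟩
      rw [mem_Icc] at hr
      have h3 := (Nat.le_floor_iff (by have : 0 ≤ b := by linarith
                                       positivity)).mp hr.2
      rw [le_div_iff₀ hd0] at h3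
      apply hdw
      have := mul_le_mul_of_nonneg_left h2 hd0.le
      linarith
    rw [if_neg hdw, this, if_neg (by tauto)]
    simp only [sub_zero, abs_zero, add_zero]
    positivity
  rw [if_pos hdw]
  set y := s / d with hy
  have hy0 : 0 < y := by positivity
  have hyw : w ≤ y := by rw [hy, le_div_iff₀ hd0]; linarith
  have hyX : X ^ ((3:ℝ)/28) ≤ y := hw.trans hyw
  have hyy : y₀ ≤ y := by
    refine le_trans ?_ hyX
    have := Real.rpow_le_rpow (by positivity) hXy (show (0:ℝ) ≤ 3/28 by norm_num)
    rw [← Real.rpow_mul (by linarith)] at this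
    norm_num at this
    exact this
  have hly : 3/28 * L ≤ Real.log y := by
    have := Real.log_le_log (by positivity) hyX
    rwa [Real.log_rpow hX0] at this
  have hly2 : 1/2 ≤ Real.log y := by
    have := Real.log_le_log (by norm_num) (hy₀.trans hyy)
    linarith [Real.log_two_gt_d9]
  have hly0 : 0 < Real.log y := by linarith
  have main := H y hyy (a/d) (b/d) (by
    rw [hy, ← mul_div_assoc, ← hηs]; gcongr) (by gcongr) (by rw [hy]; gcongr)
  set F := (((Icc ⌈a/d⌉₊ ⌊b/d⌋₊).filter Nat.Prime).card : ℝ) with hF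
  have e1 : (b/d - a/d)/Real.log y = (b-a)/(d * Real.log y) := by field_simp
  rw [e1] at main
  have b1 : C * y / Real.log y ^ 2 ≤ 100 * C * s / L^2 * (1/d) := by
    calc _ ≤ C * y / (3/28*L)^2 := by gcongr
      _ = (784/9) * (C * (y / L^2)) := by field_simp; norm_num
      _ ≤ 100 * (C * (y/L^2)) := by gcongr; norm_num
      _ = _ := by rw [hy]; field_simp
  have b2 : (b-a)/(d * Real.log y) ≤ 10 * s / L * (1/d) := by
    calc _ ≤ s / (d * (3/28*L)) := by gcongr; linarith
      _ = (28/3) * (s/L*(1/d)) := by field_simp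
      _ ≤ 10 * (s/L*(1/d)) := by gcongr; norm_num
      _ = _ := by ring
  have b3 : C * y / Real.log y ^ 2 ≤ 20 * C * s / L * (1/d) := by
    calc _ = C * y / (Real.log y * Real.log y) := by rw [sq]
      _ ≤ C * y / (3/28*L * (1/2)) := by gcongr
      _ = (56/3) * (C * (y / L)) := by field_simp; norm_num
      _ ≤ 20 * (C * (y/L)) := by gcongr; norm_num
      _ = _ := by rw [hy]; field_simp
  have hF0 : 0 ≤ F := Nat.cast_nonneg _
  have hle : cnt a b d w ≤ F := by
    rw [cnt, hF]
    norm_cast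
    apply card_le_card
    intro r; simp only [mem_filter]; tauto
  have hc0 : 0 ≤ cnt a b d w := Nat.cast_nonneg _
  have p1 : 0 ≤ C * s / L^2 * (1/d) := by positivity
  have p2 : 0 ≤ s / L^2 * (1/d) := by positivity
  have r1 : (10 + 200 * C) * s / L^2 * (1/d) = 10 * (s / L^2 * (1/d)) + 200 * (C * s / L^2 * (1/d)) := by ring
  have r2 : (10 + 200 * C) * s / L * (1/d) = 10 * s / L * (1/d) + 10 * (20 * C * s / L * (1/d)) := by ring
  have r3 : 100 * C * s / L^2 * (1/d) = 100 * (C * s / L^2 * (1/d)) := by ring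
  have p3 : 0 ≤ 20 * C * s / L * (1/d) := by positivity
  rw [r3] at b1
  obtain ⟨m1, m2⟩ := abs_le.mp main
  by_cases hη2 : (η * X) ^ ((1:ℝ)/2) ≤ d * w
  · rw [if_pos ⟨hη2, hdw⟩, r1, r2, abs_le]
    constructor <;> linarith
  · have : cnt a b d w = F := by
      rw [cnt, hF]
      congr 2
      apply filter_congr
      intro r hr
      rw [mem_Icc] at hr
      have h1 := Nat.ceil_le.mp hr.1
      rw [div_le_iff₀ hd0] at h1
      constructor
      · tauto
      · intro h; refine ⟨h, ?_⟩
        push Not at hη2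
        by_contra hc
        push Not at hc
        have := mul_le_mul_of_nonneg_left hc.le hd0.le
        linarith
    rw [if_neg (by tauto), this, r1, abs_le]
    constructor <;> linarith

end PNTaux

namespace PNTaux
open Filter Topology Asymptotics

lemma psi_eq {n : ℕ} (hn : n ≠ 0) (z : ℝ) :
    psi n z = if n = 1 ∨ z ≤ (n.minFac : ℝ) then 1 else 0 := by
  rw [psi]
  apply if_congr _ rfl rfl
  constructor
  · intro h
    by_cases h1 : n = 1
    · exact Or.inl h1
    · exact Or.inr (h _ (Nat.minFac_prime h1) (Nat.minFac_dvd n))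
  · rintro (h | h) p hp hpn
    · subst h; exact absurd (Nat.dvd_one.mp hpn) hp.ne_one
    · exact h.trans (by exact_mod_cast Nat.minFac_le_of_dvd hp.two_le hpn)

/-- Buchstab sum: only the smallest prime factor contributes. -/
lemma sum_minFac {n : ℕ} (hn : n ≠ 0) (R : ℕ → Prop) [DecidablePred R] :
    ∑ q ∈ n.primeFactors.filter R, psi (n / q) (q:ℝ) = if n ≠ 1 ∧ R n.minFac then 1 else 0 := by
  have key : ∀ q ∈ n.primeFactors, psi (n/q) (q:ℝ) = if q = n.minFac then 1 else 0 := by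
    intro q hq
    rw [Nat.mem_primeFactors] at hq
    obtain ⟨hqp, hqn, _⟩ := hq
    have hn1 : n ≠ 1 := by rintro rfl; exact hqp.ne_one (Nat.dvd_one.mp hqn)
    rw [psi]
    apply if_congr _ rfl rfl
    constructor
    · intro h
      have hm := Nat.minFac_prime hn1
      have hle : n.minFac ≤ q := Nat.minFac_le_of_dvd hqp.two_le hqn
      by_contra hne
      have hd : n.minFac ∣ n / q := by
        have h1 : n.minFac ∣ q * (n/q) := by rw [Nat.mul_div_cancel' hqn]; exact Nat.minFac_dvd n
        rcases (Nat.Prime.dvd_mul hm).mp h1 with h2 | h2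
        · exact absurd ((Nat.prime_dvd_prime_iff_eq hm hqp).mp h2).symm hne
        · exact h2
      have := h _ hm hd
      have : q ≤ n.minFac := by exact_mod_cast this
      omega
    · rintro rfl p hp hpd
      exact_mod_cast Nat.minFac_le_of_dvd hp.two_le (hpd.trans (Nat.div_dvd_of_dvd hqn))
  rw [sum_congr rfl (fun q hq => key q (mem_filter.mp hq).1), sum_ite_eq']
  apply if_congr _ rfl rfl
  rw [mem_filter, Nat.mem_primeFactors]
  constructor
  · rintro ⟨⟨h1, _⟩, h2⟩
    refine ⟨?_, h2⟩
    rintro rfl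
    simp at h1
    exact absurd h1 (by norm_num)
  · rintro ⟨h1, h2⟩
    exact ⟨⟨Nat.minFac_prime h1, Nat.minFac_dvd n, hn⟩, h2⟩

lemma buchstab {n : ℕ} (hn : n ≠ 0) {z w : ℝ} (hzw : z ≤ w) :
    psi n z - psi n w = ∑ q ∈ n.primeFactors.filter (fun q : ℕ => z ≤ (q:ℝ) ∧ (q:ℝ) < w), psi (n / q) (q:ℝ) := by
  rw [sum_minFac hn, psi_eq hn, psi_eq hn]
  by_cases h1 : n = 1
  · simp [h1]
  · by_cases h2 : w ≤ n.minFac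
    · simp [h1, h2, hzw.trans h2]
    · simp [h1, h2, lt_of_not_ge h2]

lemma psi_first {m : ℕ} {z y : ℝ} (hm1 : y < m) (hm2 : (m:ℝ) ≤ y^2) (hy : 1 ≤ y) (hzy : z ≤ y) :
    psi m z = (if m.Prime then 1 else 0) +
      ∑ p ∈ m.primeFactors.filter (fun p : ℕ => z ≤ (p:ℝ) ∧ (p:ℝ) ≤ y), psi (m / p) (p:ℝ) := by
  have hm0 : m ≠ 0 := by rintro rfl; simp at hm1; linarith
  have hm1' : m ≠ 1 := by rintro rfl; simp at hm1; linarith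
  rw [sum_minFac hm0, psi_eq hm0]
  by_cases hp : m.Prime
  · have : ¬ (m:ℝ) ≤ y := not_le.mpr hm1
    simp [hp, hp.minFac_eq, this, hzy.trans hm1.le]
  · have : (m.minFac : ℝ) ≤ y := by
      have h := Nat.minFac_sq_le_self (by omega) hp
      have h' : (m.minFac : ℝ)^2 ≤ m := by exact_mod_cast h
      exact le_of_sq_le_sq (h'.trans hm2) (by linarith)
    simp [hp, hm1', this]

lemma psi_two {j : ℕ} {r : ℝ} (hj0 : j ≠ 0) (hj : (j:ℝ) < r^2) (hr : 0 ≤ r) :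
    psi j r = (if j = 1 then 1 else 0) + if j.Prime ∧ r ≤ (j:ℝ) then 1 else 0 := by
  rw [psi_eq hj0]
  by_cases h1 : j = 1
  · simp [h1, Nat.not_prime_one]
  by_cases hp : j.Prime
  · simp [h1, hp, hp.minFac_eq]
  · have : ¬ r ≤ (j.minFac : ℝ) := by
      intro hc
      have h := Nat.minFac_sq_le_self (by omega) hp
      have h' : (j.minFac : ℝ)^2 ≤ j := by exact_mod_cast h
      have := pow_le_pow_left₀ hr hc 2
      linarith
    simp [h1, hp, this]

lemma psi_three {k : ℕ} (hk : k ≠ 0) (q : ℝ) :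
    psi k q = (if k = 1 then 1 else 0) +
      ∑ r ∈ k.primeFactors.filter (fun r : ℕ => q ≤ (r:ℝ)), psi (k / r) (r:ℝ) := by
  rw [sum_minFac hk, psi_eq hk]
  by_cases h1 : k = 1 <;> simp [h1]

lemma reindex {u v : ℝ} (hu : 0 < u) (P : Finset ℕ) (Q : ℕ → Prop) [DecidablePred Q] (hP : ∀ p ∈ P, p.Prime)
    (hQ : ∀ p : ℕ, p.Prime → Q p → (p:ℝ) ≤ v → p ∈ P) (g : ℕ → ℕ → ℝ) :
    ∑ m ∈ Icc ⌈u⌉₊ ⌊v⌋₊, ∑ p ∈ m.primeFactors.filter Q, g p (m / p) =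
    ∑ p ∈ P, if Q p then ∑ k ∈ Icc ⌈u/p⌉₊ ⌊v/p⌋₊, g p k else 0 := by
  rw [← sum_filter]
  rw [Finset.sum_sigma', Finset.sum_sigma']
  refine sum_bij' (fun x _ => ⟨x.2, x.1 / x.2⟩) (fun x _ => ⟨x.1 * x.2, x.1⟩) ?_ ?_ ?_ ?_ ?_
  · rintro ⟨m, p⟩ h
    simp only [mem_sigma, mem_Icc, mem_filter, Nat.mem_primeFactors] at h ⊢
    obtain ⟨⟨h1, h2⟩, ⟨hp, hpm, hm0⟩, hq⟩ := h
    have hm : (m:ℝ) ≤ v := (Nat.le_floor_iff' hm0).mp h2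
    have hp0 : (0:ℝ) < p := by exact_mod_cast hp.pos
    have hpm' : (p:ℝ) ≤ m := by exact_mod_cast Nat.le_of_dvd (Nat.pos_of_ne_zero hm0) hpm
    refine ⟨⟨hQ p hp hq (hpm'.trans hm), hq⟩, ?_, ?_⟩
    · rw [Nat.ceil_le, div_le_iff₀ hp0]
      have := Nat.ceil_le.mp h1
      rw [← Nat.cast_mul, Nat.div_mul_cancel hpm]; exact this
    · rw [Nat.le_floor_iff (by have : (0:ℝ) ≤ m := Nat.cast_nonneg _
                               exact div_nonneg (by linarith) hp0.le), le_div_iff₀ hp0]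
      rw [← Nat.cast_mul, Nat.div_mul_cancel hpm]; exact hm
  · rintro ⟨p, k⟩ h
    simp only [mem_sigma, mem_Icc, mem_filter, Nat.mem_primeFactors] at h ⊢
    obtain ⟨⟨hpP, hq⟩, h1, h2⟩ := h
    have hp := hP p hpP
    have hp0 : (0:ℝ) < p := by exact_mod_cast hp.pos
    have h1' := Nat.ceil_le.mp h1
    have hk0 : k ≠ 0 := by
      rintro rfl
      have : 0 < u / p := by positivity
      simp at h1'; linarith
    have h2' := (Nat.le_floor_iff' hk0).mp h2
    rw [div_le_iff₀ hp0] at h1'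
    rw [le_div_iff₀ hp0] at h2'
    refine ⟨⟨?_, ?_⟩, ⟨hp, dvd_mul_right _ _, mul_ne_zero hp.ne_zero hk0⟩, hq⟩
    · rw [Nat.ceil_le]; push_cast; linarith
    · rw [Nat.le_floor_iff' (mul_ne_zero hp.ne_zero hk0)]; push_cast; linarith
  · rintro ⟨m, p⟩ h
    simp only [mem_sigma, mem_Icc, mem_filter, Nat.mem_primeFactors] at h ⊢
    rw [Nat.mul_div_cancel' h.2.1.2.1]
  · rintro ⟨p, k⟩ h
    simp only [mem_sigma, mem_Icc, mem_filter, Nat.mem_primeFactors] at h ⊢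
    rw [Nat.mul_div_cancel_left _ (hP p h.1.1).pos]
  · rintro ⟨m, p⟩ h
    rfl

end PNTaux

namespace PNTaux
open Filter Topology Asymptotics

noncomputable def al (X : ℝ) (n : ℕ) : ℝ := Real.log n / Real.log X

noncomputable def PX (X : ℝ) : Finset ℕ :=
  (Icc 1 ⌊X⌋₊).filter (fun p => p.Prime ∧ X ^ ((1:ℝ)/20) ≤ (p:ℝ))

def W1 (α β : ℝ) : Prop := 10/84 ≤ α ∧ α < 12/84 ∧ 15/84 - α/2 ≤ β ∧ β < α
def W2 (α β : ℝ) : Prop := 18/84 < α ∧ α ≤ 21/84 ∧ 30/84 - α ≤ β ∧ β < α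

lemma rpow_al {X : ℝ} (hX : 1 < X) {n : ℕ} (hn : n ≠ 0) : X ^ (al X n) = n := by
  have hL : 0 < Real.log X := Real.log_pos hX
  have hn' : (0:ℝ) < n := by positivity
  rw [al, Real.rpow_def_of_pos (by linarith), mul_div_cancel₀ _ hL.ne', Real.exp_log hn']

lemma le_al {X : ℝ} (hX : 1 < X) {n : ℕ} (hn : n ≠ 0) (x : ℝ) : X ^ x ≤ n ↔ x ≤ al X n := by
  rw [← rpow_al hX hn, Real.rpow_le_rpow_left_iff hX]
lemma lt_al {X : ℝ} (hX : 1 < X) {n : ℕ} (hn : n ≠ 0) (x : ℝ) : X ^ x < n ↔ x < al X n := by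
  rw [← rpow_al hX hn, Real.rpow_lt_rpow_left_iff hX]
lemma al_le {X : ℝ} (hX : 1 < X) {n : ℕ} (hn : n ≠ 0) (x : ℝ) : n ≤ X ^ x ↔ al X n ≤ x := by
  rw [← rpow_al hX hn, Real.rpow_le_rpow_left_iff hX]
lemma al_lt {X : ℝ} (hX : 1 < X) {n : ℕ} (hn : n ≠ 0) (x : ℝ) : n < X ^ x ↔ al X n < x := by
  rw [← rpow_al hX hn, Real.rpow_lt_rpow_left_iff hX]
lemma al_lt_al {X : ℝ} (hX : 1 < X) {m n : ℕ} (hm : m ≠ 0) (hn : n ≠ 0) : (m:ℝ) < n ↔ al X m < al X n := by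
  rw [← lt_al hX hn, rpow_al hX hm]
lemma al_le_al {X : ℝ} (hX : 1 < X) {m n : ℕ} (hm : m ≠ 0) (hn : n ≠ 0) : (m:ℝ) ≤ n ↔ al X m ≤ al X n := by
  rw [← le_al hX hn, rpow_al hX hm]

lemma mem_PX {X : ℝ} (hX : 1 < X) {p : ℕ} : p ∈ PX X ↔ p.Prime ∧ 1/20 ≤ al X p ∧ al X p ≤ 1 := by
  rw [PX, mem_filter, mem_Icc]
  constructor
  · rintro ⟨⟨h1, h2⟩, h3, h4⟩
    rw [le_al hX h3.ne_zero] at h4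
    have := (Nat.le_floor_iff (by linarith)).mp h2
    rw [← Real.rpow_one X, al_le hX h3.ne_zero] at this
    exact ⟨h3, h4, this⟩
  · rintro ⟨h3, h4, h5⟩
    rw [← al_le hX h3.ne_zero, Real.rpow_one] at h5
    rw [← le_al hX h3.ne_zero] at h4
    exact ⟨⟨h3.pos, Nat.le_floor h5⟩, h3, h4⟩

noncomputable def zeta' (α : ℝ) : ℝ := if α < 1/7 then 5/28 - α/2 else if α ≤ 3/14 then α else 5/14 - α

lemma zP_eq {X : ℝ} (hX : 1 < X) {p : ℕ} (hp : p ≠ 0) : zP X p = X ^ (zeta' (al X p)) := by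
  have hX0 : 0 < X := by linarith
  unfold zP zeta'
  simp only [al_lt hX hp, al_le hX hp]
  split_ifs
  · nth_rw 1 [← rpow_al hX hp]
    rw [← Real.rpow_mul hX0.le, ← Real.rpow_add hX0]
    congr 1; ring
  · rw [rpow_al hX hp]
  · nth_rw 1 [← rpow_al hX hp]
    rw [← Real.rpow_sub hX0]

lemma cond_iff (α β : ℝ) : ((5/42 ≤ α ∧ α ≤ 1/4) ∧ (zeta' α ≤ β ∧ β < α)) ↔ W1 α β ∨ W2 α β := by
  unfold zeta' W1 W2
  split_ifs with h1 h2
  · constructor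
    · rintro ⟨⟨a, b⟩, c, d⟩
      left; refine ⟨?_, ?_, ?_, ?_⟩ <;> linarith
    · rintro (⟨a, b, c, d⟩ | ⟨a, b, c, d⟩)
      · refine ⟨⟨?_, ?_⟩, ?_, ?_⟩ <;> linarith
      · exfalso; linarith
  · constructor
    · rintro ⟨⟨a, b⟩, c, d⟩
      exfalso; linarith
    · rintro (⟨a, b, c, d⟩ | ⟨a, b, c, d⟩) <;> (exfalso; linarith)
  · constructor
    · rintro ⟨⟨a, b⟩, c, d⟩
      right; refine ⟨?_, ?_, ?_, ?_⟩ <;> linarith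
    · rintro (⟨a, b, c, d⟩ | ⟨a, b, c, d⟩)
      · exfalso; linarith
      · refine ⟨⟨?_, ?_⟩, ?_, ?_⟩ <;> linarith

lemma zeta'_le {α : ℝ} (h : 5/42 ≤ α) : zeta' α ≤ α := by
  unfold zeta'; split_ifs <;> linarith

lemma rho_eq {X : ℝ} (hX : 1 < X) {m : ℕ} (hm1 : X ^ ((1:ℝ)/4) < m) (hm2 : (m:ℝ) ≤ X ^ ((1:ℝ)/2)) :
    rho X m = (if m.Prime then 1 else 0) -
      ∑ p ∈ m.primeFactors.filter (fun p : ℕ => X ^ ((5:ℝ)/42) ≤ (p:ℝ) ∧ (p:ℝ) ≤ X ^ ((1:ℝ)/4)),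
        ∑ q ∈ (m/p).primeFactors.filter (fun q : ℕ => zP X p ≤ (q:ℝ) ∧ (q:ℝ) < p), psi (m / p / q) (q:ℝ) := by
  have hX0 : 0 < X := by linarith
  have e1 := psi_first (z := X ^ ((5:ℝ)/42)) hm1 (by
    rw [← Real.rpow_natCast, ← Real.rpow_mul hX0.le]; norm_num; norm_num at hm2; exact hm2)
    (Real.one_le_rpow hX.le (by norm_num)) (Real.rpow_le_rpow_of_exponent_le hX.le (by norm_num))
  rw [rho, e1, add_sub_assoc, ← sum_sub_distrib, sub_eq_add_neg _ (∑ _ ∈ _, _), ← sum_neg_distrib]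
  congr 1
  apply sum_congr rfl
  intro p hp
  rw [mem_filter, Nat.mem_primeFactors] at hp
  obtain ⟨⟨hp, hpm, hm0⟩, h1, h2⟩ := hp
  have hz : zP X p ≤ p := by
    rw [zP_eq hX hp.ne_zero, le_al hX hp.ne_zero]
    apply zeta'_le
    rw [← le_al hX hp.ne_zero]; exact h1
  have hne : m / p ≠ 0 := by
    intro h
    have := Nat.mul_div_cancel' hpm
    rw [h] at this; omega
  rw [← buchstab hne hz]; ring

end PNTaux

namespace PNTaux
open Filter Topology Asymptotics

lemma one_mem_iff {a b d : ℝ} (hd : 0 < d) : 1 ∈ Icc ⌈a/d⌉₊ ⌊b/d⌋₊ ↔ a ≤ d ∧ d ≤ b := by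
  rw [mem_Icc, Nat.ceil_le, Nat.one_le_floor_iff, Nat.cast_one, div_le_one hd, one_le_div hd]

lemma sum_one {a b d : ℝ} (hd : 0 < d) :
    ∑ k ∈ Icc ⌈a/d⌉₊ ⌊b/d⌋₊, (if k = 1 then (1:ℝ) else 0) = if a ≤ d ∧ d ≤ b then 1 else 0 := by
  rw [sum_ite_eq']
  simp only [one_mem_iff hd]

lemma inner_sum {X a b : ℝ} (hX : 1 < X) (ha : 0 < a) (hb : b ≤ X ^ ((1:ℝ)/2))
    {p q : ℕ} (hp : p.Prime) (hq : q.Prime) (hq' : 1/20 ≤ al X q) (hW : 1/2 < al X p + 4 * al X q) :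
    ∑ k ∈ Icc ⌈a/(p*q)⌉₊ ⌊b/(p*q)⌋₊, psi k (q:ℝ) =
      (if a ≤ (p:ℝ)*q ∧ (p:ℝ)*q ≤ b then 1 else 0) + (cnt a b (p*q) q +
        ∑ r ∈ PX X, if q ≤ r then cnt a b (p*q*r) r else 0) := by
  have hX0 : 0 < X := by linarith
  have hp0 : (0:ℝ) < p := by exact_mod_cast hp.pos
  have hq0 : (0:ℝ) < q := by exact_mod_cast hq.pos
  have hk0 : ∀ {d : ℝ}, 0 < d → ∀ {k : ℕ}, k ∈ Icc ⌈a/d⌉₊ ⌊b/d⌋₊ → k ≠ 0 := by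
    rintro d hd k hk rfl
    rw [mem_Icc, Nat.ceil_le] at hk
    have : 0 < a/d := by positivity
    simp at hk; linarith
  have s1 : ∑ k ∈ Icc ⌈a/(p*q)⌉₊ ⌊b/(p*q)⌋₊, psi k (q:ℝ) =
      ∑ k ∈ Icc ⌈a/(p*q)⌉₊ ⌊b/(p*q)⌋₊, ((if k = 1 then (1:ℝ) else 0) +
      ∑ r ∈ k.primeFactors.filter (fun r : ℕ => (q:ℝ) ≤ (r:ℝ)), psi (k / r) (r:ℝ)) :=
    sum_congr rfl fun k hk => psi_three (hk0 (by positivity) hk) q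
  rw [s1, sum_add_distrib, sum_one (by positivity)]
  congr 1
  have hv : b/(p*q) ≤ X := by
    have h1 : X ^ ((1:ℝ)/2) ≤ X := by
      nth_rw 2 [← Real.rpow_one X]
      exact Real.rpow_le_rpow_of_exponent_le hX.le (by norm_num)
    have h2 : (1:ℝ) ≤ p*q := by
      have : 1 ≤ p * q := Nat.one_le_iff_ne_zero.mpr (mul_ne_zero hp.ne_zero hq.ne_zero)
      exact_mod_cast this
    rw [div_le_iff₀ (by positivity)]
    nlinarith
  have hPX : ∀ r : ℕ, r.Prime → (q:ℝ) ≤ r → (r:ℝ) ≤ b/(p*q) → r ∈ PX X := by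
    intro r hr hqr hrv
    rw [mem_PX hX]
    refine ⟨hr, hq'.trans ((al_le_al hX hq.ne_zero hr.ne_zero).mp hqr), ?_⟩
    rw [← al_le hX hr.ne_zero, Real.rpow_one]; linarith
  rw [reindex (by positivity) (PX X) (fun r : ℕ => (q:ℝ) ≤ (r:ℝ)) (fun r hr => ((mem_PX hX).mp hr).1)
    hPX (fun r j => psi j (r:ℝ))]
  have s2 : ∀ r ∈ PX X, (if (q:ℝ) ≤ r then ∑ j ∈ Icc ⌈a/(p*q)/r⌉₊ ⌊b/(p*q)/r⌋₊, psi j (r:ℝ) else 0) =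
      (if (q:ℝ) ≤ r ∧ (a/(p*q) ≤ r ∧ r ≤ b/(p*q)) then 1 else 0) + (if q ≤ r then cnt a b (p*q*r) r else 0) := by
    intro r hr
    have hrp := ((mem_PX hX).mp hr).1
    have hr0 : (0:ℝ) < r := by exact_mod_cast hrp.pos
    by_cases hqr : q ≤ r
    · have hqr' : (q:ℝ) ≤ r := by exact_mod_cast hqr
      rw [if_pos hqr', if_pos hqr]
      have : ∀ j ∈ Icc ⌈a/(p*q)/r⌉₊ ⌊b/(p*q)/r⌋₊, psi j (r:ℝ) =
        (if j = 1 then (1:ℝ) else 0) + if j.Prime ∧ (r:ℝ) ≤ (j:ℝ) then 1 else 0 := by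
        intro j hj
        rw [div_div, div_div] at hj
        have hj0 := hk0 (by positivity) hj
        refine psi_two hj0 ?_ hr0.le
        rw [mem_Icc] at hj
        have hj2 := (Nat.le_floor_iff' hj0).mp hj.2
        refine hj2.trans_lt ?_
        rw [div_lt_iff₀ (by positivity)]
        have g1 : X ^ ((1:ℝ)/2) < p * q^4 := by
          rw [← rpow_al hX hp.ne_zero, ← rpow_al hX hq.ne_zero, ← Real.rpow_natCast, ← Real.rpow_mul hX0.le,
            ← Real.rpow_add hX0, Real.rpow_lt_rpow_left_iff hX]
          push_cast; linarith
        have g2 : (p:ℝ) * q^4 ≤ p*q*r^3 := by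
          have : (q:ℝ)^3 ≤ r^3 := pow_le_pow_left₀ hq0.le hqr' 3
          have := mul_le_mul_of_nonneg_left this (by positivity : 0 ≤ (p:ℝ)*q)
          calc _ = (p:ℝ)*q*q^3 := by ring
            _ ≤ _ := this
        calc b ≤ _ := hb
          _ < _ := g1
          _ ≤ _ := g2
          _ = _ := by ring
      rw [sum_congr rfl this, sum_add_distrib, sum_one hr0]
      congr 1
      · simp only [hqr', true_and]
      · rw [sum_boole, cnt, div_div, div_div]
    · have hqr' : ¬ (q:ℝ) ≤ r := by exact_mod_cast hqr
      rw [if_neg hqr', if_neg hqr, if_neg (by tauto)]; simp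
  rw [sum_congr rfl s2, sum_add_distrib]
  congr 1
  rw [sum_boole, cnt]
  congr 2
  ext r
  simp only [mem_filter, mem_Icc]
  constructor
  · rintro ⟨h1, h2, h3, h4⟩
    exact ⟨⟨Nat.ceil_le.mpr h3, Nat.le_floor h4⟩, ((mem_PX hX).mp h1).1, h2⟩
  · rintro ⟨⟨h1, h2⟩, h3, h4⟩
    have h2' := (Nat.le_floor_iff' h3.ne_zero).mp h2
    exact ⟨hPX r h3 h4 h2', h4, Nat.ceil_le.mp h1, h2'⟩

lemma rho_sum {X a b : ℝ} (hX : 1 < X) (ha : X ^ ((1:ℝ)/4) < a) (hb : b ≤ X ^ ((1:ℝ)/2)) :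
    ∑ m ∈ Icc ⌈a⌉₊ ⌊b⌋₊, rho X m = cnt a b 1 (X ^ ((3:ℝ)/28)) -
      ∑ p ∈ PX X, ∑ q ∈ PX X, if W1 (al X p) (al X q) ∨ W2 (al X p) (al X q) then
      (if a ≤ (p:ℝ)*q ∧ (p:ℝ)*q ≤ b then 1 else 0) + (cnt a b (p*q) q +
        ∑ r ∈ PX X, if q ≤ r then cnt a b (p*q*r) r else 0) else 0 := by
  have hX0 : 0 < X := by linarith
  have h14 : 0 < X ^ ((1:ℝ)/4) := by positivity
  have ha0 : 0 < a := by linarith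
  have hbX : b ≤ X := hb.trans (by
      nth_rw 2 [← Real.rpow_one X]
      exact Real.rpow_le_rpow_of_exponent_le hX.le (by norm_num))
  have hm' : ∀ m ∈ Icc ⌈a⌉₊ ⌊b⌋₊, X ^ ((1:ℝ)/4) < m ∧ (m:ℝ) ≤ X ^ ((1:ℝ)/2) := fun m hm => by
    rw [mem_Icc] at hm
    have h1 := Nat.ceil_le.mp hm.1
    have hm0 : m ≠ 0 := by rintro rfl; rw [Nat.cast_zero] at h1; linarith
    exact ⟨ha.trans_le h1, ((Nat.le_floor_iff' hm0).mp hm.2).trans hb⟩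
  rw [sum_congr rfl (fun m hm => rho_eq hX (hm' m hm).1 (hm' m hm).2), sum_sub_distrib]
  congr 1
  · rw [sum_boole, cnt, div_one, div_one]
    congr 2
    apply filter_congr
    intro m hm
    rw [mem_Icc] at hm
    have h1 := Nat.ceil_le.mp hm.1
    have : X ^ ((3:ℝ)/28) ≤ X ^ ((1:ℝ)/4) := Real.rpow_le_rpow_of_exponent_le hX.le (by norm_num)
    constructor
    · intro h; exact ⟨h, by linarith⟩
    · tauto
  rw [reindex ha0 (PX X) (fun p : ℕ => X ^ ((5:ℝ)/42) ≤ (p:ℝ) ∧ (p:ℝ) ≤ X ^ ((1:ℝ)/4))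
    (fun r hr => ((mem_PX hX).mp hr).1) ?_
    (fun p k => ∑ q ∈ k.primeFactors.filter (fun q : ℕ => zP X p ≤ (q:ℝ) ∧ (q:ℝ) < p), psi (k / q) (q:ℝ))]
  swap
  · rintro p hp ⟨h1, h2⟩ h3
    rw [mem_PX hX]
    rw [le_al hX hp.ne_zero] at h1
    rw [al_le hX hp.ne_zero] at h2
    exact ⟨hp, by linarith, by linarith⟩
  apply sum_congr rfl
  intro p hpP
  have hp := ((mem_PX hX).mp hpP).1
  have hp0 : (0:ℝ) < p := by exact_mod_cast hp.pos
  have hcond : ∀ q ∈ PX X, ((X ^ ((5:ℝ)/42) ≤ (p:ℝ) ∧ (p:ℝ) ≤ X ^ ((1:ℝ)/4)) ∧ (zP X p ≤ (q:ℝ) ∧ (q:ℝ) < p)) ↔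
      W1 (al X p) (al X q) ∨ W2 (al X p) (al X q) := by
    intro q hqP
    have hq := ((mem_PX hX).mp hqP).1
    rw [zP_eq hX hp.ne_zero, le_al hX hp.ne_zero, al_le hX hp.ne_zero, le_al hX hq.ne_zero,
      al_lt_al hX hq.ne_zero hp.ne_zero]
    exact cond_iff _ _
  by_cases hQ : X ^ ((5:ℝ)/42) ≤ (p:ℝ) ∧ (p:ℝ) ≤ X ^ ((1:ℝ)/4)
  swap
  · rw [if_neg hQ]
    symm
    apply sum_eq_zero
    intro q hq
    rw [if_neg]
    rw [← hcond q hq]; tauto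
  rw [if_pos hQ, reindex (by positivity) (PX X) (fun q : ℕ => zP X p ≤ (q:ℝ) ∧ (q:ℝ) < p)
    (fun r hr => ((mem_PX hX).mp hr).1) ?_ (fun q k => psi k (q:ℝ))]
  swap
  · rintro q hq ⟨h1, h2⟩ h3
    rw [mem_PX hX]
    have := (cond_iff (al X p) (al X q)).mp (by
      rw [zP_eq hX hp.ne_zero, le_al hX hq.ne_zero] at h1
      rw [al_lt_al hX hq.ne_zero hp.ne_zero] at h2
      rw [le_al hX hp.ne_zero, al_le hX hp.ne_zero] at hQ
      exact ⟨hQ, h1, h2⟩)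
    refine ⟨hq, ?_, ?_⟩ <;> rcases this with ⟨a, b, c, d⟩ | ⟨a, b, c, d⟩ <;> linarith
  apply sum_congr rfl
  intro q hqP
  have hq := (mem_PX hX).mp hqP
  have hiff := hcond q hqP
  by_cases hW : W1 (al X p) (al X q) ∨ W2 (al X p) (al X q)
  · rw [if_pos hW, if_pos (hiff.mpr hW).2]
    rw [div_div, div_div]
    refine inner_sum hX ha0 hb hp hq.1 hq.2.1 ?_
    rcases hW with ⟨a, b, c, d⟩ | ⟨a, b, c, d⟩ <;> linarith
  · rw [if_neg hW, if_neg (by tauto)]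

end PNTaux

namespace PNTaux
open Filter Topology Asymptotics

noncomputable def S (X : ℝ) (f : ℝ → ℝ) : ℝ := ∑ p ∈ PX X, (1/(p:ℝ)) * f (al X p)

noncomputable def ind (A : Set ℝ) (α : ℝ) : ℝ := if α ∈ A then 1 else 0

lemma big_X {X : ℝ} (hX : 2^20 ≤ X) : 1 < X ∧ 0 < Real.log X := by
  have : 1 < X := by linarith
  exact ⟨this, Real.log_pos this⟩

lemma S_mono {X : ℝ} {f g : ℝ → ℝ} (h : ∀ p ∈ PX X, f (al X p) ≤ g (al X p)) : S X f ≤ S X g := by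
  apply sum_le_sum
  intro p hp
  exact mul_le_mul_of_nonneg_left (h p hp) (by positivity)

lemma S_add {X : ℝ} {f g : ℝ → ℝ} : S X (fun α => f α + g α) = S X f + S X g := by
  simp only [S, mul_add, sum_add_distrib]

lemma S_mul {X c : ℝ} {f : ℝ → ℝ} : S X (fun α => c * f α) = c * S X f := by
  simp only [S, mul_sum]
  apply sum_congr rfl; intros; ring

lemma S_nonneg {X : ℝ} {f : ℝ → ℝ} (h : ∀ p ∈ PX X, 0 ≤ f (al X p)) : 0 ≤ S X f :=
  sum_nonneg fun p hp => mul_nonneg (by positivity) (h p hp)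

lemma S_Ioc {X x1 x2 : ℝ} (hX : 2^20 ≤ X) (h1 : 1/20 ≤ x1) (h3 : x2 ≤ 1) :
    S X (ind (Set.Ioc x1 x2)) = ∑ p ∈ (Ioc ⌊X^x1⌋₊ ⌊X^x2⌋₊).filter Nat.Prime, (1:ℝ)/p := by
  obtain ⟨hX1, hL⟩ := big_X hX
  have hX0 : 0 < X := by linarith
  simp only [S, ind, mul_ite, mul_one, mul_zero]
  rw [← sum_filter]
  apply sum_congr _ (fun _ _ => rfl)
  ext p
  simp only [mem_filter, mem_PX hX1, Set.mem_Ioc, Finset.mem_Ioc]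
  constructor
  · rintro ⟨⟨hp, h4, h5⟩, h6, h7⟩
    refine ⟨⟨?_, ?_⟩, hp⟩
    · rw [Nat.floor_lt (by positivity), lt_al hX1 hp.ne_zero]; exact h6
    · apply Nat.le_floor; rw [al_le hX1 hp.ne_zero]; exact h7
  · rintro ⟨⟨h4, h5⟩, hp⟩
    rw [Nat.floor_lt (by positivity), lt_al hX1 hp.ne_zero] at h4
    have h6 := (Nat.le_floor_iff (by positivity)).mp h5
    rw [al_le hX1 hp.ne_zero] at h6
    exact ⟨⟨hp, by linarith, by linarith⟩, h4, h6⟩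

lemma mass_Ioc : ∃ C > 0, ∀ X : ℝ, 2^20 ≤ X → ∀ x1 x2 : ℝ, 1/20 ≤ x1 → x1 ≤ x2 → x2 ≤ 1 →
    |S X (ind (Set.Ioc x1 x2)) - Real.log (x2/x1)| ≤ C / Real.log X := by
  obtain ⟨C, hC, H⟩ := mertens
  refine ⟨20*C, by positivity, fun X hX x1 x2 h1 h2 h3 => ?_⟩
  obtain ⟨hX1, hL⟩ := big_X hX
  have hX0 : 0 < X := by linarith
  rw [S_Ioc hX h1 h3]
  have g1 : 2 ≤ X^x1 := by
    calc (2:ℝ) = ((2:ℝ)^(20:ℝ))^((1:ℝ)/20) := by rw [← Real.rpow_mul (by norm_num)]; norm_num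
      _ ≤ X^((1:ℝ)/20) := by
        apply Real.rpow_le_rpow (by positivity) _ (by norm_num)
        exact_mod_cast hX
      _ ≤ _ := Real.rpow_le_rpow_of_exponent_le hX1.le h1
  have := H (X^x1) (X^x2) g1 (Real.rpow_le_rpow_of_exponent_le hX1.le h2)
  rw [Real.log_rpow hX0, Real.log_rpow hX0, mul_div_mul_right _ _ hL.ne'] at this
  refine this.trans ?_
  calc C / (x1 * Real.log X) ≤ C / (1/20 * Real.log X) := by gcongr
    _ = _ := by field_simp

lemma mass_pt {X : ℝ} (hX : 2^20 ≤ X) (x : ℝ) : S X (ind {x}) ≤ 20 / Real.log X := by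
  obtain ⟨hX1, hL⟩ := big_X hX
  have hX0 : 0 < X := by linarith
  have hb : ∀ p ∈ PX X, 1/(p:ℝ) ≤ 20/Real.log X := by
    intro p hp
    obtain ⟨hp, h1, h2⟩ := (mem_PX hX1).mp hp
    have hp0 : (0:ℝ) < p := by exact_mod_cast hp.pos
    have h3 : Real.log p ≤ p := (Real.log_le_sub_one_of_pos hp0).trans (by linarith)
    rw [al, le_div_iff₀ hL] at h1
    rw [div_le_div_iff₀ hp0 hL]; linarith
  by_cases h : ∃ p ∈ PX X, al X p = x
  · obtain ⟨p, hp, rfl⟩ := h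
    rw [S, sum_eq_single p]
    · simpa [ind] using hb p hp
    · intro q hq hne
      rw [ind, if_neg, mul_zero]
      rw [Set.mem_singleton_iff]
      intro h
      apply hne
      have h1 := rpow_al hX1 ((mem_PX hX1).mp hp).1.ne_zero
      rw [← h, rpow_al hX1 ((mem_PX hX1).mp hq).1.ne_zero] at h1
      exact_mod_cast h1
    · intro h; exact absurd hp h
  · push Not at h
    rw [S, sum_eq_zero]
    · positivity
    · intro p hp
      rw [ind, if_neg (by simpa using h p hp), mul_zero]

lemma mass_Icc : ∃ C > 0, ∀ X : ℝ, 2^20 ≤ X → ∀ x1 x2 : ℝ, 1/20 ≤ x1 → x1 ≤ x2 → x2 ≤ 1 →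
    S X (ind (Set.Icc x1 x2)) ≤ (x2 - x1)/x1 + C / Real.log X := by
  obtain ⟨C, hC, H⟩ := mass_Ioc
  refine ⟨C+20, by positivity, fun X hX x1 x2 h1 h2 h3 => ?_⟩
  have a1 := (abs_le.mp (H X hX x1 x2 h1 h2 h3)).2
  have a2 := mass_pt hX x1
  have a3 : S X (ind (Set.Icc x1 x2)) ≤ S X (ind (Set.Ioc x1 x2)) + S X (ind {x1}) := by
    rw [← S_add]
    apply S_mono
    intro p _
    simp only [ind, Set.mem_Icc, Set.mem_Ioc, Set.mem_singleton_iff]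
    by_cases h : al X p = x1
    · simp [h, h2]
    · have : x1 ≤ al X p ↔ x1 < al X p := ⟨fun g => lt_of_le_of_ne g (Ne.symm h), le_of_lt⟩
      simp [h, this]
  have a4 : Real.log (x2/x1) ≤ (x2-x1)/x1 := by
    have : 0 < x1 := by linarith
    have := Real.log_le_sub_one_of_pos (show 0 < x2/x1 by have : 0 < x2 := by linarith
                                                          positivity)
    rw [sub_div, div_self (by linarith)]; exact this
  rw [add_div]; linarith

/-- short interval bound -/
lemma mass_short : ∃ C > 0, ∀ X : ℝ, 2^20 ≤ X → ∀ x1 x2 : ℝ, x1 ≤ x2 →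
    S X (ind (Set.Icc x1 x2)) ≤ 20*(x2 - x1) + C / Real.log X := by
  obtain ⟨C, hC, H⟩ := mass_Icc
  refine ⟨C, hC, fun X hX x1 x2 h1 => ?_⟩
  obtain ⟨hX1, hL⟩ := big_X hX
  by_cases hx : max x1 (1/20) ≤ min x2 1
  · have e : S X (ind (Set.Icc x1 x2)) ≤ S X (ind (Set.Icc (max x1 (1/20)) (min x2 1))) := by
      apply S_mono
      intro p hp
      obtain ⟨hp, g1, g2⟩ := (mem_PX hX1).mp hp
      simp only [ind, Set.mem_Icc, max_le_iff, le_min_iff, g1, g2, and_true]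
      exact le_rfl
    have := H X hX _ _ (le_max_right x1 (1/20)) hx (min_le_right _ _)
    have m0 : (1:ℝ)/20 ≤ max x1 (1/20) := le_max_right _ _
    have m1 : x1 ≤ max x1 (1/20) := le_max_left _ _
    have m2 : min x2 1 ≤ x2 := min_le_left _ _
    have : (min x2 1 - max x1 (1/20)) / max x1 (1/20) ≤ 20 * (x2 - x1) := by
      calc _ ≤ (min x2 1 - max x1 (1/20)) / (1/20) := by
            apply div_le_div_of_nonneg_left (by linarith) (by norm_num) m0
        _ = 20 * (min x2 1 - max x1 (1/20)) := by ring
        _ ≤ _ := by linarith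
    linarith
  · have : S X (ind (Set.Icc x1 x2)) = 0 := by
      rw [S, sum_eq_zero]
      intro p hp
      obtain ⟨hp, g1, g2⟩ := (mem_PX hX1).mp hp
      rw [ind, if_neg, mul_zero]
      rintro ⟨a, b⟩
      exact hx ((max_le a g1).trans (le_min b g2))
    rw [this]
    have : 0 ≤ x2 - x1 := by linarith
    positivity

lemma S_ord : ∃ C > 0, ∀ A : Set ℝ, A.OrdConnected → ∃ lam : ℝ, ∀ X : ℝ, 2^20 ≤ X →
    |S X (ind A) - lam| ≤ C / Real.log X := by
  obtain ⟨C, hC, H⟩ := mass_Ioc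
  refine ⟨C+20, by positivity, fun A hA => ?_⟩
  set B := A ∩ Set.Icc (1/20) 1 with hB
  have hBb : BddBelow B := ⟨1/20, fun x hx => hx.2.1⟩
  have hBa : BddAbove B := ⟨1, fun x hx => hx.2.2⟩
  by_cases hne : B.Nonempty
  swap
  · refine ⟨0, fun X hX => ?_⟩
    obtain ⟨hX1, hL⟩ := big_X hX
    have : S X (ind A) = 0 := by
      rw [S, sum_eq_zero]
      intro p hp
      obtain ⟨hp, g1, g2⟩ := (mem_PX hX1).mp hp
      rw [ind, if_neg, mul_zero]
      intro h
      exact hne ⟨_, h, g1, g2⟩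
    rw [this]; simp; positivity
  have k1 : 1/20 ≤ sInf B := le_csInf hne fun x hx => hx.2.1
  have k2 : sSup B ≤ 1 := csSup_le hne fun x hx => hx.2.2
  have k3 : sInf B ≤ sSup B := csInf_le_csSup hne hBb hBa
  refine ⟨Real.log (sSup B / sInf B), fun X hX => ?_⟩
  obtain ⟨hX1, hL⟩ := big_X hX
  obtain ⟨u1, u2⟩ := abs_le.mp (H X hX _ _ k1 k3 k2)
  have p1 := mass_pt hX (sInf B)
  have p2 := mass_pt hX (sSup B)
  have a1 : S X (ind A) ≤ S X (ind (Set.Ioc (sInf B) (sSup B))) + S X (ind {sInf B}) := by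
    rw [← S_add]
    apply S_mono
    intro p hp
    obtain ⟨hp, g1, g2⟩ := (mem_PX hX1).mp hp
    simp only [ind, Set.mem_Ioc, Set.mem_singleton_iff]
    by_cases h : al X p ∈ A
    · have hb : al X p ∈ B := ⟨h, g1, g2⟩
      have h1 := csInf_le hBb hb
      have h2 := le_csSup hBa hb
      by_cases h3 : al X p = sInf B
      · simp only [if_true, h3]; split_ifs <;> norm_num
      · have : sInf B < al X p := lt_of_le_of_ne h1 (Ne.symm h3)
        simp [h, h3, this, h2]
    · rw [if_neg h]; split_ifs <;> norm_num
  have a2 : S X (ind (Set.Ioc (sInf B) (sSup B))) ≤ S X (ind A) + S X (ind {sSup B}) := by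
    rw [← S_add]
    apply S_mono
    intro p hp
    simp only [ind, Set.mem_Ioc, Set.mem_singleton_iff]
    by_cases h : sInf B < al X p ∧ al X p ≤ sSup B
    · by_cases h3 : al X p = sSup B
      · rw [if_pos h, if_pos h3]; split_ifs <;> norm_num
      · have h4 : al X p < sSup B := lt_of_le_of_ne h.2 h3
        obtain ⟨x, hx, hx'⟩ := exists_lt_of_csInf_lt hne h.1
        obtain ⟨y, hy, hy'⟩ := exists_lt_of_lt_csSup hne h4
        have : al X p ∈ A := hA.out hx.1 hy.1 ⟨hx'.le, hy'.le⟩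
        simp [h, this, h3]
    · rw [if_neg h]; split_ifs <;> norm_num
  rw [add_div, abs_le]
  constructor <;> linarith

end PNTaux

namespace PNTaux
open Filter Topology Asymptotics

lemma layer {c M : ℝ} (hc : 0 ≤ c) (hM : c ≤ M) :
    ∫ t in (0:ℝ)..M, (if t < c then (1:ℝ) else 0) = c := by
  rw [intervalIntegral.integral_of_le (hc.trans hM)]
  have : (fun t : ℝ => if t < c then (1:ℝ) else 0) = (Set.Iio c).indicator (fun _ => 1) := by
    ext t; simp [Set.indicator]
  rw [this, setIntegral_indicator measurableSet_Iio]
  have : Set.Ioc 0 M ∩ Set.Iio c = Set.Ioo 0 c := by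
    ext t; simp only [Set.mem_inter_iff, Set.mem_Ioc, Set.mem_Iio, Set.mem_Ioo]
    constructor
    · rintro ⟨⟨a, b⟩, d⟩; exact ⟨a, d⟩
    · rintro ⟨a, b⟩; exact ⟨⟨a, by linarith⟩, b⟩
  rw [this, setIntegral_const]
  simp [hc]

lemma layer_int (c M : ℝ) : IntervalIntegrable (fun t : ℝ => if t < c then (1:ℝ) else 0) volume 0 M := by
  apply Antitone.intervalIntegrable
  intro a b hab
  dsimp only
  split_ifs <;> linarith

lemma S_layer {X M : ℝ} {f : ℝ → ℝ} (hf : ∀ α, 0 ≤ f α ∧ f α ≤ M) :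
    S X f = ∫ t in (0:ℝ)..M, S X (ind {α | t < f α}) := by
  simp only [S]
  rw [intervalIntegral.integral_finsetSum]
  · apply sum_congr rfl
    intro p _
    rw [intervalIntegral.integral_const_mul]
    simp only [ind, Set.mem_ofPred_eq]
    rw [layer (hf _).1 (hf _).2]
  · intro p _
    simp only [ind, Set.mem_ofPred_eq]
    exact (layer_int _ _).const_mul _

lemma S_cauchy : ∃ C > 0, ∀ (f : ℝ → ℝ) (M : ℝ), (∀ α, 0 ≤ f α ∧ f α ≤ M) →
    (∀ t ≥ 0, ({α | t < f α} : Set ℝ).OrdConnected) → ∀ X Y : ℝ, 2^20 ≤ X → X ≤ Y →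
    |S X f - S Y f| ≤ C * M / Real.log X := by
  obtain ⟨C, hC, H⟩ := S_ord
  refine ⟨2*C, by positivity, fun f M hf hA X Y hX hXY => ?_⟩
  have hM : 0 ≤ M := (hf 0).1.trans (hf 0).2
  obtain ⟨hX1, hL⟩ := big_X hX
  have hlog : Real.log X ≤ Real.log Y := Real.log_le_log (by linarith) hXY
  have hint : ∀ Z, IntervalIntegrable (fun t => S Z (ind {α | t < f α})) volume 0 M := by
    intro Z
    simp only [S, ind, Set.mem_ofPred_eq]
    have := IntervalIntegrable.sum (PX Z) (fun p _ => (layer_int (f (al Z p)) M).const_mul (1/(p:ℝ)))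
    refine (intervalIntegrable_congr (fun t _ => ?_)).mp this
    simp only [Finset.sum_apply]
  rw [S_layer (X := X) hf, S_layer (X := Y) hf, ← intervalIntegral.integral_sub (hint X) (hint Y)]
  have := intervalIntegral.norm_integral_le_of_norm_le_const (a := 0) (b := M)
    (f := fun t => S X (ind {α | t < f α}) - S Y (ind {α | t < f α})) (C := 2*C/Real.log X) ?_
  · rw [Real.norm_eq_abs, sub_zero, abs_of_nonneg hM] at this
    calc _ ≤ _ := this
      _ = _ := by ring
  · intro t ht
    rw [Set.uIoc_of_le hM] at ht
    obtain ⟨lam, hl⟩ := H _ (hA t ht.1.le)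
    have h1 := hl X hX
    have h2 := (hl Y (hX.trans hXY)).trans (div_le_div_of_nonneg_left hC.le hL hlog)
    rw [Real.norm_eq_abs]
    have e : 2*C/Real.log X = C/Real.log X + C/Real.log X := by ring
    rw [abs_le] at *
    constructor <;> linarith

lemma S_mass : ∃ D ≥ 1, ∀ X : ℝ, 2^20 ≤ X → S X (fun _ => 1) ≤ D := by
  obtain ⟨C, hC, H⟩ := mass_Icc
  refine ⟨19 + C, by linarith, fun X hX => ?_⟩
  obtain ⟨hX1, hL⟩ := big_X hX
  have h := H X hX (1/20) 1 le_rfl (by norm_num) le_rfl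
  have e : S X (fun _ => 1) ≤ S X (ind (Set.Icc (1/20) 1)) := by
    apply S_mono
    intro p hp
    obtain ⟨hp, g1, g2⟩ := (mem_PX hX1).mp hp
    rw [ind, if_pos ⟨g1, g2⟩]
  have hL1 : 1 ≤ Real.log X := by
    rw [Real.le_log_iff_exp_le (by linarith)]
    linarith [Real.exp_one_lt_d9]
  have : C/Real.log X ≤ C := div_le_self hC.le hL1
  norm_num at h e
  linarith

lemma S_bound {D X c : ℝ} (hD : S X (fun _ => 1) ≤ D) (hc : 0 ≤ c) {f g : ℝ → ℝ}
    (h : ∀ α, |f α - g α| ≤ c) : |S X f - S X g| ≤ D * c := by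
  rw [S, S, ← sum_sub_distrib]
  calc _ ≤ ∑ p ∈ PX X, |1/(p:ℝ) * f (al X p) - 1/(p:ℝ) * g (al X p)| := abs_sum_le_sum_abs _ _
    _ ≤ ∑ p ∈ PX X, 1/(p:ℝ) * c := by
      apply sum_le_sum
      intro p _
      rw [← mul_sub, abs_mul, abs_of_nonneg (by positivity)]
      exact mul_le_mul_of_nonneg_left (h _) (by positivity)
    _ = S X (fun _ => 1) * c := by simp only [S, sum_mul, mul_one]
    _ ≤ D * c := mul_le_mul_of_nonneg_right hD hc

lemma S_comm (X Y : ℝ) (f : ℝ → ℝ → ℝ) : S X (fun α => S Y (fun β => f α β)) = S Y (fun β => S X (fun α => f α β)) := by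
  simp only [S, mul_sum]
  rw [sum_comm]
  apply sum_congr rfl; intro p _
  apply sum_congr rfl; intro q _
  ring

/-- admissible kernel in one variable -/
def Adm (M : ℝ) (f : ℝ → ℝ) : Prop := (∀ α, 0 ≤ f α ∧ f α ≤ M) ∧ ∀ t ≥ 0, ({α | t < f α} : Set ℝ).OrdConnected

lemma S2_cauchy : ∃ C > 0, ∀ (f : ℝ → ℝ → ℝ) (M : ℝ), (∀ α, Adm M (f α)) → (∀ β, Adm M (fun α => f α β)) →
    ∀ X Y : ℝ, 2^20 ≤ X → X ≤ Y →
    |S X (fun α => S X (f α)) - S Y (fun α => S Y (f α))| ≤ C * M / Real.log X := by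
  obtain ⟨C, hC, H⟩ := S_cauchy
  obtain ⟨D, hD, HD⟩ := S_mass
  refine ⟨2*D*C, by positivity, fun f M h1 h2 X Y hX hXY => ?_⟩
  obtain ⟨hX1, hL⟩ := big_X hX
  have hM : 0 ≤ M := ((h1 0).1 0).1.trans ((h1 0).1 0).2
  have a1 := S_bound (HD X hX) (by positivity) (fun α => H (f α) M (h1 α).1 (h1 α).2 X Y hX hXY)
  have a2 := S_bound (HD Y (hX.trans hXY)) (by positivity)
    (fun β => H (fun α => f α β) M (h2 β).1 (h2 β).2 X Y hX hXY)
  have c1 := S_comm X Y f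
  have c2 := S_comm Y Y f
  rw [← c1, ← c2] at a2
  have e : 2*D*C*M/Real.log X = D*(C*M/Real.log X) + D*(C*M/Real.log X) := by ring
  rw [e]
  exact (abs_sub_le _ _ _).trans (add_le_add a1 a2)

lemma S3_cauchy : ∃ C > 0, ∀ (f : ℝ → ℝ → ℝ → ℝ) (M : ℝ), (∀ α β, Adm M (f α β)) →
    (∀ α γ, Adm M (fun β => f α β γ)) → (∀ β γ, Adm M (fun α => f α β γ)) →
    ∀ X Y : ℝ, 2^20 ≤ X → X ≤ Y →
    |S X (fun α => S X (fun β => S X (f α β))) - S Y (fun α => S Y (fun β => S Y (f α β)))| ≤ C * M / Real.log X := by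
  obtain ⟨C, hC, H⟩ := S_cauchy
  obtain ⟨C2, hC2, H2⟩ := S2_cauchy
  obtain ⟨D, hD, HD⟩ := S_mass
  refine ⟨D*C2 + D*(D*C), by positivity, fun f M h1 h2 h3 X Y hX hXY => ?_⟩
  obtain ⟨hX1, hL⟩ := big_X hX
  have hM : 0 ≤ M := ((h1 0 0).1 0).1.trans ((h1 0 0).1 0).2
  have a1 := S_bound (HD X hX) (by positivity) (fun α => H2 (f α) M (h1 α) (fun β => h2 α β) X Y hX hXY)
  have a2 := S_bound (HD Y (hX.trans hXY)) (by positivity)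
    (fun β => S_bound (HD Y (hX.trans hXY)) (by positivity)
    (fun γ => H (fun α => f α β γ) M (h3 β γ).1 (h3 β γ).2 X Y hX hXY))
  have c : ∀ Z, S Z (fun α => S Y (fun β => S Y (fun γ => f α β γ))) = S Y (fun β => S Y (fun γ => S Z (fun α => f α β γ))) := by
    intro Z
    rw [S_comm Z Y (fun α β => S Y (fun γ => f α β γ))]
    congr 1; ext β
    rw [S_comm Z Y]
  have c1 := c X
  have c2 := c Y
  rw [← c1, ← c2] at a2
  have e : (D*C2 + D*(D*C))*M/Real.log X = D*(C2*M/Real.log X) + D*(D*(C*M/Real.log X)) := by ring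
  rw [e]
  exact (abs_sub_le _ _ _).trans (add_le_add a1 a2)

lemma lim_exists {Φ : ℝ → ℝ} {C : ℝ}
    (h : ∀ X Y : ℝ, 2^20 ≤ X → X ≤ Y → |Φ X - Φ Y| ≤ C / Real.log X) :
    ∃ K, ∀ X : ℝ, 2^20 ≤ X → |Φ X - K| ≤ C / Real.log X := by
  have ht : Tendsto (fun N : ℝ => C/Real.log (max N (2^20)) ) atTop (𝓝 0) := by
    have : Tendsto (fun N : ℝ => max N (2^20)) atTop atTop := tendsto_atTop_mono (fun N => le_max_left _ _) tendsto_id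
    exact (Real.tendsto_log_atTop.comp this).const_div_atTop C
  have ht2 := ht.const_mul 2
  rw [mul_zero] at ht2
  have hc : CauchySeq (fun t : ℝ => Φ (max t (2^20))) := by
    refine cauchySeq_of_le_tendsto_0 _ ?_ ht2
    intro n m N hn hm
    have h1 := h (max N (2^20)) (max n (2^20)) (le_max_right _ _) (max_le_max_right _ hn)
    have h2 := h (max N (2^20)) (max m (2^20)) (le_max_right _ _) (max_le_max_right _ hm)
    rw [Real.dist_eq]
    rw [abs_le] at *
    constructor <;> linarith
  obtain ⟨K, hK⟩ := cauchySeq_tendsto_of_complete hc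
  refine ⟨K, fun X hX => ?_⟩
  have hl : Tendsto (fun t : ℝ => |Φ X - Φ (max t (2^20))|) atTop (𝓝 |Φ X - K|) :=
    (tendsto_const_nhds.sub hK).abs
  refine le_of_tendsto hl ?_
  filter_upwards [eventually_ge_atTop X] with t ht
  exact h X _ hX (ht.trans (le_max_left _ _))

end PNTaux

namespace PNTaux
open Filter Topology Asymptotics

noncomputable def F1 (α β : ℝ) : ℝ := if W1 α β ∧ α + 2*β ≤ 1/2 then 1/(1/2 - (α + β)) else 0
noncomputable def F2 (α β : ℝ) : ℝ := if W2 α β ∧ α + 2*β ≤ 1/2 then 1/(1/2 - (α + β)) else 0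
noncomputable def F3 (α β γ : ℝ) : ℝ :=
  if (W1 α β ∧ β ≤ γ) ∧ α + β + 2*γ ≤ 1/2 then 1/(1/2 - (α + β + γ)) else 0

lemma adm_of (P : ℝ → Prop) [DecidablePred P] (g : ℝ → ℝ) {f : ℝ → ℝ} {m : ℝ} (hf : ∀ x, f x = if P x then 1/(g x) else 0) (hm : 0 < m) (hg : ∀ x y, x ≤ y → g y ≤ g x)
    (hP : ∀ x y z, P x → P z → x ≤ y → y ≤ z → P y) (hPg : ∀ x, P x → m ≤ g x) :
    Adm (1/m) f := by
  obtain rfl : f = fun x => if P x then 1/(g x) else 0 := funext hf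
  constructor
  · intro x
    dsimp only
    split_ifs with h
    · have := hPg x h
      exact ⟨by have : 0 < g x := by linarith
                positivity, one_div_le_one_div_of_le hm this⟩
    · exact ⟨le_rfl, by positivity⟩
  · intro t ht
    constructor
    rintro x hx z hz y ⟨hxy, hyz⟩
    simp only [Set.mem_ofPred_eq] at *
    have px : P x := by
      by_contra h; rw [if_neg h] at hx; linarith
    have pz : P z := by
      by_contra h; rw [if_neg h] at hz; linarith
    have py := hP x y z px pz hxy hyz
    rw [if_pos px] at hx
    rw [if_pos py]
    have h1 := hPg y py
    exact hx.trans_le (one_div_le_one_div_of_le (by linarith) (hg x y hxy))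

lemma tend_aux (M v1 v2 C : ℝ) :
    Tendsto (fun X : ℝ => M * ((v1 + C/Real.log X) * (v2 + C/Real.log X))) atTop (𝓝 (M * (v1*v2))) := by
  have h : Tendsto (fun X : ℝ => C/Real.log X) atTop (𝓝 0) := Real.tendsto_log_atTop.const_div_atTop C
  have := ((h.const_add v1).mul (h.const_add v2)).const_mul M
  simpa using this

lemma tend_aux3 (M v1 v2 v3 C : ℝ) :
    Tendsto (fun X : ℝ => M * ((v1 + C/Real.log X) * ((v2 + C/Real.log X)*(v3 + C/Real.log X)))) atTop (𝓝 (M * (v1*(v2*v3)))) := by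
  have h : Tendsto (fun X : ℝ => C/Real.log X) atTop (𝓝 0) := Real.tendsto_log_atTop.const_div_atTop C
  have := ((h.const_add v1).mul ((h.const_add v2).mul (h.const_add v3))).const_mul M
  simpa using this

lemma K_le {Φ U : ℝ → ℝ} {K C u : ℝ} (h : ∀ X : ℝ, 2^20 ≤ X → |Φ X - K| ≤ C / Real.log X)
    (hU : ∀ X : ℝ, 2^20 ≤ X → Φ X ≤ U X) (ht : Tendsto U atTop (𝓝 u)) : K ≤ u := by
  have h0 : Tendsto (fun X : ℝ => C/Real.log X) atTop (𝓝 0) := Real.tendsto_log_atTop.const_div_atTop C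
  have h1 := ht.add h0
  rw [add_zero] at h1
  refine ge_of_tendsto h1 ?_
  filter_upwards [eventually_ge_atTop (2^20)] with X hX
  have := (abs_le.mp (h X hX)).1
  linarith [hU X hX]

lemma ind_nonneg (A : Set ℝ) (x : ℝ) : 0 ≤ ind A x := by unfold ind; split_ifs <;> norm_num

lemma S2_le {X M v1 v2 c : ℝ} {A B : Set ℝ} {f : ℝ → ℝ → ℝ} (hM : 0 ≤ M) (h1 : S X (ind A) ≤ v1 + c)
    (h2 : S X (ind B) ≤ v2 + c)
    (hf : ∀ α β, f α β ≤ M * (ind A α * ind B β)) :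
    S X (fun α => S X (f α)) ≤ M * ((v1 + c)*(v2+c)) := by
  calc _ ≤ S X (fun α => S X (fun β => (M * ind A α) * ind B β)) := by
        apply S_mono; intro p _; apply S_mono; intro q _
        exact (hf _ _).trans (by rw [mul_assoc])
    _ = M * (S X (ind A) * S X (ind B)) := by
      simp only [S_mul]
      simp only [S, sum_mul, mul_sum]
      rw [sum_comm]
      apply sum_congr rfl; intro p _
      apply sum_congr rfl; intro q _
      ring
    _ ≤ _ := by
      have n1 := S_nonneg (X := X) (f := ind A) (fun p _ => ind_nonneg _ _)
      have n2 := S_nonneg (X := X) (f := ind B) (fun p _ => ind_nonneg _ _)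
      gcongr
      linarith

lemma F1_adm : (∀ α, Adm (14/3) (F1 α)) ∧ (∀ β, Adm (14/3) (fun α => F1 α β)) := by
  have e : (14/3:ℝ) = 1/(18/84) := by norm_num
  rw [e]
  constructor
  · intro α
    apply adm_of (fun x => W1 α x ∧ α + 2*x ≤ 1/2) (fun x => 1/2 - (α + x)) (fun x => rfl) (by norm_num)
    · intro x y h; linarith
    · rintro x y z ⟨⟨a1,a2,a3,a4⟩,a5⟩ ⟨⟨b1,b2,b3,b4⟩,b5⟩ h1 h2
      refine ⟨⟨?_,?_,?_,?_⟩,?_⟩ <;> linarith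
    · rintro x ⟨⟨a1,a2,a3,a4⟩,a5⟩; linarith
  · intro β
    apply adm_of (fun x => W1 x β ∧ x + 2*β ≤ 1/2) (fun x => 1/2 - (x + β)) (fun x => rfl) (by norm_num)
    · intro x y h; linarith
    · rintro x y z ⟨⟨a1,a2,a3,a4⟩,a5⟩ ⟨⟨b1,b2,b3,b4⟩,b5⟩ h1 h2
      refine ⟨⟨?_,?_,?_,?_⟩,?_⟩ <;> linarith
    · rintro x ⟨⟨a1,a2,a3,a4⟩,a5⟩; linarith

lemma F2_adm : (∀ α, Adm (28/3) (F2 α)) ∧ (∀ β, Adm (28/3) (fun α => F2 α β)) := by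
  have e : (28/3:ℝ) = 1/(9/84) := by norm_num
  rw [e]
  constructor
  · intro α
    apply adm_of (fun x => W2 α x ∧ α + 2*x ≤ 1/2) (fun x => 1/2 - (α + x)) (fun x => rfl) (by norm_num)
    · intro x y h; linarith
    · rintro x y z ⟨⟨a1,a2,a3,a4⟩,a5⟩ ⟨⟨b1,b2,b3,b4⟩,b5⟩ h1 h2
      refine ⟨⟨?_,?_,?_,?_⟩,?_⟩ <;> linarith
    · rintro x ⟨⟨a1,a2,a3,a4⟩,a5⟩; linarith
  · intro β
    apply adm_of (fun x => W2 x β ∧ x + 2*β ≤ 1/2) (fun x => 1/2 - (x + β)) (fun x => rfl) (by norm_num)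
    · intro x y h; linarith
    · rintro x y z ⟨⟨a1,a2,a3,a4⟩,a5⟩ ⟨⟨b1,b2,b3,b4⟩,b5⟩ h1 h2
      refine ⟨⟨?_,?_,?_,?_⟩,?_⟩ <;> linarith
    · rintro x ⟨⟨a1,a2,a3,a4⟩,a5⟩; linarith

lemma F3_adm : (∀ α β, Adm (28/3) (F3 α β)) ∧ (∀ α γ, Adm (28/3) (fun β => F3 α β γ)) ∧
    (∀ β γ, Adm (28/3) (fun α => F3 α β γ)) := by
  have e : (28/3:ℝ) = 1/(9/84) := by norm_num
  rw [e]
  refine ⟨fun α β => ?_, fun α γ => ?_, fun β γ => ?_⟩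
  · apply adm_of (fun x => (W1 α β ∧ β ≤ x) ∧ α + β + 2*x ≤ 1/2) (fun x => 1/2 - (α + β + x)) (fun x => rfl) (by norm_num)
    · intro x y h; linarith
    · rintro x y z ⟨⟨⟨a1,a2,a3,a4⟩,a5⟩,a6⟩ ⟨⟨⟨b1,b2,b3,b4⟩,b5⟩,b6⟩ h1 h2
      refine ⟨⟨⟨?_,?_,?_,?_⟩,?_⟩,?_⟩ <;> linarith
    · rintro x ⟨⟨⟨a1,a2,a3,a4⟩,a5⟩,a6⟩; linarith
  · apply adm_of (fun x => (W1 α x ∧ x ≤ γ) ∧ α + x + 2*γ ≤ 1/2) (fun x => 1/2 - (α + x + γ)) (fun x => rfl) (by norm_num)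
    · intro x y h; linarith
    · rintro x y z ⟨⟨⟨a1,a2,a3,a4⟩,a5⟩,a6⟩ ⟨⟨⟨b1,b2,b3,b4⟩,b5⟩,b6⟩ h1 h2
      refine ⟨⟨⟨?_,?_,?_,?_⟩,?_⟩,?_⟩ <;> linarith
    · rintro x ⟨⟨⟨a1,a2,a3,a4⟩,a5⟩,a6⟩; linarith
  · apply adm_of (fun x => (W1 x β ∧ β ≤ γ) ∧ x + β + 2*γ ≤ 1/2) (fun x => 1/2 - (x + β + γ)) (fun x => rfl) (by norm_num)
    · intro x y h; linarith
    · rintro x y z ⟨⟨⟨a1,a2,a3,a4⟩,a5⟩,a6⟩ ⟨⟨⟨b1,b2,b3,b4⟩,b5⟩,b6⟩ h1 h2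
      refine ⟨⟨⟨?_,?_,?_,?_⟩,?_⟩,?_⟩ <;> linarith
    · rintro x ⟨⟨⟨a1,a2,a3,a4⟩,a5⟩,a6⟩; linarith

lemma kernels : ∃ K1 K2 K3 C : ℝ, 0 < C ∧ K1 + K2 + K3 < 2 ∧ ∀ X : ℝ, 2^20 ≤ X →
    |S X (fun α => S X (F1 α)) - K1| ≤ C / Real.log X ∧
    |S X (fun α => S X (F2 α)) - K2| ≤ C / Real.log X ∧
    |S X (fun α => S X (fun β => S X (F3 α β))) - K3| ≤ C / Real.log X := by
  obtain ⟨C2, hC2, H2⟩ := S2_cauchy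
  obtain ⟨C3, hC3, H3⟩ := S3_cauchy
  obtain ⟨D, hD, HD⟩ := mass_Icc
  obtain ⟨K1, hK1⟩ := lim_exists (H2 F1 (14/3) F1_adm.1 F1_adm.2)
  obtain ⟨K2, hK2⟩ := lim_exists (H2 F2 (28/3) F2_adm.1 F2_adm.2)
  obtain ⟨K3, hK3⟩ := lim_exists (H3 F3 (28/3) F3_adm.1 F3_adm.2.1 F3_adm.2.2)
  have b1 : K1 ≤ 14/3 * (((12/84-10/84)/(10/84)) * ((12/84-9/84)/(9/84))) := by
    refine K_le hK1 ?_ (tend_aux _ _ _ D)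
    intro X hX
    refine S2_le (by norm_num) (HD X hX (10/84) (12/84) (by norm_num) (by norm_num) (by norm_num))
      (HD X hX (9/84) (12/84) (by norm_num) (by norm_num) (by norm_num)) ?_
    intro α β
    by_cases h : W1 α β ∧ α + 2*β ≤ 1/2
    · have := ((F1_adm.1 α).1 β).2
      obtain ⟨⟨a1,a2,a3,a4⟩,a5⟩ := h
      rw [ind, ind, if_pos ⟨by linarith, by linarith⟩, if_pos ⟨by linarith, by linarith⟩]
      linarith
    · rw [F1, if_neg h]
      exact mul_nonneg (by norm_num) (mul_nonneg (ind_nonneg _ _) (ind_nonneg _ _))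
  have b2 : K2 ≤ 28/3 * (((21/84-18/84)/(18/84)) * ((12/84-9/84)/(9/84))) := by
    refine K_le hK2 ?_ (tend_aux _ _ _ D)
    intro X hX
    refine S2_le (by norm_num) (HD X hX (18/84) (21/84) (by norm_num) (by norm_num) (by norm_num))
      (HD X hX (9/84) (12/84) (by norm_num) (by norm_num) (by norm_num)) ?_
    intro α β
    by_cases h : W2 α β ∧ α + 2*β ≤ 1/2
    · have := ((F2_adm.1 α).1 β).2
      obtain ⟨⟨a1,a2,a3,a4⟩,a5⟩ := h
      rw [ind, ind, if_pos ⟨by linarith, by linarith⟩, if_pos ⟨by linarith, by linarith⟩]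
      linarith
    · rw [F2, if_neg h]
      exact mul_nonneg (by norm_num) (mul_nonneg (ind_nonneg _ _) (ind_nonneg _ _))
  have b3 : K3 ≤ 28/3 * ((11/84-9/84)/(9/84)*(((12/84-10/84)/(10/84)) * ((12/84-9/84)/(9/84)))) := by
    refine K_le hK3 ?_ (tend_aux3 _ _ _ _ D)
    intro X hX
    obtain ⟨hX1, hL⟩ := big_X hX
    have hg := HD X hX (9/84) (11/84) (by norm_num) (by norm_num) (by norm_num)
    rw [← mul_assoc (28/3)]
    refine S2_le (by positivity) (HD X hX (10/84) (12/84) (by norm_num) (by norm_num) (by norm_num))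
      (HD X hX (9/84) (12/84) (by norm_num) (by norm_num) (by norm_num)) ?_
    intro α β
    calc S X (F3 α β) ≤ S X (fun γ => (28/3 * (ind (Set.Icc (10/84) (12/84)) α * ind (Set.Icc (9/84) (12/84)) β)) * ind (Set.Icc (9/84) (11/84)) γ) := by
          apply S_mono
          intro r _
          set γ := al X r
          by_cases h : (W1 α β ∧ β ≤ γ) ∧ α + β + 2*γ ≤ 1/2
          · have := ((F3_adm.1 α β).1 γ).2
            obtain ⟨⟨⟨a1,a2,a3,a4⟩,a5⟩,a6⟩ := h
            rw [ind, ind, ind, if_pos ⟨by linarith, by linarith⟩, if_pos ⟨by linarith, by linarith⟩,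
              if_pos ⟨by linarith, by linarith⟩]
            linarith
          · rw [F3, if_neg h]
            exact mul_nonneg (mul_nonneg (by norm_num) (mul_nonneg (ind_nonneg _ _) (ind_nonneg _ _))) (ind_nonneg _ _)
      _ = (28/3 * (ind (Set.Icc (10/84) (12/84)) α * ind (Set.Icc (9/84) (12/84)) β)) * S X (ind (Set.Icc (9/84) (11/84))) := S_mul
      _ ≤ (28/3 * (ind (Set.Icc (10/84) (12/84)) α * ind (Set.Icc (9/84) (12/84)) β)) * ((11/84-9/84)/(9/84) + D/Real.log X) := by
          apply mul_le_mul_of_nonneg_left hg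
          exact mul_nonneg (by norm_num) (mul_nonneg (ind_nonneg _ _) (ind_nonneg _ _))
      _ = _ := by ring
  refine ⟨K1, K2, K3, C2*(28/3) + C3*(28/3), by positivity, ?_, fun X hX => ?_⟩
  · norm_num at b1 b2 b3; linarith
  · obtain ⟨hX1, hL⟩ := big_X hX
    refine ⟨(hK1 X hX).trans ?_, (hK2 X hX).trans ?_, (hK3 X hX).trans ?_⟩ <;> gcongr <;> linarith

end PNTaux

namespace PNTaux
open Filter Topology Asymptotics

lemma cnt_al (η : ℝ) (hη : 0 < η) (hη1 : η < 1) : ∃ C > 0, ∃ X₀ ≥ 2, ∀ X ≥ X₀, ∀ a b d w δ ω : ℝ,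
    (η * X) ^ ((1:ℝ)/2) ≤ a → a ≤ b → b ≤ X ^ ((1:ℝ)/2) → d = X ^ δ → w = X ^ ω → 0 ≤ δ → 3/28 ≤ ω →
    |cnt a b d w - (1/d) * ((b-a)/Real.log X * if δ + ω ≤ 1/2 then 1/(1/2 - δ) else 0)| ≤
      (1/d) * (C * X ^ ((1:ℝ)/2) / (Real.log X)^2 + C * X ^ ((1:ℝ)/2) / Real.log X *
        ind (Set.Icc (1/2 + Real.log η/2/Real.log X) (1/2)) (δ + ω)) := by
  obtain ⟨C, hC, X₀, hX₀, H⟩ := cnt_asymp η hη hη1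
  refine ⟨C, hC, X₀, hX₀, fun X hX a b d w δ ω ha hab hb hd hw hδ hω => ?_⟩
  have hX1 : 1 < X := by linarith
  have hX0 : 0 < X := by linarith
  have hL : 0 < Real.log X := Real.log_pos hX1
  have h := H X hX a b d w ha hab hb (by rw [hd]; exact Real.one_le_rpow hX1.le hδ)
    (by rw [hw]; exact Real.rpow_le_rpow_of_exponent_le hX1.le hω)
  have e1 : d * w = X ^ (δ + ω) := by rw [hd, hw, Real.rpow_add hX0]
  have e2 : d * w ≤ X ^ ((1:ℝ)/2) ↔ δ + ω ≤ 1/2 := by rw [e1, Real.rpow_le_rpow_left_iff hX1]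
  have e3 : (η * X) ^ ((1:ℝ)/2) = X ^ (1/2 + Real.log η/2/Real.log X) := by
    rw [Real.rpow_def_of_pos (by positivity), Real.rpow_def_of_pos hX0, Real.log_mul hη.ne' hX0.ne']
    congr 1; field_simp; ring
  have e4 : (η * X) ^ ((1:ℝ)/2) ≤ d * w ↔ 1/2 + Real.log η/2/Real.log X ≤ δ + ω := by
    rw [e3, e1, Real.rpow_le_rpow_left_iff hX1]
  have e5 : Real.log (X ^ ((1:ℝ)/2) / d) = (1/2 - δ) * Real.log X := by
    rw [hd, ← Real.rpow_sub hX0, Real.log_rpow hX0]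
  simp only [e2, e4, e5] at h
  have hd0 : 0 < d := by rw [hd]; positivity
  have l1 : (1/d) * ((b-a)/Real.log X * if δ + ω ≤ 1/2 then 1/(1/2 - δ) else 0) =
     if δ + ω ≤ 1/2 then (b-a)/(d * ((1/2 - δ) * Real.log X)) else 0 := by
    split_ifs
    · rw [div_mul_div_comm, div_mul_div_comm]; congr 1 <;> ring
    · simp
  rw [l1]
  refine h.trans (le_of_eq ?_)
  simp only [ind, Set.mem_Icc]
  split_ifs <;> ring

lemma pair_bound {X a b C η D B : ℝ} {p q : ℕ} (hη : 0 < η) (hX : 2^20 ≤ X)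
    (ha : (η * X) ^ ((1:ℝ)/2) ≤ a) (hab : a ≤ b) (hb : b ≤ X ^ ((1:ℝ)/2)) (hC : 0 < C)
    (hcnt : ∀ d w δ ω : ℝ, d = X ^ δ → w = X ^ ω → 0 ≤ δ → 3/28 ≤ ω →
    |cnt a b d w - (1/d) * ((b-a)/Real.log X * if δ + ω ≤ 1/2 then 1/(1/2 - δ) else 0)| ≤
      (1/d) * (C * X ^ ((1:ℝ)/2) / (Real.log X)^2 + C * X ^ ((1:ℝ)/2) / Real.log X *
        ind (Set.Icc (1/2 + Real.log η/2/Real.log X) (1/2)) (δ + ω)))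
    (hD : S X (fun _ => 1) ≤ D)
    (hB : ∀ c, S X (fun γ => ind (Set.Icc (1/2 + Real.log η/2/Real.log X) (1/2)) (c + 2*γ)) ≤ B/Real.log X)
    (hp : p ∈ PX X) (hq : q ∈ PX X) :
    |(if W1 (al X p) (al X q) ∨ W2 (al X p) (al X q) then
      (if a ≤ (p:ℝ)*q ∧ (p:ℝ)*q ≤ b then 1 else 0) + (cnt a b (p*q) q +
        ∑ r ∈ PX X, if q ≤ r then cnt a b (p*q*r) r else 0) else 0) -
      1/(p:ℝ) * (1/(q:ℝ) * ((b-a)/Real.log X * (F1 (al X p) (al X q) + F2 (al X p) (al X q) + S X (F3 (al X p) (al X q)))))|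
    ≤ 1/(p:ℝ) * (1/(q:ℝ) * (X ^ ((1:ℝ)/2) *
        (ind (Set.Icc (1/4 + Real.log η/2/Real.log X) (1/4)) (al X p) * ind (Set.Icc (1/4 + Real.log η/2/Real.log X) (1/4)) (al X q))
        + C * X ^ ((1:ℝ)/2) / (Real.log X)^2 * (1 + D + B) +
        C * X ^ ((1:ℝ)/2) / Real.log X * ind (Set.Icc (1/2 + Real.log η/2/Real.log X) (1/2)) (al X p + 2 * al X q))) := by
  obtain ⟨hX1, hL⟩ := big_X hX
  have hX0 : 0 < X := by linarith
  obtain ⟨hpp, hp1, hp2⟩ := (mem_PX hX1).mp hp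
  obtain ⟨hqp, hq1, hq2⟩ := (mem_PX hX1).mp hq
  have hp0 : (0:ℝ) < p := by exact_mod_cast hpp.pos
  have hq0 : (0:ℝ) < q := by exact_mod_cast hqp.pos
  have epX := rpow_al hX1 hpp.ne_zero
  have eqX := rpow_al hX1 hqp.ne_zero
  set α := al X p
  set β := al X q
  set L := Real.log X
  set s := X ^ ((1:ℝ)/2)
  have hs : 0 < s := by positivity
  set J := ind (Set.Icc (1/2 + Real.log η/2/L) (1/2)) with hJ
  set I := ind (Set.Icc (1/4 + Real.log η/2/L) (1/4)) with hI
  set T := (b-a)/L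
  have hD0 : 0 ≤ D := (S_nonneg (fun _ _ => zero_le_one)).trans hD
  have hB0 : 0 ≤ B := by
    have : 0 ≤ B/L := (S_nonneg (fun _ _ => ind_nonneg _ _)).trans (hB 0)
    by_contra hc
    push Not at hc
    have := div_neg_of_neg_of_pos hc hL
    linarith
  by_cases hW : W1 α β ∨ W2 α β
  swap
  · push Not at hW
    have z1 : F1 α β = 0 := by rw [F1, if_neg (by tauto)]
    have z2 : F2 α β = 0 := by rw [F2, if_neg (by tauto)]
    have z3 : S X (F3 α β) = 0 := by
      rw [S, sum_eq_zero]; intro r _; rw [F3, if_neg (by tauto), mul_zero]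
    rw [if_neg (by tauto), z1, z2, z3]
    have i1 := ind_nonneg (Set.Icc (1/4 + Real.log η/2/L) (1/4)) α
    have i2 := ind_nonneg (Set.Icc (1/4 + Real.log η/2/L) (1/4)) β
    have i3 := ind_nonneg (Set.Icc (1/2 + Real.log η/2/L) (1/2)) (α + 2*β)
    simp only [add_zero, mul_zero, sub_zero, abs_zero]
    rw [← hI] at i1 i2
    rw [← hJ] at i3
    positivity
  rw [if_pos hW]
  have hβ : 3/28 ≤ β := by rcases hW with ⟨a1,a2,a3,a4⟩ | ⟨a1,a2,a3,a4⟩ <;> linarith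
  have hα : α ≤ 1/4 ∧ β < α := by rcases hW with ⟨a1,a2,a3,a4⟩ | ⟨a1,a2,a3,a4⟩ <;> constructor <;> linarith
  have epq : (p:ℝ) * q = X ^ (α + β) := by rw [Real.rpow_add hX0, epX, eqX]
  -- the k = 1 term
  have t1 : 0 ≤ (if a ≤ (p:ℝ)*q ∧ (p:ℝ)*q ≤ b then (1:ℝ) else 0) ∧
      (if a ≤ (p:ℝ)*q ∧ (p:ℝ)*q ≤ b then (1:ℝ) else 0) ≤ 1/(p:ℝ) * (1/(q:ℝ) * (s * (I α * I β))) := by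
    split_ifs with h
    · refine ⟨zero_le_one, ?_⟩
      have e3 : (η * X) ^ ((1:ℝ)/2) = X ^ (1/2 + Real.log η/2/L) := by
        rw [Real.rpow_def_of_pos (by positivity), Real.rpow_def_of_pos hX0, Real.log_mul hη.ne' hX0.ne']
        congr 1; field_simp; ring
      have h1 := ha.trans h.1
      rw [e3, epq, Real.rpow_le_rpow_left_iff hX1] at h1
      have i1 : I α = 1 := by rw [hI, ind, if_pos ⟨by linarith, hα.1⟩]
      have i2 : I β = 1 := by rw [hI, ind, if_pos ⟨by linarith, by linarith⟩]
      rw [i1, i2]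
      have h2 := h.2.trans hb
      have : 1/(p:ℝ) * (1/(q:ℝ) * (s * (1 * 1))) = s / (p*q) := by field_simp
      rw [this, le_div_iff₀ (by positivity)]; linarith
    · refine ⟨le_rfl, ?_⟩
      have i1 := ind_nonneg (Set.Icc (1/4 + Real.log η/2/L) (1/4)) α
      have i2 := ind_nonneg (Set.Icc (1/4 + Real.log η/2/L) (1/4)) β
      rw [← hI] at i1 i2
      positivity
  -- the two-prime term
  have t2 := hcnt (p*q) q (α+β) β epq eqX.symm (by linarith) hβ
  have f2 : (if α + β + β ≤ 1/2 then 1/(1/2 - (α+β)) else 0) = F1 α β + F2 α β := by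
    have e : α + β + β = α + 2*β := by ring
    rw [e, F1, F2]
    rcases hW with h | h
    · have : ¬ W2 α β := by
        rintro ⟨b1,b2,b3,b4⟩
        obtain ⟨a1,a2,a3,a4⟩ := h
        linarith
      simp [h, this]
    · have : ¬ W1 α β := by
        rintro ⟨b1,b2,b3,b4⟩
        obtain ⟨a1,a2,a3,a4⟩ := h
        linarith
      simp [h, this]
  have eJ : α + β + β = α + 2*β := by ring
  rw [f2, eJ] at t2
  -- the three-prime term
  have t3 : |(∑ r ∈ PX X, if q ≤ r then cnt a b (p*q*r) r else 0) - 1/((p:ℝ)*q) * (T * S X (F3 α β))| ≤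
      1/((p:ℝ)*q) * (C * s / L^2 * (D + B)) := by
    have e : 1/((p:ℝ)*q) * (T * S X (F3 α β)) = ∑ r ∈ PX X, 1/((p:ℝ)*q*r) * (T * F3 α β (al X r)) := by
      simp only [S, mul_sum]
      apply sum_congr rfl
      intro r _
      rw [one_div_mul_eq_div, one_div_mul_eq_div, one_div_mul_eq_div, ← div_div]
      ring
    rw [e, ← sum_sub_distrib]
    calc _ ≤ ∑ r ∈ PX X, |(if q ≤ r then cnt a b (p*q*r) r else 0) - 1/((p:ℝ)*q*r) * (T * F3 α β (al X r))| :=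
          abs_sum_le_sum_abs _ _
      _ ≤ ∑ r ∈ PX X, 1/((p:ℝ)*q*r) * (C * s / L^2 + C * s / L * J (α + β + 2 * al X r)) := by
          apply sum_le_sum
          intro r hr
          obtain ⟨hrp, hr1, hr2⟩ := (mem_PX hX1).mp hr
          have hr0 : (0:ℝ) < r := by exact_mod_cast hrp.pos
          have erX := rpow_al hX1 hrp.ne_zero
          have hqr := al_le_al hX1 hqp.ne_zero hrp.ne_zero
          set γ := al X r
          by_cases h : q ≤ r
          · have hβγ : β ≤ γ := by rw [← hqr]; exact_mod_cast h
            have epqr : (p:ℝ)*q*r = X ^ (α+β+γ) := by rw [Real.rpow_add hX0, ← epq, erX]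
            have := hcnt (p*q*r) r (α+β+γ) γ epqr erX.symm (by linarith) (by linarith)
            have eJ3 : α + β + γ + γ = α + β + 2*γ := by ring
            rw [eJ3] at this
            have f3 : (if α + β + 2*γ ≤ 1/2 then 1/(1/2 - (α+β+γ)) else 0) = F3 α β γ := by
              rw [F3]
              rcases hW with hw | hw
              · simp [hw, hβγ]
              · have : ¬ (α + β + 2*γ ≤ 1/2) := by
                  obtain ⟨a1,a2,a3,a4⟩ := hw
                  intro hc; linarith
                rw [if_neg this, if_neg (by tauto)]
            rw [f3] at this
            rw [if_pos h]; exact this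
          · have : F3 α β γ = 0 := by
              rw [F3, if_neg]
              rintro ⟨⟨_, hc⟩, _⟩
              rw [← hqr] at hc
              exact h (by exact_mod_cast hc)
            rw [if_neg h, this]
            have i3 := ind_nonneg (Set.Icc (1/2 + Real.log η/2/L) (1/2)) (α + β + 2*γ)
            rw [← hJ] at i3
            simp only [mul_zero, sub_zero, abs_zero]
            positivity
      _ = 1/((p:ℝ)*q) * (C * s / L^2 * S X (fun _ => 1) + C * s / L * S X (fun γ => J (α + β + 2 * γ))) := by
          simp only [S, mul_sum, ← sum_add_distrib]
          apply sum_congr rfl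
          intro r _
          rw [one_div_mul_eq_div, one_div_mul_eq_div, ← div_div]
          ring
      _ ≤ 1/((p:ℝ)*q) * (C * s / L^2 * D + C * s / L * (B/L)) := by
          have := hB (α + β)
          gcongr
      _ = _ := by congr 1; field_simp
  set E1 := (if a ≤ (p:ℝ)*q ∧ (p:ℝ)*q ≤ b then (1:ℝ) else 0)
  set N2 := cnt a b (p*q) q
  set N3 := ∑ r ∈ PX X, if q ≤ r then cnt a b (p*q*r) r else 0
  have g1 : 1/(p:ℝ) * (1/(q:ℝ) * (T * (F1 α β + F2 α β + S X (F3 α β)))) =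
     1/((p:ℝ)*q) * (T * (F1 α β + F2 α β)) + 1/((p:ℝ)*q) * (T * S X (F3 α β)) := by
    field_simp
  have g2 : 1/(p:ℝ) * (1/(q:ℝ) * (s * (I α * I β) + C * s / L^2 * (1 + D + B) + C * s / L * J (α + 2*β))) =
     1/(p:ℝ) * (1/(q:ℝ) * (s * (I α * I β))) + 1/((p:ℝ)*q) * (C * s/L^2 + C * s / L * J (α + 2*β)) +
     1/((p:ℝ)*q) * (C * s / L^2 * (D + B)) := by
    field_simp
    ring
  rw [g1, g2]
  rw [abs_le] at t2 t3 ⊢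
  constructor <;> linarith

end PNTaux

namespace PNTaux
open Filter Topology Asymptotics

lemma double_sum {X a b C η D B B' : ℝ} (hη : 0 < η) (hX : 2^20 ≤ X)
    (ha : (η * X) ^ ((1:ℝ)/2) ≤ a) (hab : a ≤ b) (hb : b ≤ X ^ ((1:ℝ)/2)) (hC : 0 < C)
    (hcnt : ∀ d w δ ω : ℝ, d = X ^ δ → w = X ^ ω → 0 ≤ δ → 3/28 ≤ ω →
    |cnt a b d w - (1/d) * ((b-a)/Real.log X * if δ + ω ≤ 1/2 then 1/(1/2 - δ) else 0)| ≤
      (1/d) * (C * X ^ ((1:ℝ)/2) / (Real.log X)^2 + C * X ^ ((1:ℝ)/2) / Real.log X *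
        ind (Set.Icc (1/2 + Real.log η/2/Real.log X) (1/2)) (δ + ω)))
    (hD : S X (fun _ => 1) ≤ D) (hB0 : 0 ≤ B) (hB0' : 0 ≤ B')
    (hB : ∀ c, S X (fun γ => ind (Set.Icc (1/2 + Real.log η/2/Real.log X) (1/2)) (c + 2*γ)) ≤ B/Real.log X)
    (hB' : S X (ind (Set.Icc (1/4 + Real.log η/2/Real.log X) (1/4))) ≤ B'/Real.log X) :
    |(∑ p ∈ PX X, ∑ q ∈ PX X, if W1 (al X p) (al X q) ∨ W2 (al X p) (al X q) then
      (if a ≤ (p:ℝ)*q ∧ (p:ℝ)*q ≤ b then 1 else 0) + (cnt a b (p*q) q +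
        ∑ r ∈ PX X, if q ≤ r then cnt a b (p*q*r) r else 0) else 0) -
      (b-a)/Real.log X * (S X (fun α => S X (F1 α)) + S X (fun α => S X (F2 α)) +
        S X (fun α => S X (fun β => S X (F3 α β))))|
    ≤ (B'^2 + C * (1+D+B) * D^2 + C * B * D) * X ^ ((1:ℝ)/2) / (Real.log X)^2 := by
  obtain ⟨hX1, hL⟩ := big_X hX
  have hX0 : 0 < X := by linarith
  have hD0 : 0 ≤ D := (S_nonneg (fun _ _ => zero_le_one)).trans hD
  have key := fun p (hp : p ∈ PX X) q (hq : q ∈ PX X) =>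
    pair_bound hη hX ha hab hb hC hcnt hD hB hp hq
  set L := Real.log X
  set s := X ^ ((1:ℝ)/2)
  have hs : 0 < s := by positivity
  set J := ind (Set.Icc (1/2 + Real.log η/2/L) (1/2)) with hJ
  set I := ind (Set.Icc (1/4 + Real.log η/2/L) (1/4)) with hI
  set T := (b-a)/L
  have hI0 : ∀ x, 0 ≤ I x := fun x => ind_nonneg _ _
  have hSI0 : 0 ≤ S X I := S_nonneg fun _ _ => hI0 _
  have e : T * (S X (fun α => S X (F1 α)) + S X (fun α => S X (F2 α)) +
        S X (fun α => S X (fun β => S X (F3 α β)))) =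
      ∑ p ∈ PX X, ∑ q ∈ PX X, 1/(p:ℝ) * (1/(q:ℝ) * (T * (F1 (al X p) (al X q) + F2 (al X p) (al X q) + S X (F3 (al X p) (al X q))))) := by
    have e1 : T * (S X (fun α => S X (F1 α)) + S X (fun α => S X (F2 α)) +
        S X (fun α => S X (fun β => S X (F3 α β)))) =
        S X (fun α => S X (fun β => T * (F1 α β + F2 α β + S X (F3 α β)))) := by
      simp only [S_mul, S_add]
    rw [e1]
    rw [S]
    apply sum_congr rfl; intro p _
    rw [S, mul_sum]
  rw [e, ← sum_sub_distrib]
  have step : |∑ p ∈ PX X, ((∑ q ∈ PX X, if W1 (al X p) (al X q) ∨ W2 (al X p) (al X q) then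
      (if a ≤ (p:ℝ)*q ∧ (p:ℝ)*q ≤ b then 1 else 0) + (cnt a b (p*q) q +
        ∑ r ∈ PX X, if q ≤ r then cnt a b (p*q*r) r else 0) else 0) -
      ∑ q ∈ PX X, 1/(p:ℝ) * (1/(q:ℝ) * (T * (F1 (al X p) (al X q) + F2 (al X p) (al X q) + S X (F3 (al X p) (al X q))))))|
      ≤ S X (fun α => S X (fun β => s * (I α * I β) + C * s / L^2 * (1 + D + B) + C * s / L * J (α + 2*β))) := by
    refine (abs_sum_le_sum_abs _ _).trans ?_
    rw [S]
    refine sum_le_sum fun p hp => ?_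
    rw [← sum_sub_distrib, S, mul_sum]
    refine (abs_sum_le_sum_abs _ _).trans (sum_le_sum fun q hq => key p hp q hq)
  refine step.trans ?_
  set Q := C * s / L^2 * (1 + D + B) with hQ
  have hQ0 : 0 ≤ Q := by positivity
  have in1 : ∀ α, S X (fun β => s * (I α * I β) + Q + C * s / L * J (α + 2*β)) ≤
      (s * (B'/L)) * I α + (Q * D + C * s / L * (B/L)) * 1 := by
    intro α
    have e2 : S X (fun β => s * (I α * I β) + Q + C * s / L * J (α + 2*β)) =
        s * (I α * S X I) + Q * S X (fun _ => 1) + C * s / L * S X (fun β => J (α + 2*β)) := by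
      rw [← S_mul (c := Q), ← S_mul (c := C * s / L), ← S_mul (c := I α), ← S_mul (c := s), ← S_add, ← S_add]
      simp only [mul_one]
    rw [e2]
    have b1 : s * (I α * S X I) ≤ s * (I α * (B'/L)) := by
      have := hI0 α
      gcongr
    have b2 : Q * S X (fun _ => 1) ≤ Q * D := by gcongr
    have b3 : C * s / L * S X (fun β => J (α + 2*β)) ≤ C * s / L * (B/L) := by
      have := hB α
      gcongr
    linarith
  calc _ ≤ S X (fun α => (s * (B'/L)) * I α + (Q * D + C * s / L * (B/L)) * 1) := S_mono fun p _ => in1 _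
    _ = (s * (B'/L)) * S X I + (Q * D + C * s / L * (B/L)) * S X (fun _ => 1) := by
        rw [← S_mul (c := Q * D + C * s / L * (B/L)), ← S_mul (c := s * (B'/L)), ← S_add]
    _ ≤ (s * (B'/L)) * (B'/L) + (Q * D + C * s / L * (B/L)) * D := by gcongr
    _ = _ := by rw [hQ]; field_simp; ring

lemma final (η : ℝ) (hη : 0 < η) (hη1 : η < 1) :
    ∃ κ > (0:ℝ), ∃ C > (0:ℝ), ∃ X₀ : ℝ, ∀ X ≥ X₀, ∀ a b : ℝ,
      (η * X) ^ ((1:ℝ)/2) ≤ a → a ≤ b → b ≤ X ^ ((1:ℝ)/2) →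
      |(∑ m ∈ Finset.Icc ⌈a⌉₊ ⌊b⌋₊, rho X m) - κ * (b - a) * (Real.log X)⁻¹|
        ≤ C * X ^ ((1:ℝ)/2) * (Real.log X)⁻¹ ^ 2 := by
  obtain ⟨K1, K2, K3, Ck, hCk, hK, HK⟩ := kernels
  obtain ⟨C0, hC0, X1, hX1, Hc⟩ := cnt_al η hη hη1
  obtain ⟨Cs, hCs, Hs⟩ := mass_short
  obtain ⟨D, hD1, HD⟩ := S_mass
  obtain ⟨h, hh⟩ : ∃ h, h = -(Real.log η/2) := ⟨_, rfl⟩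
  have hlog : Real.log η < 0 := Real.log_neg hη hη1
  have hh0 : 0 < h := by linarith
  have hle : Real.log η/2 = -h := by linarith
  set B := 10*h + Cs with hBdef
  set B' := 20*h + Cs with hBdef'
  have hB0 : 0 < B := by positivity
  have hB0' : 0 < B' := by positivity
  have hD0 : 0 < D := by linarith
  refine ⟨2 - K1 - K2 - K3, by linarith, C0 + (B'^2 + C0 * (1+D+B) * D^2 + C0 * B * D) + 3*Ck, by positivity,
    max X1 (max (2^20) (Real.exp (4*h+1))), fun X hX a b ha hab hb => ?_⟩
  have g1 : X1 ≤ X := (le_max_left _ _).trans hX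
  have g2 : 2^20 ≤ X := (le_max_left _ _).trans ((le_max_right _ _).trans hX)
  have g3 : Real.exp (4*h+1) ≤ X := (le_max_right _ _).trans ((le_max_right _ _).trans hX)
  obtain ⟨hX1, hL⟩ := big_X g2
  have hX0 : 0 < X := by linarith
  have hLh : 4*h < Real.log X := by
    have := (Real.le_log_iff_exp_le hX0).mpr g3
    linarith
  have hhL : h / Real.log X < 1/4 := by rw [div_lt_iff₀ hL]; linarith
  have e3 : (η * X) ^ ((1:ℝ)/2) = X ^ (1/2 + Real.log η/2/Real.log X) := by
    rw [Real.rpow_def_of_pos (by positivity), Real.rpow_def_of_pos hX0, Real.log_mul hη.ne' hX0.ne']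
    congr 1; field_simp; ring
  have ee : Real.log η/2/Real.log X = -(h/Real.log X) := by rw [hle, neg_div]
  have ha' : X ^ ((1:ℝ)/4) < a := by
    refine lt_of_lt_of_le ?_ ha
    rw [e3, Real.rpow_lt_rpow_left_iff hX1, ee]
    linarith
  have hcnt := fun d w δ ω => Hc X g1 a b d w δ ω ha hab hb
  have hB : ∀ c, S X (fun γ => ind (Set.Icc (1/2 + Real.log η/2/Real.log X) (1/2)) (c + 2*γ)) ≤ B/Real.log X := by
    intro c
    have e : (fun γ => ind (Set.Icc (1/2 + Real.log η/2/Real.log X) (1/2)) (c + 2*γ)) =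
        ind (Set.Icc ((1/2 + Real.log η/2/Real.log X - c)/2) ((1/2 - c)/2)) := by
      funext γ
      simp only [ind, Set.mem_Icc]
      congr 1
      apply propext
      constructor
      · rintro ⟨u, v⟩; constructor <;> linarith
      · rintro ⟨u, v⟩; constructor <;> linarith
    have hnn : 0 < h / Real.log X := by positivity
    rw [e]
    refine (Hs X g2 _ _ (by rw [ee]; linarith)).trans (le_of_eq ?_)
    rw [ee, hBdef]; ring
  have hB' : S X (ind (Set.Icc (1/4 + Real.log η/2/Real.log X) (1/4))) ≤ B'/Real.log X := by
    have hnn : 0 < h / Real.log X := by positivity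
    refine (Hs X g2 _ _ (by rw [ee]; linarith)).trans (le_of_eq ?_)
    rw [ee, hBdef']; ring
  have dbl := double_sum hη g2 ha hab hb hC0 hcnt (HD X g2) hB0.le hB0'.le hB hB'
  have hA := hcnt 1 (X ^ ((3:ℝ)/28)) 0 (3/28) (Real.rpow_zero X).symm rfl le_rfl le_rfl
  have hind : ind (Set.Icc (1/2 + Real.log η/2/Real.log X) (1/2)) (0 + 3/28) = 0 := by
    rw [ind, if_neg]
    rintro ⟨u, -⟩
    rw [ee] at u
    linarith
  rw [hind, if_pos (by norm_num)] at hA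
  obtain ⟨k1, k2, k3⟩ := HK X g2
  rw [rho_sum hX1 ha' hb]
  set DS := ∑ p ∈ PX X, ∑ q ∈ PX X, if W1 (al X p) (al X q) ∨ W2 (al X p) (al X q) then
      (if a ≤ (p:ℝ)*q ∧ (p:ℝ)*q ≤ b then (1:ℝ) else 0) + (cnt a b (p*q) q +
        ∑ r ∈ PX X, if q ≤ r then cnt a b (p*q*r) r else 0) else 0
  set P1 := S X (fun α => S X (F1 α))
  set P2 := S X (fun α => S X (F2 α))
  set P3 := S X (fun α => S X (fun β => S X (F3 α β)))
  set N := cnt a b 1 (X ^ ((3:ℝ)/28))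
  set s := X ^ ((1:ℝ)/2) with hsdef
  set L := Real.log X
  set T := (b-a)/L with hT
  have hs : 0 < s := by positivity
  have ha0 : 0 ≤ a := le_trans (by positivity) ha
  have hT0 : 0 ≤ T := div_nonneg (by linarith) hL.le
  have hTs : T ≤ s/L := by rw [hT]; gcongr; linarith
  have hk : |T * (P1 + P2 + P3) - T * (K1 + K2 + K3)| ≤ 3*Ck * s / L^2 := by
    rw [← mul_sub, abs_mul, abs_of_nonneg hT0]
    have : |P1 + P2 + P3 - (K1 + K2 + K3)| ≤ 3 * (Ck/L) := by
      rw [abs_le] at k1 k2 k3 ⊢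
      constructor <;> linarith
    calc _ ≤ s/L * (3 * (Ck/L)) := by gcongr
      _ = _ := by field_simp
  have eA : (1:ℝ)/1 * (T * (1/(1/2 - 0))) = 2*T := by ring
  have eA2 : (1:ℝ)/1 * (C0 * s / L^2 + C0 * s / L * 0) = C0 * s / L^2 := by ring
  rw [eA, eA2] at hA
  have r1 : (2 - K1 - K2 - K3) * (b-a) * L⁻¹ = 2*T - T * (K1 + K2 + K3) := by
    rw [hT]; field_simp; ring
  have r2 : (C0 + (B'^2 + C0 * (1+D+B) * D^2 + C0 * B * D) + 3*Ck) * s * L⁻¹^2 =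
      C0 * s / L^2 + (B'^2 + C0 * (1+D+B) * D^2 + C0 * B * D) * s / L^2 + 3*Ck*s/L^2 := by
    field_simp
  rw [r1, r2]
  rw [abs_le] at hA dbl hk ⊢
  constructor <;> linarith

end PNTaux

theorem rho_sum_asymptotic (η : ℝ) (hη : 0 < η) (hη1 : η < 1) :
    ∃ κ > (0:ℝ), ∃ C > (0:ℝ), ∃ X₀ : ℝ, ∀ X ≥ X₀, ∀ a b : ℝ,
      (η * X) ^ ((1:ℝ)/2) ≤ a → a ≤ b → b ≤ X ^ ((1:ℝ)/2) →
      |(∑ m ∈ Finset.Icc ⌈a⌉₊ ⌊b⌋₊, rho X m) - κ * (b - a) * (Real.log X)⁻¹|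
        ≤ C * X ^ ((1:ℝ)/2) * (Real.log X)⁻¹ ^ 2 := by
  exact PNTaux.final η hη hη1
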